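/- arXiv:2010.13079 — 2 statements merged into one kernel-verified Lean document; each statement's English description precedes it below -/
import Mathlib

section
/- Let q = p^e be a power of a prime with q ≡ 1 (mod 5) and set t = (q-1)/5. For every λ ∈ 𝔽_q with λ ≠ 0 and λ⁵ ≠ 1, the number of 𝔽_q-rational points on the Dwork hypersurface X_λ⁵ satisfies: #X_λ⁵(𝔽_q) = (q⁴-1)/(q-1) + q³·₄F₃(ω^t,ω^{2t},ω^{3t},ω^{4t}; ε,ε,ε | 1/λ⁵)_q + 20·q²·₂F₁(ω^{2t},ω^{3t}; ε | 1/λ⁵)_q + 20·q²·₂F₁(ω^t,ω^{4t}; ε | 1/λ⁵)_q + 30·q²·₂F₁(ω^t,ω^{3t}; ω^{4t} | 1/λ⁵)_q + 30·q²·₂F₁(ω^t,ω^{2t}; ω^{3t} | 1/λ⁵)_q. -/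
open scoped Classical

noncomputable section

/-- The Gauss sum `g(χ) = ∑ₓ χ(x) exp(2π√-1 · tr(x)/p)` of a multiplicative character `χ`
of a finite field `F` of characteristic `p`, where `tr : F → 𝔽_p` is the trace map. -/
def gaussChar (p : ℕ) (F : Type) [Field F] [Fintype F] [Algebra (ZMod p) F]
    (χ : MulChar F ℂ) : ℂ :=
  ∑ x : F, χ x *
    Complex.exp (2 * Real.pi * Complex.I * ((Algebra.trace (ZMod p) F x).val : ℂ) / (p : ℂ))

/-- The Jacobi sum `J(χ₁, …, χₙ) = ∑_{x₁ + ⋯ + xₙ = 1} χ₁(x₁) ⋯ χₙ(xₙ)`. -/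
def jacobiS (F : Type) [Field F] [Fintype F] {n : ℕ} (χ : Fin n → MulChar F ℂ) : ℂ :=
  ∑ v ∈ Finset.univ.filter (fun v : Fin n → F => ∑ i, v i = 1), ∏ i, χ i (v i)

/-- The normalized Jacobi sum `binom(A; B) = (B(-1)/q) · J(A, B̄)`. -/
def gBinom (F : Type) [Field F] [Fintype F] (A B : MulChar F ℂ) : ℂ :=
  B (-1) / (Fintype.card F : ℂ) * jacobiS F ![A, B⁻¹]

/-- Greene's finite-field hypergeometric function `ₙ₊₁Fₙ` (case `n ≥ 2`), where the sum over all
multiplicative characters is written as a sum over the powers `ω^j`, `0 ≤ j ≤ q - 2`, of a fixed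
generator `ω` of the character group. -/
def greeneF (F : Type) [Field F] [Fintype F] (ω : MulChar F ℂ) {n : ℕ}
    (A : Fin (n + 1) → MulChar F ℂ) (B : Fin n → MulChar F ℂ) (x : F) : ℂ :=
  (Fintype.card F : ℂ) / ((Fintype.card F : ℂ) - 1) *
    ∑ j ∈ Finset.range (Fintype.card F - 1),
      gBinom F (A 0 * ω ^ j) (ω ^ j) *
        (∏ i : Fin n, gBinom F (A i.succ * ω ^ j) (B i * ω ^ j)) * (ω ^ j) x

/-- Greene's finite-field hypergeometric function `₂F₁` (case `n = 1`):
`₂F₁(A₀, A₁; B₁ | x) = ε(x) · (A₁B₁(-1)/q) · ∑_y A₁(y) (A̅₁B₁)(1-y) A̅₀(1-xy)`. -/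
def greene2F1 (F : Type) [Field F] [Fintype F] (A₀ A₁ B₁ : MulChar F ℂ) (x : F) : ℂ :=
  (1 : MulChar F ℂ) x * ((A₁ * B₁) (-1) / (Fintype.card F : ℂ)) *
    ∑ y : F, A₁ y * (A₁⁻¹ * B₁) (1 - y) * A₀⁻¹ (1 - x * y)

/-- The number of `F`-rational points of the Dwork hypersurface
`x₁^d + ⋯ + x_d^d = dλ x₁ ⋯ x_d` in projective space. -/
def dworkCount (F : Type) [Field F] [Fintype F] (d : ℕ) (lam : F) : ℕ :=
  Nat.card {P : Projectivization F (Fin d → F) //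
    ∑ i, P.rep i ^ d = (d : F) * lam * ∏ i, P.rep i}

/-- The number of `F`-rational points of the diagonal hypersurface
`x₁^d + ⋯ + xₙ^d = dλ x₁^{h₁} ⋯ xₙ^{hₙ}` in projective space. -/
def diagCount (F : Type) [Field F] [Fintype F] (d n : ℕ) (h : Fin n → ℕ) (lam : F) : ℕ :=
  Nat.card {P : Projectivization F (Fin n → F) //
    ∑ i, P.rep i ^ d = (d : F) * lam * ∏ i, P.rep i ^ h i}

/-- The quantity `N_q(0, w)` from Koblitz's formula, with `t = (q - 1)/d`. -/
def NqW (p : ℕ) (F : Type) [Field F] [Fintype F] [Algebra (ZMod p) F]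
    (ω : MulChar F ℂ) (d : ℕ) {n : ℕ} (w : Fin n → ZMod d) : ℂ :=
  if ∀ i, w i = 0 then ((Fintype.card F : ℂ) ^ (n - 1) - 1) / ((Fintype.card F : ℂ) - 1)
  else if ∀ i, w i ≠ 0 then
    (1 / (Fintype.card F : ℂ)) *
      ∏ i, gaussChar p F (ω ^ ((w i).val * ((Fintype.card F - 1) / d)))
  else 0

/-- The quantity `S_{[w]} = (q-1)⁻¹ ∑_{j=0}^{q-2} (∏ᵢ g(ω^{wᵢt + hᵢj}) / g(ω^{dj})) ω^{dj}(dλ)`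
from Koblitz's formula, with `t = (q - 1)/d`. -/
def SW (p : ℕ) (F : Type) [Field F] [Fintype F] [Algebra (ZMod p) F]
    (ω : MulChar F ℂ) (d : ℕ) {n : ℕ} (h : Fin n → ℕ) (w : Fin n → ZMod d) (lam : F) : ℂ :=
  ((Fintype.card F : ℂ) - 1)⁻¹ *
    ∑ j ∈ Finset.range (Fintype.card F - 1),
      (∏ i, gaussChar p F (ω ^ ((w i).val * ((Fintype.card F - 1) / d) + h i * j))) /
          gaussChar p F (ω ^ (d * j)) * (ω ^ (d * j)) ((d : F) * lam)

end


noncomputable section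
namespace DworkFive

section Orbits
variable {Ω : Type*}

/-- The multiset `{α, φ α, …, φ^(k-1) α}`. -/
def orb (φ : Ω → Ω) (k : ℕ) (α : Ω) : Multiset Ω :=
  (Multiset.range k).map (fun i => φ^[i] α)

lemma card_orb (φ : Ω → Ω) (k : ℕ) (α : Ω) : (orb φ k α).card = k := by
  simp [orb]

lemma orb_add (φ : Ω → Ω) (k l : ℕ) (α : Ω) :
    orb φ (k + l) α = orb φ k α + orb φ l (φ^[k] α) := by
  unfold orb
  rw [Multiset.range_add, Multiset.map_add, Multiset.map_map]
  congr 1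
  refine Multiset.map_congr rfl fun i _ => ?_
  simp only [Function.comp]
  rw [add_comm, Function.iterate_add_apply]

lemma orb_mul (φ : Ω → Ω) (d j : ℕ) (α : Ω) (h : φ^[d] α = α) :
    orb φ (j * d) α = j • orb φ d α := by
  induction j with
  | zero => simp [orb]
  | succ j ih =>
    rw [add_mul, one_mul, add_comm, orb_add, h, ih, add_comm j 1, add_smul, one_smul]

lemma mem_orb {φ : Ω → Ω} {k : ℕ} (hk : 1 ≤ k) (α : Ω) : α ∈ orb φ k α := by
  unfold orb
  rw [Multiset.mem_map]
  exact ⟨0, Multiset.mem_range.2 hk, rfl⟩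

lemma orb_map {φ : Ω → Ω} {k : ℕ} {α : Ω} (h : φ^[k] α = α) :
    (orb φ k α).map φ = orb φ k α := by
  have h1 := orb_add φ 1 k α
  have h2 := orb_add φ k 1 α
  rw [add_comm 1 k, h2, h] at h1
  have h3 : orb φ 1 α = {α} := by simp [orb]
  rw [h3, add_comm, add_left_cancel_iff] at h1
  conv_rhs => rw [h1]
  unfold orb
  rw [Multiset.map_map]
  refine Multiset.map_congr rfl fun i _ => ?_
  simp only [Function.comp, Function.iterate_one]
  exact (Function.iterate_succ_apply' φ i α).symm.trans (Function.iterate_succ_apply φ i α)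

lemma count_iterate {φ : Ω → Ω} (hφ : Function.Injective φ) {s : Multiset Ω}
    (hs : s.map φ = s) (i : ℕ) (α : Ω) : s.count (φ^[i] α) = s.count α := by
  induction i with
  | zero => rfl
  | succ i ih =>
    rw [Function.iterate_succ_apply', ← ih]
    conv_lhs => rw [← hs]
    exact Multiset.count_map_eq_count' φ s hφ _

lemma minPeriod_pos {φ : Ω → Ω} (hφ : Function.Injective φ) {s : Multiset Ω}
    (hs : s.map φ = s) {α : Ω} (hα : α ∈ s) : 0 < Function.minimalPeriod φ α := by
  apply Function.minimalPeriod_pos_of_mem_periodicPts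
  by_contra hcon
  have hinj : Function.Injective (fun i : ℕ => φ^[i] α) := by
    intro i j hij
    by_contra hne
    rcases lt_or_gt_of_ne hne with hlt | hlt
    · refine hcon ⟨j - i, by omega, ?_⟩
      have : φ^[i] (φ^[j - i] α) = φ^[i] α := by
        rw [← Function.iterate_add_apply, Nat.add_sub_cancel' hlt.le]; exact hij.symm
      exact hφ.iterate i this
    · refine hcon ⟨i - j, by omega, ?_⟩
      have : φ^[j] (φ^[i - j] α) = φ^[j] α := by
        rw [← Function.iterate_add_apply, Nat.add_sub_cancel' hlt.le]; exact hij
      exact hφ.iterate j this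
  have hmem : ∀ i : ℕ, φ^[i] α ∈ (s.toFinset : Set Ω) := by
    intro i
    simp only [Finset.mem_coe, Multiset.mem_toFinset]
    rw [← Multiset.count_pos, count_iterate hφ hs, Multiset.count_pos]
    exact hα
  exact (Set.infinite_of_injective_forall_mem hinj hmem) s.toFinset.finite_toSet

lemma count_periods {φ : Ω → Ω} (hφ : Function.Injective φ) {s : Multiset Ω}
    (hs : s.map φ = s) {α : Ω} (hα : α ∈ s) :
    ((Finset.Icc 1 s.card).filter (fun k => φ^[k] α = α ∧ orb φ k α ≤ s)).card = s.count α := by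
  set d := Function.minimalPeriod φ α with hd
  have hdpos : 0 < d := minPeriod_pos hφ hs hα
  have hper : φ^[d] α = α := Function.iterate_minimalPeriod
  have hnd : (orb φ d α).Nodup := by
    unfold orb
    refine (Multiset.nodup_map_iff_inj_on (Multiset.nodup_range d)).2 ?_
    intro x hx y hy hxy
    rw [Multiset.mem_range] at hx hy
    exact Function.iterate_injOn_Iio_minimalPeriod hx hy hxy
  have key : ∀ j, j • orb φ d α ≤ s ↔ j ≤ s.count α := by
    intro j
    rw [Multiset.le_iff_count]
    constructor
    · intro h
      have := h α
      rw [Multiset.count_nsmul, Multiset.count_eq_one_of_mem hnd (mem_orb hdpos α)] at this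
      simpa using this
    · intro h β
      rw [Multiset.count_nsmul]
      by_cases hβ : β ∈ orb φ d α
      · rw [Multiset.count_eq_one_of_mem hnd hβ, mul_one]
        unfold orb at hβ
        rw [Multiset.mem_map] at hβ
        obtain ⟨i, _, rfl⟩ := hβ
        rw [count_iterate hφ hs]; exact h
      · rw [Multiset.count_eq_zero_of_notMem hβ]; simp
  have himg : (Finset.Icc 1 s.card).filter (fun k => φ^[k] α = α ∧ orb φ k α ≤ s)
      = (Finset.Icc 1 (s.count α)).image (fun j => j * d) := by
    ext k
    simp only [Finset.mem_filter, Finset.mem_Icc, Finset.mem_image]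
    constructor
    · rintro ⟨⟨h1, h2⟩, h3, h4⟩
      have hdvd : d ∣ k := Function.IsPeriodicPt.minimalPeriod_dvd h3
      obtain ⟨j, rfl⟩ := hdvd
      rw [mul_comm d j, orb_mul _ _ _ _ hper, key] at h4
      refine ⟨j, ⟨?_, h4⟩, mul_comm _ _⟩
      rcases Nat.eq_zero_or_pos j with rfl | hj
      · simp at h1
      · exact hj
    · rintro ⟨j, ⟨h1, h2⟩, rfl⟩
      have hle : orb φ (j * d) α ≤ s := by rw [orb_mul _ _ _ _ hper, key]; exact h2
      refine ⟨⟨Nat.mul_pos h1 hdpos, ?_⟩, ?_, hle⟩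
      · have := Multiset.card_le_card hle
        rwa [card_orb] at this
      · have : Function.IsPeriodicPt φ d α := hper
        exact this.const_mul j
  rw [himg, Finset.card_image_of_injective]
  · simp
  · intro a b hab
    exact Nat.eq_of_mul_eq_mul_right hdpos hab

theorem orbit_recursion {φ : Ω → Ω} (hφ : Function.Injective φ)
    (D : ℕ → Finset (Multiset Ω)) (hD : ∀ n s, s ∈ D n ↔ s.card = n ∧ s.map φ = s)
    (E : ℕ → Finset Ω) (hE : ∀ k, 1 ≤ k → ∀ α, α ∈ E k ↔ φ^[k] α = α)
    (h : Multiset Ω → ℂ)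
    (hmul : ∀ s t : Multiset Ω, s.map φ = s → t.map φ = t → h (s + t) = h s * h t) (n : ℕ) :
    (n : ℂ) * ∑ s ∈ D n, h s =
      ∑ k ∈ Finset.Icc 1 n, (∑ α ∈ E k, h (orb φ k α)) * ∑ s ∈ D (n - k), h s := by
  have step1 : ∀ k ∈ Finset.Icc 1 n, (∑ α ∈ E k, h (orb φ k α)) * ∑ s ∈ D (n - k), h s
      = ∑ s ∈ D n, ∑ α ∈ s.toFinset, if φ^[k] α = α ∧ orb φ k α ≤ s then h s else 0 := by
    intro k hk
    rw [Finset.mem_Icc] at hk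
    have e1 : ∀ s ∈ D n, (∑ α ∈ s.toFinset, if φ^[k] α = α ∧ orb φ k α ≤ s then h s else 0)
        = ∑ α ∈ E k, if orb φ k α ≤ s then h s else 0 := by
      intro s _
      rw [← Finset.sum_filter, ← Finset.sum_filter]
      refine Finset.sum_congr ?_ fun _ _ => rfl
      ext α
      simp only [Finset.mem_filter, Multiset.mem_toFinset, hE k hk.1]
      constructor
      · rintro ⟨_, h1, h2⟩; exact ⟨h1, h2⟩
      · rintro ⟨h1, h2⟩; exact ⟨Multiset.mem_of_le h2 (mem_orb hk.1 α), h1, h2⟩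
    rw [Finset.sum_congr rfl e1, Finset.sum_comm, Finset.sum_mul]
    refine Finset.sum_congr rfl fun α hα => ?_
    rw [hE k hk.1] at hα
    rw [Finset.mul_sum, ← Finset.sum_filter]
    have hom := orb_map hα
    refine Finset.sum_bij (fun s _ => orb φ k α + s) ?_ ?_ ?_ ?_
    · intro s hs
      rw [hD] at hs
      rw [Finset.mem_filter, hD]
      refine ⟨⟨?_, ?_⟩, Multiset.le_add_right _ _⟩
      · rw [Multiset.card_add, card_orb, hs.1]; omega
      · rw [Multiset.map_add, hom, hs.2]
    · intro s _ t _ hst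
      exact add_left_cancel hst
    · intro s hs
      rw [Finset.mem_filter, hD] at hs
      obtain ⟨u, hu⟩ := Multiset.le_iff_exists_add.1 hs.2
      refine ⟨u, ?_, hu.symm⟩
      rw [hD]
      constructor
      · have := hs.1.1
        rw [hu, Multiset.card_add, card_orb] at this
        omega
      · have := hs.1.2
        rw [hu, Multiset.map_add, hom] at this
        exact add_left_cancel this
    · intro s hs
      rw [hD] at hs
      exact (hmul _ _ hom hs.2).symm
  rw [Finset.sum_congr rfl step1, Finset.sum_comm, Finset.mul_sum]
  refine Finset.sum_congr rfl fun s hs => ?_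
  rw [hD] at hs
  rw [Finset.sum_comm]
  have e2 : ∀ α ∈ s.toFinset, (∑ k ∈ Finset.Icc 1 n,
      if φ^[k] α = α ∧ orb φ k α ≤ s then h s else 0) = (s.count α : ℂ) * h s := by
    intro α hα
    rw [Multiset.mem_toFinset] at hα
    rw [← Finset.sum_filter, Finset.sum_const, ← hs.1, count_periods hφ hs.2 hα, nsmul_eq_mul]
  rw [Finset.sum_congr rfl e2, ← Finset.sum_mul, ← Nat.cast_sum, Multiset.toFinset_sum_count_eq,
    hs.1]

/-- A sequence is determined by its Newton-type recursion. -/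
lemma rec_unique (a b S : ℕ → ℂ) (h0 : a 0 = b 0)
    (ha : ∀ n : ℕ, (n : ℂ) * a n = ∑ k ∈ Finset.Icc 1 n, S k * a (n - k))
    (hb : ∀ n : ℕ, (n : ℂ) * b n = ∑ k ∈ Finset.Icc 1 n, S k * b (n - k)) (n : ℕ) : a n = b n := by
  induction n using Nat.strong_induction_on with
  | _ n ih =>
    rcases Nat.eq_zero_or_pos n with rfl | hn
    · exact h0
    · have hn' : (n : ℂ) ≠ 0 := by exact_mod_cast hn.ne'
      apply mul_left_cancel₀ hn'
      rw [ha, hb]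
      refine Finset.sum_congr rfl fun k hk => ?_
      rw [Finset.mem_Icc] at hk
      rw [ih (n - k) (by omega)]

end Orbits
end DworkFive
end

noncomputable section
namespace DworkFive

set_option linter.unusedSectionVars false
section Divisors
open Polynomial
variable (F : Type) [Field F] [Fintype F] (Ω : Type) [Field Ω] [Algebra F Ω] [IsAlgClosed Ω]

/-- The `q`-power Frobenius on `Ω`. -/
def frb : Ω →+* Ω := (FiniteField.frobeniusAlgHom F Ω).toRingHom

lemma frb_apply (x : Ω) : frb F Ω x = x ^ Fintype.card F := rfl

lemma frb_inj : Function.Injective (frb F Ω) := (frb F Ω).injective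

lemma frb_iter (k : ℕ) (x : Ω) : (frb F Ω)^[k] x = x ^ (Fintype.card F ^ k) := by
  induction k with
  | zero => simp
  | succ k ih => rw [Function.iterate_succ_apply', ih, frb_apply, ← pow_mul, ← pow_succ]

lemma frb_algebraMap (a : F) : frb F Ω (algebraMap F Ω a) = algebraMap F Ω a :=
  (FiniteField.frobeniusAlgHom F Ω).commutes a

lemma exists_of_frb_fixed {x : Ω} (hx : frb F Ω x = x) : ∃ a : F, algebraMap F Ω a = x := by
  have hne : (X ^ Fintype.card F - X : Polynomial Ω) ≠ 0 :=
    FiniteField.X_pow_card_sub_X_ne_zero Ω Fintype.one_lt_card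
  have hsub : (Finset.univ.image (algebraMap F Ω)) ⊆ (X ^ Fintype.card F - X : Polynomial Ω).roots.toFinset := by
    intro y hy
    obtain ⟨a, _, rfl⟩ := Finset.mem_image.1 hy
    rw [Multiset.mem_toFinset, mem_roots hne]
    have := frb_algebraMap F Ω a
    rw [frb_apply] at this
    simp [IsRoot, this]
  have hcard : (X ^ Fintype.card F - X : Polynomial Ω).roots.toFinset.card ≤
      (Finset.univ.image (algebraMap F Ω)).card := by
    rw [Finset.card_image_of_injective _ (algebraMap F Ω).injective, Finset.card_univ]
    refine (Multiset.toFinset_card_le _).trans ((card_roots' _).trans ?_)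
    rw [FiniteField.X_pow_card_sub_X_natDegree_eq Ω Fintype.one_lt_card]
  have heq := Finset.eq_of_subset_of_card_le hsub hcard
  have hmem : x ∈ (X ^ Fintype.card F - X : Polynomial Ω).roots.toFinset := by
    rw [Multiset.mem_toFinset, mem_roots hne]
    rw [frb_apply] at hx
    simp [IsRoot, hx]
  rw [← heq] at hmem
  obtain ⟨a, _, h⟩ := Finset.mem_image.1 hmem
  exact ⟨a, h⟩

/-- A left inverse of the inclusion of `F` in `Ω`. -/
def down (x : Ω) : F := Function.invFun (algebraMap F Ω) x

lemma down_algebraMap (a : F) : down F Ω (algebraMap F Ω a) = a :=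
  Function.leftInverse_invFun (algebraMap F Ω).injective a

lemma algebraMap_down {x : Ω} (hx : frb F Ω x = x) : algebraMap F Ω (down F Ω x) = x := by
  obtain ⟨a, rfl⟩ := exists_of_frb_fixed F Ω hx
  rw [down_algebraMap]

/-- The monic polynomial with given lower coefficients. -/
def polyOf {n : ℕ} (v : Fin n → F) : F[X] := X ^ n + ∑ i : Fin n, C (v i) * X ^ (i : ℕ)

lemma polyOf_monic {n : ℕ} (v : Fin n → F) : (polyOf F v).Monic :=
  monic_X_pow_add (degree_sum_fin_lt v)

lemma polyOf_natDegree {n : ℕ} (v : Fin n → F) : (polyOf F v).natDegree = n := by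
  unfold polyOf
  apply natDegree_eq_of_degree_eq_some
  rw [degree_add_eq_left_of_degree_lt]
  · exact degree_X_pow n
  · rw [degree_X_pow]; exact degree_sum_fin_lt v

lemma polyOf_coeff {n : ℕ} (v : Fin n → F) (i : Fin n) : (polyOf F v).coeff i = v i := by
  unfold polyOf
  rw [coeff_add, coeff_X_pow, if_neg (ne_of_lt i.2), zero_add, finsetSum_coeff]
  simp only [coeff_C_mul, coeff_X_pow]
  rw [Finset.sum_eq_single i]
  · simp
  · intro b _ hb
    rw [if_neg, mul_zero]
    exact fun h => hb (Fin.ext h.symm)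
  · simp

lemma polyOf_surj {n : ℕ} {f : F[X]} (hf : f.Monic) (hn : f.natDegree = n) :
    ∃ v : Fin n → F, polyOf F v = f := by
  refine ⟨fun i => f.coeff i, ?_⟩
  unfold polyOf
  conv_rhs => rw [hf.as_sum, hn, ← Fin.sum_univ_eq_sum_range (fun i => C (f.coeff i) * X ^ i)]

/-- The multiset of roots of the monic polynomial with coefficients `v`. -/
def rts {n : ℕ} (v : Fin n → F) : Multiset Ω := ((polyOf F v).map (algebraMap F Ω)).roots

lemma rts_prod {n : ℕ} (v : Fin n → F) :
    (polyOf F v).map (algebraMap F Ω) = ((rts F Ω v).map (fun a => X - C a)).prod :=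
  (IsAlgClosed.splits _).eq_prod_roots_of_monic ((polyOf_monic F v).map _)

lemma rts_card {n : ℕ} (v : Fin n → F) : (rts F Ω v).card = n := by
  have := (IsAlgClosed.splits ((polyOf F v).map (algebraMap F Ω))).natDegree_eq_card_roots
  rw [natDegree_map, polyOf_natDegree] at this
  exact this.symm

lemma rts_inj {n : ℕ} : Function.Injective (rts F Ω (n := n)) := by
  intro v w h
  have h1 := rts_prod F Ω v
  rw [h, ← rts_prod F Ω w] at h1
  have h2 := map_injective _ (algebraMap F Ω).injective h1
  funext i
  rw [← polyOf_coeff F v i, ← polyOf_coeff F w i, h2]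

lemma map_prod_X_sub_C (s : Multiset Ω) :
    ((s.map (fun a => X - C a)).prod).map (frb F Ω) =
      ((s.map (frb F Ω)).map (fun a => X - C a)).prod := by
  rw [Polynomial.map_multiset_prod, Multiset.map_map, Multiset.map_map]
  congr 1
  refine Multiset.map_congr rfl fun a _ => ?_
  simp

lemma rts_fixed {n : ℕ} (v : Fin n → F) : (rts F Ω v).map (frb F Ω) = rts F Ω v := by
  have h1 := map_prod_X_sub_C F Ω (rts F Ω v)
  rw [← rts_prod, Polynomial.map_map] at h1
  have h2 : (frb F Ω).comp (algebraMap F Ω) = algebraMap F Ω := by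
    ext a; exact frb_algebraMap F Ω a
  rw [h2] at h1
  have h3 := congrArg roots h1
  rw [roots_multiset_prod_X_sub_C] at h3
  exact h3.symm

lemma rts_surj {n : ℕ} {s : Multiset Ω} (hc : s.card = n) (hs : s.map (frb F Ω) = s) :
    ∃ v : Fin n → F, rts F Ω v = s := by
  set P : Polynomial Ω := (s.map (fun a => X - C a)).prod with hP
  have hm : P.Monic := monic_multiset_prod_of_monic _ _ (fun a _ => monic_X_sub_C a)
  have hfix : P.map (frb F Ω) = P := by rw [hP, map_prod_X_sub_C, hs]
  have hl : P ∈ lifts (algebraMap F Ω) := by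
    rw [lifts_iff_coeff_lifts]
    intro i
    have : frb F Ω (P.coeff i) = P.coeff i := by
      conv_rhs => rw [← hfix]
      rw [coeff_map]
    exact exists_of_frb_fixed F Ω this
  obtain ⟨f, hf1, hf2, hf3⟩ := lifts_and_natDegree_eq_and_monic hl hm
  have hdeg : P.natDegree = n := by
    rw [hP, natDegree_multiset_prod_X_sub_C_eq_card, hc]
  obtain ⟨v, hv⟩ := polyOf_surj F hf3 (hf2.trans hdeg)
  refine ⟨v, ?_⟩
  unfold rts
  rw [hv, hf1, hP, roots_multiset_prod_X_sub_C]

/-- Frobenius-stable multisets of size `n`. -/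
def Dv (n : ℕ) : Finset (Multiset Ω) := Finset.univ.image (rts F Ω (n := n))

lemma mem_Dv (n : ℕ) (s : Multiset Ω) : s ∈ Dv F Ω n ↔ s.card = n ∧ s.map (frb F Ω) = s := by
  unfold Dv
  rw [Finset.mem_image]
  constructor
  · rintro ⟨v, _, rfl⟩
    exact ⟨rts_card F Ω v, rts_fixed F Ω v⟩
  · rintro ⟨h1, h2⟩
    obtain ⟨v, hv⟩ := rts_surj F Ω h1 h2
    exact ⟨v, Finset.mem_univ _, hv⟩

lemma sum_Dv (n : ℕ) (h : Multiset Ω → ℂ) :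
    ∑ s ∈ Dv F Ω n, h s = ∑ v : Fin n → F, h (rts F Ω v) := by
  unfold Dv
  rw [Finset.sum_image]
  intro x _ y _ hxy
  exact rts_inj F Ω hxy

/-- The elements of the degree `k` extension of `F` inside `Ω`. -/
def Ek (k : ℕ) : Finset Ω := (X ^ (Fintype.card F ^ k) - X : Polynomial Ω).roots.toFinset

lemma mem_Ek (k : ℕ) (hk : 1 ≤ k) (α : Ω) : α ∈ Ek F Ω k ↔ (frb F Ω)^[k] α = α := by
  unfold Ek
  rw [Multiset.mem_toFinset, mem_roots
    (FiniteField.X_pow_card_pow_sub_X_ne_zero Ω (by omega) Fintype.one_lt_card), frb_iter]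
  simp [IsRoot, sub_eq_zero]

/-- The weight `χ(∏ s) ψ(∑ s^m)`. -/
def wt (χ : MulChar F ℂ) (ψ : AddChar F ℂ) (m : ℕ) (s : Multiset Ω) : ℂ :=
  χ (down F Ω s.prod) * ψ (down F Ω (s.map (· ^ m)).sum)

lemma prod_fixed {s : Multiset Ω} (hs : s.map (frb F Ω) = s) : frb F Ω s.prod = s.prod := by
  rw [map_multiset_prod, hs]

lemma psum_fixed {s : Multiset Ω} (hs : s.map (frb F Ω) = s) (m : ℕ) :
    frb F Ω (s.map (· ^ m)).sum = (s.map (· ^ m)).sum := by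
  rw [map_multiset_sum, Multiset.map_map]
  conv_rhs => rw [← hs, Multiset.map_map]
  congr 1
  refine Multiset.map_congr rfl fun a _ => ?_
  simp

lemma wt_add (χ : MulChar F ℂ) (ψ : AddChar F ℂ) (m : ℕ) (s t : Multiset Ω)
    (hs : s.map (frb F Ω) = s) (ht : t.map (frb F Ω) = t) :
    wt F Ω χ ψ m (s + t) = wt F Ω χ ψ m s * wt F Ω χ ψ m t := by
  have h1 : down F Ω (s + t).prod = down F Ω s.prod * down F Ω t.prod := by
    apply (algebraMap F Ω).injective
    rw [map_mul, algebraMap_down F Ω (prod_fixed F Ω hs), algebraMap_down F Ω (prod_fixed F Ω ht),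
      algebraMap_down F Ω, Multiset.prod_add]
    rw [Multiset.prod_add, map_mul, prod_fixed F Ω hs, prod_fixed F Ω ht]
  have h2 : down F Ω ((s + t).map (· ^ m)).sum =
      down F Ω (s.map (· ^ m)).sum + down F Ω (t.map (· ^ m)).sum := by
    apply (algebraMap F Ω).injective
    rw [map_add, algebraMap_down F Ω (psum_fixed F Ω hs m),
      algebraMap_down F Ω (psum_fixed F Ω ht m), algebraMap_down F Ω, Multiset.map_add,
      Multiset.sum_add]
    rw [Multiset.map_add, Multiset.sum_add, map_add, psum_fixed F Ω hs, psum_fixed F Ω ht]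
  unfold wt
  rw [h1, h2, map_mul, AddChar.map_add_eq_mul]
  ring

/-- Coefficients of the `L`-function. -/
def Lc (χ : MulChar F ℂ) (ψ : AddChar F ℂ) (m n : ℕ) : ℂ := ∑ v : Fin n → F, wt F Ω χ ψ m (rts F Ω v)

/-- Character sums over the extensions. -/
def Sk (χ : MulChar F ℂ) (ψ : AddChar F ℂ) (m k : ℕ) : ℂ :=
  ∑ α ∈ Ek F Ω k, wt F Ω χ ψ m (orb (frb F Ω) k α)

theorem Lc_rec (χ : MulChar F ℂ) (ψ : AddChar F ℂ) (m n : ℕ) :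
    (n : ℂ) * Lc F Ω χ ψ m n =
      ∑ k ∈ Finset.Icc 1 n, Sk F Ω χ ψ m k * Lc F Ω χ ψ m (n - k) := by
  have := orbit_recursion (frb_inj F Ω) (Dv F Ω) (mem_Dv F Ω) (Ek F Ω) (mem_Ek F Ω)
    (wt F Ω χ ψ m) (wt_add F Ω χ ψ m) n
  simp only [sum_Dv] at this
  exact this

end Divisors
end DworkFive
end

noncomputable section
namespace DworkFive

section RecSeries

/-- Power series of the sequence `S`, without constant term. -/
def serS (S : ℕ → ℂ) : PowerSeries ℂ := PowerSeries.mk fun k => if k = 0 then 0 else S k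

lemma coeff_serS_mul (S : ℕ → ℂ) (A : PowerSeries ℂ) (n : ℕ) :
    PowerSeries.coeff n (serS S * A) = ∑ k ∈ Finset.Icc 1 n, S k * PowerSeries.coeff (n - k) A := by
  rw [PowerSeries.coeff_mul, Finset.Nat.sum_antidiagonal_eq_sum_range_succ_mk]
  simp only [serS, PowerSeries.coeff_mk]
  have hsub : Finset.Icc 1 n ⊆ Finset.range n.succ := by
    intro k hk
    rw [Finset.mem_Icc] at hk
    rw [Finset.mem_range]; omega
  rw [← Finset.sum_subset hsub]
  · refine Finset.sum_congr rfl fun k hk => ?_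
    rw [Finset.mem_Icc] at hk
    rw [if_neg (by omega)]
  · intro k hk hk'
    rw [Finset.mem_range] at hk
    rw [Finset.mem_Icc] at hk'
    rw [if_pos (by omega), zero_mul]

lemma coeff_X_deriv (A : PowerSeries ℂ) (n : ℕ) :
    PowerSeries.coeff n (PowerSeries.X * PowerSeries.derivative ℂ A) = n * PowerSeries.coeff n A := by
  cases n with
  | zero => simp
  | succ n =>
    rw [mul_comm, PowerSeries.coeff_succ_mul_X, PowerSeries.coeff_derivative]
    push_cast; ring

lemma rec_iff (A : PowerSeries ℂ) (S : ℕ → ℂ) :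
    (∀ n : ℕ, (n : ℂ) * PowerSeries.coeff n A =
      ∑ k ∈ Finset.Icc 1 n, S k * PowerSeries.coeff (n - k) A) ↔
    PowerSeries.X * PowerSeries.derivative ℂ A = serS S * A := by
  constructor
  · intro h
    ext n
    rw [coeff_X_deriv, coeff_serS_mul, h]
  · intro h n
    rw [← coeff_X_deriv, h, coeff_serS_mul]

lemma rec_prod (A : ℕ → PowerSeries ℂ) (S : ℕ → ℕ → ℂ)
    (h : ∀ i, PowerSeries.X * PowerSeries.derivative ℂ (A i) = serS (S i) * A i) (N : ℕ) :
    PowerSeries.X * PowerSeries.derivative ℂ (∏ i ∈ Finset.range N, A i) =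
      serS (fun k => ∑ i ∈ Finset.range N, S i k) * ∏ i ∈ Finset.range N, A i := by
  induction N with
  | zero =>
    have : serS (fun _ => (0 : ℂ)) = 0 := by ext n; simp [serS]
    simp [this]
  | succ N ih =>
    have hs : serS (fun k => ∑ i ∈ Finset.range (N + 1), S i k) =
        serS (fun k => ∑ i ∈ Finset.range N, S i k) + serS (S N) := by
      ext n
      simp only [serS, PowerSeries.coeff_mk, map_add, Finset.sum_range_succ]
      split_ifs <;> simp
    rw [Finset.prod_range_succ, Derivation.leibniz, smul_eq_mul, smul_eq_mul, hs]
    linear_combination (∏ i ∈ Finset.range N, A i) * h N + A N * ih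

end RecSeries

set_option linter.unusedSectionVars false
section HD
open Polynomial
variable (F : Type) [Field F] [Fintype F] (Ω : Type) [Field Ω] [Algebra F Ω] [IsAlgClosed Ω]

lemma down_eq {x : Ω} {a : F} (h : x = algebraMap F Ω a) : down F Ω x = a := by
  rw [h, down_algebraMap]

lemma rts_prod_eq {n : ℕ} (v : Fin (n + 1) → F) :
    (rts F Ω v).prod = algebraMap F Ω ((-1) ^ (n + 1) * v 0) := by
  have h := congrArg (fun P => P.coeff 0) (rts_prod F Ω v)
  simp only [coeff_map] at h
  have h0 := polyOf_coeff F v 0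
  simp only [Fin.val_zero] at h0
  rw [h0, coeff_zero_multiset_prod, Multiset.map_map] at h
  have h2 : (Multiset.map ((fun p : Polynomial Ω => p.coeff 0) ∘ fun a => X - C a) (rts F Ω v))
      = (rts F Ω v).map (fun a => -a) := by
    refine Multiset.map_congr rfl fun a _ => ?_
    simp
  rw [h2] at h
  have h3 : ((rts F Ω v).map (fun a => -a)).prod = (-1) ^ (n + 1) * (rts F Ω v).prod := by
    have := Multiset.prod_map_neg (rts F Ω v)
    rw [rts_card] at this
    exact this
  rw [h3] at h
  rw [map_mul, map_pow, map_neg, map_one, h, ← mul_assoc, ← mul_pow]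
  simp

lemma rts_sum_eq {n : ℕ} (v : Fin (n + 1) → F) :
    (rts F Ω v).sum = algebraMap F Ω (- v (Fin.last n)) := by
  have h := congrArg (fun P => P.coeff n) (rts_prod F Ω v)
  simp only [coeff_map] at h
  have h0 := polyOf_coeff F v (Fin.last n)
  simp only [Fin.val_last] at h0
  have h1 := multiset_prod_X_sub_C_coeff_card_pred (rts F Ω v) (by rw [rts_card]; omega)
  rw [rts_card, Nat.add_sub_cancel] at h1
  rw [h0, h1] at h
  rw [map_neg, h, neg_neg]

lemma Lc_zero (χ : MulChar F ℂ) (ψ : AddChar F ℂ) (m : ℕ) : Lc F Ω χ ψ m 0 = 1 := by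
  unfold Lc
  rw [Fintype.sum_unique]
  have : rts F Ω (default : Fin 0 → F) = 0 := by
    rw [← Multiset.card_eq_zero]; exact rts_card F Ω _
  rw [this]
  unfold wt
  have h1 : down F Ω (Multiset.prod (0 : Multiset Ω)) = 1 := down_eq F Ω (by simp)
  have h2 : down F Ω (Multiset.sum (Multiset.map (· ^ m) (0 : Multiset Ω))) = 0 :=
    down_eq F Ω (by simp)
  rw [h1, h2]; simp

lemma wt_one {n : ℕ} (χ : MulChar F ℂ) (ψ : AddChar F ℂ) (v : Fin (n + 1) → F) :
    wt F Ω χ ψ 1 (rts F Ω v) = χ ((-1) ^ (n + 1) * v 0) * ψ (- v (Fin.last n)) := by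
  unfold wt
  simp only [pow_one, Multiset.map_id']
  rw [down_eq F Ω (rts_prod_eq F Ω v), down_eq F Ω (rts_sum_eq F Ω v)]

lemma Lc_one_one (χ : MulChar F ℂ) (ψ : AddChar F ℂ) : Lc F Ω χ ψ 1 1 = gaussSum χ ψ := by
  unfold Lc gaussSum
  simp only [wt_one F Ω (n := 0)]
  rw [← (Equiv.funUnique (Fin 1) F).symm.sum_comp, ← Equiv.sum_comp (Equiv.neg F)]
  refine Finset.sum_congr rfl fun a _ => ?_
  simp

lemma Lc_one_big (χ : MulChar F ℂ) (ψ : AddChar F ℂ) (hψ : ψ ≠ 1) (n : ℕ) :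
    Lc F Ω χ ψ 1 (n + 2) = 0 := by
  obtain ⟨c, hc⟩ := AddChar.ne_one_iff.1 hψ
  unfold Lc
  simp only [wt_one F Ω (n := n + 1)]
  refine eq_zero_of_mul_eq_self_left hc ?_
  rw [Finset.mul_sum]
  conv_rhs => rw [← Equiv.sum_comp (Equiv.addRight (Pi.single (Fin.last (n + 1)) (-c) : Fin (n + 2) → F))]
  refine Finset.sum_congr rfl fun v _ => ?_
  have h0 : (0 : Fin (n + 2)) ≠ Fin.last (n + 1) := by
    intro h; have := congrArg Fin.val h; simp at this
  simp only [Equiv.coe_addRight, Pi.add_apply, Pi.single_eq_same, Pi.single_eq_of_ne h0, add_zero,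
    neg_add, neg_neg, AddChar.map_add_eq_mul]
  ring

lemma psum_five (v : Fin 5 → F) : ((rts F Ω v).map (· ^ 5)).sum = algebraMap F Ω
    (-v 4 ^ 5 + 5 * v 4 ^ 3 * v 3 - 5 * v 4 * v 3 ^ 2 - 5 * v 4 ^ 2 * v 2 + 5 * v 3 * v 2
      + 5 * v 4 * v 1 - 5 * v 0) := by
  have hcard := rts_card F Ω v
  have hp := rts_prod F Ω v
  generalize rts F Ω v = s at hcard hp
  obtain ⟨a, ha⟩ := Multiset.card_pos_iff_exists_mem.1 (by omega : 0 < s.card)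
  obtain ⟨s1, rfl⟩ := Multiset.exists_cons_of_mem ha
  rw [Multiset.card_cons] at hcard
  obtain ⟨b, hb⟩ := Multiset.card_pos_iff_exists_mem.1 (by omega : 0 < s1.card)
  obtain ⟨s2, rfl⟩ := Multiset.exists_cons_of_mem hb
  rw [Multiset.card_cons] at hcard
  obtain ⟨c, hc⟩ := Multiset.card_pos_iff_exists_mem.1 (by omega : 0 < s2.card)
  obtain ⟨s3, rfl⟩ := Multiset.exists_cons_of_mem hc
  rw [Multiset.card_cons] at hcard
  obtain ⟨d, hd⟩ := Multiset.card_pos_iff_exists_mem.1 (by omega : 0 < s3.card)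
  obtain ⟨s4, rfl⟩ := Multiset.exists_cons_of_mem hd
  rw [Multiset.card_cons] at hcard
  obtain ⟨e, he⟩ := Multiset.card_pos_iff_exists_mem.1 (by omega : 0 < s4.card)
  obtain ⟨s5, rfl⟩ := Multiset.exists_cons_of_mem he
  rw [Multiset.card_cons] at hcard
  have h5 : s5 = 0 := by rw [← Multiset.card_eq_zero]; omega
  subst h5
  simp only [Multiset.map_cons, Multiset.map_zero, Multiset.prod_cons, Multiset.prod_zero,
    mul_one] at hp
  have hx : (X - C a) * ((X - C b) * ((X - C c) * ((X - C d) * (X - C e)))) =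
      X ^ 5 + C (-(a + b + c + d + e)) * X ^ 4
      + C (a*b+a*c+a*d+a*e+b*c+b*d+b*e+c*d+c*e+d*e) * X ^ 3
      + C (-(a*b*c+a*b*d+a*b*e+a*c*d+a*c*e+a*d*e+b*c*d+b*c*e+b*d*e+c*d*e)) * X ^ 2
      + C (a*b*c*d+a*b*c*e+a*b*d*e+a*c*d*e+b*c*d*e) * X + C (-(a*b*c*d*e)) := by
    simp only [map_add, map_mul, map_neg]; ring
  rw [hx] at hp
  have k0 := congrArg (fun P => P.coeff 0) hp
  have k1 := congrArg (fun P => P.coeff 1) hp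
  have k2 := congrArg (fun P => P.coeff 2) hp
  have k3 := congrArg (fun P => P.coeff 3) hp
  have k4 := congrArg (fun P => P.coeff 4) hp
  have g0 := polyOf_coeff F v 0
  have g1 := polyOf_coeff F v 1
  have g2 := polyOf_coeff F v 2
  have g3 := polyOf_coeff F v 3
  have g4 := polyOf_coeff F v 4
  change (polyOf F v).coeff 0 = _ at g0
  change (polyOf F v).coeff 1 = _ at g1
  change (polyOf F v).coeff 2 = _ at g2
  change (polyOf F v).coeff 3 = _ at g3
  change (polyOf F v).coeff 4 = _ at g4
  simp [-map_neg, -map_add, -map_mul, coeff_map, g0, g1, g2, g3, g4, coeff_X_pow, coeff_C_mul, coeff_X, coeff_C] at k0 k1 k2 k3 k4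
  simp only [Multiset.map_cons, Multiset.map_zero, Multiset.sum_cons, Multiset.sum_zero,
    map_add, map_sub, map_mul, map_pow, map_neg, k0, k1, k2, k3, k4, map_ofNat]
  ring

end HD
end DworkFive
end

noncomputable section
namespace DworkFive

set_option linter.unusedSectionVars false
section HDfive
open Polynomial
variable (F : Type) [Field F] [Fintype F] (Ω : Type) [Field Ω] [Algebra F Ω] [IsAlgClosed Ω]

/-- The auxiliary character sum in the proof of Hasse-Davenport. -/
def Kc (ψ : AddChar F ℂ) : ℂ := ∑ w : Fin 4 → F,
  ψ (-w 3 ^ 5 + 5 * w 3 ^ 3 * w 2 - 5 * w 3 * w 2 ^ 2 - 5 * w 3 ^ 2 * w 1 + 5 * w 2 * w 1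
      + 5 * w 3 * w 0)

lemma Lc_five (χ : MulChar F ℂ) (ψ : AddChar F ℂ) :
    Lc F Ω χ ψ 5 5 = Kc F ψ * ∑ u : F, χ u * ψ (5 * u) := by
  unfold Lc Kc
  rw [← (Fin.consEquiv (fun _ : Fin 5 => F)).sum_comp, Fintype.sum_prod_type, Finset.sum_comm,
    Finset.sum_mul]
  refine Finset.sum_congr rfl fun w _ => ?_
  rw [← Equiv.sum_comp (Equiv.neg F), Finset.mul_sum]
  refine Finset.sum_congr rfl fun a _ => ?_
  unfold wt
  rw [down_eq F Ω (rts_prod_eq F Ω _), down_eq F Ω (psum_five F Ω _)]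
  have h0 : (Fin.consEquiv (fun _ : Fin 5 => F)) ((Equiv.neg F) a, w) 0 = -a := rfl
  have h1 : (Fin.consEquiv (fun _ : Fin 5 => F)) ((Equiv.neg F) a, w) 1 = w 0 := rfl
  have h2 : (Fin.consEquiv (fun _ : Fin 5 => F)) ((Equiv.neg F) a, w) 2 = w 1 := rfl
  have h3 : (Fin.consEquiv (fun _ : Fin 5 => F)) ((Equiv.neg F) a, w) 3 = w 2 := rfl
  have h4 : (Fin.consEquiv (fun _ : Fin 5 => F)) ((Equiv.neg F) a, w) 4 = w 3 := rfl
  rw [h0, h1, h2, h3, h4, mul_left_comm, ← AddChar.map_add_eq_mul]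
  congr 2 <;> ring

lemma orb_pow (k m : ℕ) (β : Ω) :
    (orb (frb F Ω) k β).map (· ^ m) = orb (frb F Ω) k (β ^ m) := by
  unfold orb
  rw [Multiset.map_map]
  refine Multiset.map_congr rfl fun i _ => ?_
  simp [iterate_map_pow]

lemma iter_root {t : ℕ} (ht : Fintype.card F = 5 * t + 1) (β : Ω) (k : ℕ) :
    (frb F Ω)^[k] β = β * (orb (frb F Ω) k (β ^ 5)).prod ^ t := by
  induction k with
  | zero => simp [orb]
  | succ k ih =>
    have h1 : (orb (frb F Ω) (k + 1) (β ^ 5)).prod =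
        (orb (frb F Ω) k (β ^ 5)).prod * ((frb F Ω)^[k] β) ^ 5 := by
      rw [orb_add, Multiset.prod_add]
      congr 1
      simp [orb, iterate_map_pow]
    rw [h1, Function.iterate_succ_apply', frb_apply, ht, pow_succ, mul_pow, ← pow_mul]
    conv_lhs => rw [mul_comm, ih]
    rw [ih]
    ring

lemma wt_pow_five (χ : MulChar F ℂ) (ψ : AddChar F ℂ) (k : ℕ) (β : Ω)
    (hβ : (frb F Ω)^[k] β = β) :
    wt F Ω (χ ^ 5) ψ 5 (orb (frb F Ω) k β) = wt F Ω χ ψ 1 (orb (frb F Ω) k (β ^ 5)) := by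
  unfold wt
  have h1 : down F Ω (orb (frb F Ω) k (β ^ 5)).prod = down F Ω (orb (frb F Ω) k β).prod ^ 5 := by
    apply down_eq
    rw [map_pow, algebraMap_down F Ω (prod_fixed F Ω (orb_map hβ)), ← orb_pow,
      Multiset.prod_map_pow, Multiset.map_id']
  rw [h1, orb_pow]
  simp only [pow_one, Multiset.map_id']
  rw [MulChar.pow_apply' χ (by norm_num), map_pow]

lemma card_fiber {t : ℕ} (ht : Fintype.card F = 5 * t + 1) (h5 : (5 : Ω) ≠ 0) (k : ℕ) (hk : 1 ≤ k)
    (α : Ω) (hα0 : α ≠ 0) :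
    ((Ek F Ω k).filter (fun β => β ^ 5 = α)).card =
      if (orb (frb F Ω) k α).prod ^ t = 1 then 5 else 0 := by
  split_ifs with h
  · have hsep : (X ^ 5 - C α : Polynomial Ω).Separable :=
      separable_X_pow_sub_C α (by exact_mod_cast h5) hα0
    have hne : (X ^ 5 - C α : Polynomial Ω) ≠ 0 := hsep.ne_zero
    have heq : (Ek F Ω k).filter (fun β => β ^ 5 = α) = (X ^ 5 - C α : Polynomial Ω).roots.toFinset := by
      ext β
      rw [Finset.mem_filter, mem_Ek F Ω k hk, Multiset.mem_toFinset, mem_roots hne]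
      simp only [IsRoot, eval_sub, eval_pow, eval_X, eval_C, sub_eq_zero]
      refine ⟨fun h => h.2, fun hb => ⟨?_, hb⟩⟩
      rw [iter_root F Ω ht, hb, h, mul_one]
    rw [heq, Multiset.toFinset_card_of_nodup (nodup_roots hsep),
      ← (IsAlgClosed.splits (X ^ 5 - C α : Polynomial Ω)).natDegree_eq_card_roots,
      natDegree_X_pow_sub_C]
  · rw [Finset.card_eq_zero, Finset.filter_eq_empty_iff]
    intro β hβ hb
    rw [mem_Ek F Ω k hk, iter_root F Ω ht, hb] at hβ
    have hβ0 : β ≠ 0 := by rintro rfl; exact hα0 (by rw [← hb]; simp)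
    exact h (mul_left_cancel₀ hβ0 (hβ.trans (mul_one β).symm))

lemma Sk_five {t : ℕ} (ht : Fintype.card F = 5 * t + 1) (h5 : (5 : Ω) ≠ 0) (χ ρ : MulChar F ℂ)
    (ψ : AddChar F ℂ)
    (hρ : ∀ a : F, a ≠ 0 → ∑ i ∈ Finset.range 5, (ρ ^ i) a = if a ^ t = 1 then 5 else 0)
    (k : ℕ) (hk : 1 ≤ k) :
    Sk F Ω (χ ^ 5) ψ 5 k = ∑ i ∈ Finset.range 5, Sk F Ω (χ * ρ ^ i) ψ 1 k := by
  unfold Sk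
  rw [Finset.sum_comm]
  have h1 : ∑ β ∈ Ek F Ω k, wt F Ω (χ ^ 5) ψ 5 (orb (frb F Ω) k β) =
      ∑ β ∈ Ek F Ω k, wt F Ω χ ψ 1 (orb (frb F Ω) k (β ^ 5)) :=
    Finset.sum_congr rfl fun β hβ => wt_pow_five F Ω χ ψ k β ((mem_Ek F Ω k hk β).1 hβ)
  have hm : ∀ β ∈ Ek F Ω k, β ^ 5 ∈ Ek F Ω k := by
    intro β hβ
    rw [mem_Ek F Ω k hk] at hβ ⊢
    rw [iterate_map_pow, hβ]
  rw [h1, ← Finset.sum_fiberwise_of_maps_to hm]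
  refine Finset.sum_congr rfl fun α hα => ?_
  have hα' := (mem_Ek F Ω k hk α).1 hα
  have h2 : ∑ β ∈ Ek F Ω k with β ^ 5 = α, wt F Ω χ ψ 1 (orb (frb F Ω) k (β ^ 5)) =
      (((Ek F Ω k).filter (fun β => β ^ 5 = α)).card : ℂ) * wt F Ω χ ψ 1 (orb (frb F Ω) k α) := by
    rw [← nsmul_eq_mul, ← Finset.sum_const]
    refine Finset.sum_congr rfl fun β hβ => ?_
    rw [(Finset.mem_filter.1 hβ).2]
  rw [h2]
  have hN := algebraMap_down F Ω (prod_fixed F Ω (orb_map hα'))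
  unfold wt
  simp only [MulChar.mul_apply]
  by_cases hz : down F Ω (orb (frb F Ω) k α).prod = 0
  · rw [hz, MulChar.map_zero]; simp
  · have hα0 : α ≠ 0 := by
      rintro rfl
      apply hz
      apply down_eq
      rw [map_zero]
      exact Multiset.prod_eq_zero (mem_orb hk 0)
    rw [card_fiber F Ω ht h5 k hk α hα0, ← Finset.sum_mul, ← Finset.mul_sum, hρ _ hz]
    have : (orb (frb F Ω) k α).prod ^ t = 1 ↔ down F Ω (orb (frb F Ω) k α).prod ^ t = 1 := by
      rw [← (algebraMap F Ω).injective.eq_iff, map_pow, hN, map_one]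
    simp only [this]
    split_ifs <;> push_cast <;> ring

theorem hd_pre {t : ℕ} (ht : Fintype.card F = 5 * t + 1) (h5 : (5 : F) ≠ 0) (χ ρ : MulChar F ℂ)
    (ψ : AddChar F ℂ) (hψ : ψ ≠ 1)
    (hρ : ∀ a : F, a ≠ 0 → ∑ i ∈ Finset.range 5, (ρ ^ i) a = if a ^ t = 1 then 5 else 0) :
    ∏ i ∈ Finset.range 5, gaussSum (χ * ρ ^ i) ψ = Kc F ψ * ∑ u : F, (χ ^ 5) u * ψ (5 * u) := by
  set Ω := AlgebraicClosure F
  have h5' : (5 : Ω) ≠ 0 := by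
    intro h
    apply h5
    apply (algebraMap F Ω).injective
    rw [map_zero, map_ofNat, h]
  rw [← Lc_five F Ω (χ ^ 5) ψ]
  set g : ℕ → ℂ := fun i => gaussSum (χ * ρ ^ i) ψ with hg
  set A : ℕ → PowerSeries ℂ := fun i => 1 + PowerSeries.C (g i) * PowerSeries.X with hA
  have hcoeff : ∀ i n, PowerSeries.coeff n (A i) = Lc F Ω (χ * ρ ^ i) ψ 1 n := by
    intro i n
    match n with
    | 0 => simp [hA, Lc_zero]
    | 1 => simp [hA, Lc_one_one, hg, PowerSeries.coeff_one]
    | n + 2 =>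
      rw [Lc_one_big F Ω _ ψ hψ]
      simp [hA, PowerSeries.coeff_one, PowerSeries.coeff_X]
  have hrec : ∀ i, PowerSeries.X * PowerSeries.derivative ℂ (A i) =
      serS (fun k => Sk F Ω (χ * ρ ^ i) ψ 1 k) * A i := by
    intro i
    rw [← rec_iff]
    intro n
    simp only [hcoeff]
    exact Lc_rec F Ω _ ψ 1 n
  have hprod := (rec_iff _ _).2 (rec_prod A (fun i k => Sk F Ω (χ * ρ ^ i) ψ 1 k) hrec 5)
  have huniq := rec_unique (fun n => Lc F Ω (χ ^ 5) ψ 5 n)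
    (fun n => PowerSeries.coeff n (∏ i ∈ Finset.range 5, A i))
    (fun k => ∑ i ∈ Finset.range 5, Sk F Ω (χ * ρ ^ i) ψ 1 k) ?_ ?_ hprod 5
  · rw [huniq]
    have : (∏ i ∈ Finset.range 5, A i) = ((∏ i ∈ Finset.range 5, (1 + C (g i) * X) : Polynomial ℂ) : PowerSeries ℂ) := by
      rw [← Polynomial.coeToPowerSeries.ringHom_apply, map_prod]
      refine Finset.prod_congr rfl fun i _ => ?_
      simp [hA]
    rw [this, Polynomial.coeff_coe]
    have := Polynomial.coeff_prod_of_natDegree_le (s := Finset.range 5)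
      (f := fun i => (1 + C (g i) * X : Polynomial ℂ)) (n := 1) ?_
    · rw [Finset.card_range, Nat.mul_one] at this
      rw [this]
      refine Finset.prod_congr rfl fun i _ => ?_
      simp [coeff_one]
    · intro i _
      compute_degree
  · simp only [Lc_zero]
    simp [Finset.prod_range_succ, hA]
  · intro n
    rw [Lc_rec]
    refine Finset.sum_congr rfl fun k hk => ?_
    rw [Sk_five F Ω ht h5' χ ρ ψ hρ k (Finset.mem_Icc.1 hk).1]

end HDfive
end DworkFive
end

noncomputable section
namespace DworkFive

set_option linter.unusedSectionVars false

/-- The standing data: a finite field with `q = 5t+1` elements, a generator of the character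
group and a primitive additive character. -/
structure Setup (F : Type) [Field F] [Fintype F] where
  t : ℕ
  ht : Fintype.card F = 5 * t + 1
  ω : MulChar F ℂ
  hω : ∀ χ : MulChar F ℂ, ∃ j : ℕ, χ = ω ^ j
  ψ : AddChar F ℂ
  hψ : ψ.IsPrimitive

instance mulCharFintype (F : Type) [Field F] [Fintype F] : Fintype (MulChar F ℂ) :=
  Fintype.ofFinite _

namespace Setup
variable {F : Type} [Field F] [Fintype F] (S : Setup F)

/-- The character of order five. -/
def ρ : MulChar F ℂ := S.ω ^ S.t
/-- The size of the field as a complex number. -/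
def q (_ : Setup F) : ℂ := (Fintype.card F : ℂ)
/-- Gauss sums. -/
def g (χ : MulChar F ℂ) : ℂ := gaussSum χ S.ψ

lemma q_eq : S.q = (Fintype.card F : ℂ) := rfl

lemma five_ne (S : Setup F) : (5 : F) ≠ 0 := by
  intro h
  have h1 : ((Fintype.card F : ℕ) : F) = 0 := FiniteField.cast_card_eq_zero F
  rw [S.ht] at h1
  push_cast at h1
  rw [h] at h1
  simp at h1

lemma t_pos : 0 < S.t := by
  rcases Nat.eq_zero_or_pos S.t with h | h
  · have := S.ht
    have h1 : 1 < Fintype.card F := Fintype.one_lt_card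
    rw [h] at this; omega
  · exact h

lemma q_ne : S.q ≠ 0 := by
  unfold q; exact_mod_cast Fintype.card_ne_zero

lemma q_sub_ne : S.q - 1 ≠ 0 := by
  unfold q
  have h1 : 1 < Fintype.card F := Fintype.one_lt_card
  rw [sub_ne_zero]
  exact_mod_cast h1.ne'

lemma psi_ne : S.ψ ≠ 1 := by
  have h := S.hψ one_ne_zero
  rwa [AddChar.mulShift_one] at h

lemma pow_card (χ : MulChar F ℂ) : χ ^ (5 * S.t) = 1 := by
  have h := MulChar.pow_card_eq_one χ
  rwa [Fintype.card_units, S.ht, Nat.add_sub_cancel] at h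

lemma rho_five : S.ρ ^ 5 = 1 := by
  unfold ρ; rw [← pow_mul, mul_comm]; exact S.pow_card S.ω

lemma faithful {a : F} (h : S.ω a = 1) : a = 1 := by
  by_contra hne
  obtain ⟨χ, hχ⟩ := MulChar.exists_apply_ne_one_of_hasEnoughRootsOfUnity F ℂ hne
  obtain ⟨j, rfl⟩ := S.hω χ
  apply hχ
  rcases Nat.eq_zero_or_pos j with rfl | hj
  · rw [pow_zero]
    have ha : IsUnit a := by
      by_contra hu
      rw [MulChar.map_nonunit _ hu] at h
      exact zero_ne_one h
    exact MulChar.one_apply ha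
  · rw [MulChar.pow_apply' _ hj.ne', h, one_pow]

lemma rho_apply (a : F) : S.ρ a = S.ω (a ^ S.t) := by
  unfold ρ
  rw [MulChar.pow_apply' _ S.t_pos.ne', map_pow]

lemma rho_apply_five {a : F} (ha : a ≠ 0) : S.ρ a ^ 5 = 1 := by
  rw [← MulChar.pow_apply' _ (by norm_num), S.rho_five, MulChar.one_apply ha.isUnit]

lemma pow_apply_of_ne (χ : MulChar F ℂ) (i : ℕ) {a : F} (ha : a ≠ 0) : (χ ^ i) a = χ a ^ i := by
  rcases Nat.eq_zero_or_pos i with rfl | hi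
  · rw [pow_zero, pow_zero, MulChar.one_apply ha.isUnit]
  · exact MulChar.pow_apply' _ hi.ne' a

lemma geom_five {r : ℂ} (h5 : r ^ 5 = 1) (h1 : r ≠ 1) : 1 + r + r ^ 2 + r ^ 3 + r ^ 4 = 0 := by
  have h : (r - 1) * (1 + r + r ^ 2 + r ^ 3 + r ^ 4) = 0 := by linear_combination h5
  exact (mul_eq_zero.1 h).resolve_left (sub_ne_zero.2 h1)

lemma rho_sum (a : F) (ha : a ≠ 0) :
    ∑ i ∈ Finset.range 5, (S.ρ ^ i) a = if a ^ S.t = 1 then 5 else 0 := by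
  simp only [pow_apply_of_ne _ _ ha, Finset.sum_range_succ, Finset.sum_range_zero, zero_add,
    pow_zero, pow_one]
  split_ifs with h
  · rw [S.rho_apply, h, map_one]; norm_num
  · exact geom_five (S.rho_apply_five ha) (fun h1 => h (S.faithful (by rw [← S.rho_apply, h1])))

lemma rho_ne : S.ρ ≠ 1 := by
  intro h
  obtain ⟨u, hu⟩ := IsCyclic.exists_generator (α := Fˣ)
  have h1 : (u : F) ^ S.t = 1 := by
    apply S.faithful
    rw [← S.rho_apply, h, MulChar.one_apply u.isUnit]
  have h2 : u ^ S.t = 1 := by ext; simpa using h1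
  have h3 := orderOf_dvd_of_pow_eq_one h2
  rw [orderOf_eq_card_of_forall_mem_zpowers hu, Nat.card_eq_fintype_card, Fintype.card_units,
    S.ht] at h3
  have := Nat.le_of_dvd S.t_pos h3
  have := S.t_pos
  omega

lemma rho2_ne : S.ρ ^ 2 ≠ 1 := by
  intro h
  apply S.rho_ne
  have := S.rho_five
  calc S.ρ = S.ρ ^ 5 * ((S.ρ ^ 2) ^ 2)⁻¹ := by group
    _ = 1 := by rw [h, this]; simp

lemma rho3_ne : S.ρ ^ 3 ≠ 1 := by
  intro h
  apply S.rho_ne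
  have := S.rho_five
  calc S.ρ = (S.ρ ^ 3) ^ 2 * (S.ρ ^ 5)⁻¹ := by group
    _ = 1 := by rw [h, this]; simp

lemma rho4_ne : S.ρ ^ 4 ≠ 1 := by
  intro h
  apply S.rho_ne
  have := S.rho_five
  calc S.ρ = S.ρ ^ 5 * (S.ρ ^ 4)⁻¹ := by group
    _ = 1 := by rw [h, this]; simp

lemma rho_inv : S.ρ⁻¹ = S.ρ ^ 4 := by
  rw [inv_eq_iff_mul_eq_one, ← pow_succ', S.rho_five]
lemma rho2_inv : (S.ρ ^ 2)⁻¹ = S.ρ ^ 3 := by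
  rw [inv_eq_iff_mul_eq_one, ← pow_add, S.rho_five]
lemma rho3_inv : (S.ρ ^ 3)⁻¹ = S.ρ ^ 2 := by
  rw [inv_eq_iff_mul_eq_one, ← pow_add, S.rho_five]
lemma rho4_inv : (S.ρ ^ 4)⁻¹ = S.ρ := by
  rw [inv_eq_iff_mul_eq_one, ← pow_succ, S.rho_five]

lemma rho_neg_one : S.ρ (-1) = 1 := by
  have h5 := S.rho_apply_five (a := -1) (by simp)
  have h2 : S.ρ (-1) ^ 2 = 1 := by rw [← map_pow]; simp
  calc S.ρ (-1) = S.ρ (-1) ^ 5 * ((S.ρ (-1) ^ 2)^2)⁻¹ := by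
        rw [h5, h2]; 
        have : S.ρ (-1) ^ 5 = S.ρ (-1) * (S.ρ (-1) ^ 2) ^ 2 := by ring
        rw [h2, h5] at this
        simp at this ⊢
        exact this.symm
    _ = 1 := by rw [h5, h2]; simp

lemma rho_pow_neg_one (i : ℕ) : (S.ρ ^ i) (-1) = 1 := by
  rw [pow_apply_of_ne _ _ (by simp), S.rho_neg_one, one_pow]

/-! Sums over characters -/

lemma card_chars : (Fintype.card (MulChar F ℂ) : ℂ) = S.q - 1 := by
  rw [← Nat.card_eq_fintype_card, MulChar.card_eq_card_units_of_hasEnoughRootsOfUnity F ℂ,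
    Nat.card_eq_fintype_card, Fintype.card_units, Nat.cast_sub Fintype.card_pos]
  simp [q]

lemma sum_range_eq (f : MulChar F ℂ → ℂ) :
    ∑ j ∈ Finset.range (Fintype.card F - 1), f (S.ω ^ j) = ∑ χ, f χ := by
  have hc : Fintype.card (MulChar F ℂ) = Fintype.card F - 1 := by
    rw [← Nat.card_eq_fintype_card, MulChar.card_eq_card_units_of_hasEnoughRootsOfUnity F ℂ,
      Nat.card_eq_fintype_card, Fintype.card_units]
  have ho : orderOf S.ω = Fintype.card F - 1 := by
    rw [orderOf_eq_card_of_forall_mem_zpowers, Nat.card_eq_fintype_card, hc]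
    intro χ
    obtain ⟨j, rfl⟩ := S.hω χ
    exact ⟨j, by simp⟩
  refine Finset.sum_bij (fun j _ => S.ω ^ j) (fun _ _ => Finset.mem_univ _) ?_ ?_ (fun _ _ => rfl)
  · intro i hi j hj h
    rw [Finset.mem_range, ← ho] at hi hj
    exact pow_injOn_Iio_orderOf hi hj h
  · intro χ _
    obtain ⟨j, rfl⟩ := S.hω χ
    refine ⟨j % orderOf S.ω, ?_, ?_⟩
    · rw [Finset.mem_range, ← ho]
      exact Nat.mod_lt _ (orderOf_pos S.ω)
    · exact pow_mod_orderOf _ _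

lemma orth (a : F) : ∑ χ : MulChar F ℂ, χ a = if a = 1 then S.q - 1 else 0 := by
  split_ifs with h
  · subst h
    simp [← S.card_chars]
  · obtain ⟨χ, hχ⟩ := MulChar.exists_apply_ne_one_of_hasEnoughRootsOfUnity F ℂ h
    refine eq_zero_of_mul_eq_self_left hχ ?_
    rw [Finset.mul_sum]
    conv_rhs => rw [← Equiv.sum_comp (Equiv.mulLeft χ)]
    refine Finset.sum_congr rfl fun θ _ => ?_
    simp

/-! Gauss sums -/

lemma g_one : S.g 1 = -1 := gaussSum_one_left S.psi_ne

lemma g_mul_inv {χ : MulChar F ℂ} (hχ : χ ≠ 1) : S.g χ * S.g χ⁻¹ = χ (-1) * S.q := by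
  have h1 := gaussSum_mul_gaussSum_eq_card hχ S.hψ
  have h2 := mul_gaussSum_inv_eq_gaussSum χ⁻¹ S.ψ
  have h3 : χ⁻¹ (-1) = χ (-1) := by
    rw [MulChar.inv_apply]; congr 1; simp [Ring.inverse_eq_inv']; 
  unfold g q
  rw [← h2, ← h1, h3]; ring

lemma chi_neg_one_ne (χ : MulChar F ℂ) : χ (-1) ≠ 0 := by
  intro h
  have : χ (-1) * χ (-1) = 1 := by rw [← map_mul]; simp
  rw [h] at this; simp at this

lemma chi_neg_one_sq (χ : MulChar F ℂ) : χ (-1) * χ (-1) = 1 := by rw [← map_mul]; simp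

lemma g_ne (χ : MulChar F ℂ) : S.g χ ≠ 0 := by
  by_cases h : χ = 1
  · rw [h, S.g_one]; simp
  · intro h0
    have := S.g_mul_inv h
    rw [h0, zero_mul] at this
    exact mul_ne_zero (chi_neg_one_ne χ) S.q_ne this.symm

lemma gauss_shift (χ : MulChar F ℂ) {a : F} (ha : a ≠ 0) :
    ∑ u : F, χ u * S.ψ (a * u) = χ⁻¹ a * S.g χ := by
  have h := gaussSum_mulShift χ S.ψ (Units.mk0 a ha)
  have h1 : gaussSum χ (S.ψ.mulShift a) = ∑ u : F, χ u * S.ψ (a * u) := by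
    unfold gaussSum; simp [AddChar.mulShift_apply]
  rw [Units.val_mk0, h1] at h
  unfold g
  rw [← h, ← mul_assoc, MulChar.inv_apply, Ring.inverse_eq_inv', ← map_mul, inv_mul_cancel₀ ha,
    map_one, one_mul]

lemma g14 : S.g S.ρ * S.g (S.ρ ^ 4) = S.q := by
  have := S.g_mul_inv S.rho_ne
  rwa [S.rho_inv, S.rho_neg_one, one_mul] at this

lemma g23 : S.g (S.ρ ^ 2) * S.g (S.ρ ^ 3) = S.q := by
  have := S.g_mul_inv S.rho2_ne
  rwa [S.rho2_inv, S.rho_pow_neg_one, one_mul] at this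

/-- Hasse-Davenport for five. -/
theorem hasse_davenport (χ : MulChar F ℂ) :
    S.g χ * S.g (χ * S.ρ) * S.g (χ * S.ρ ^ 2) * S.g (χ * S.ρ ^ 3) * S.g (χ * S.ρ ^ 4) =
      S.q ^ 2 * ((χ ^ 5)⁻¹ 5 * S.g (χ ^ 5)) := by
  have key : ∀ χ : MulChar F ℂ, S.g χ * S.g (χ * S.ρ) * S.g (χ * S.ρ ^ 2) * S.g (χ * S.ρ ^ 3) *
      S.g (χ * S.ρ ^ 4) = Kc F S.ψ * ((χ ^ 5)⁻¹ 5 * S.g (χ ^ 5)) := by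
    intro χ
    have h := hd_pre F S.ht S.five_ne χ S.ρ S.ψ S.psi_ne S.rho_sum
    rw [S.gauss_shift _ S.five_ne] at h
    rw [← h]
    simp [Finset.prod_range_succ, g]
  have hK : Kc F S.ψ = S.q ^ 2 := by
    have h := key 1
    have h1 : (1 : MulChar F ℂ) 5 = 1 := MulChar.one_apply S.five_ne.isUnit
    simp only [one_mul, one_pow, inv_one, h1, S.g_one] at h
    linear_combination h + S.g (S.ρ ^ 2) * S.g (S.ρ ^ 3) * S.g14 + S.q * S.g23 
  rw [← hK, key]

end Setup
end DworkFive
end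

noncomputable section
namespace DworkFive

set_option linter.unusedSectionVars false

/-- The bracket. -/
def Br (a0 a1 a2 a3 a4 : ℂ) : ℂ :=
  a0 ^ 5 + 20 * a0 ^ 3 * a1 * a4 + 20 * a0 ^ 3 * a2 * a3 + 30 * a0 ^ 2 * a1 ^ 2 * a3
    + 30 * a0 ^ 2 * a2 ^ 2 * a1

/-- The constant coefficient of the fifth power in `ℂ[ℤ/5]`. -/
def Pz (a0 a1 a2 a3 a4 : ℂ) : ℂ :=
  Br a0 a1 a2 a3 a4 + Br a1 a2 a3 a4 a0 + Br a2 a3 a4 a0 a1 + Br a3 a4 a0 a1 a2 +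
    Br a4 a0 a1 a2 a3 + 120 * a0 * a1 * a2 * a3 * a4

lemma cyc_mul {r : ℂ} (h : r ^ 5 = 1) (a0 a1 a2 a3 a4 b0 b1 b2 b3 b4 : ℂ) :
    (a0 + a1 * r + a2 * r ^ 2 + a3 * r ^ 3 + a4 * r ^ 4) *
      (b0 + b1 * r + b2 * r ^ 2 + b3 * r ^ 3 + b4 * r ^ 4) =
    (a0 * b0 + a1 * b4 + a2 * b3 + a3 * b2 + a4 * b1) +
    (a0 * b1 + a1 * b0 + a2 * b4 + a3 * b3 + a4 * b2) * r +
    (a0 * b2 + a1 * b1 + a2 * b0 + a3 * b4 + a4 * b3) * r ^ 2 +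
    (a0 * b3 + a1 * b2 + a2 * b1 + a3 * b0 + a4 * b4) * r ^ 3 +
    (a0 * b4 + a1 * b3 + a2 * b2 + a3 * b1 + a4 * b0) * r ^ 4 := by
  linear_combination ((a1 * b4 + a2 * b3 + a3 * b2 + a4 * b1) + (a2 * b4 + a3 * b3 + a4 * b2) * r +
    (a3 * b4 + a4 * b3) * r ^ 2 + a4 * b4 * r ^ 3) * h

lemma cyc_five (a0 a1 a2 a3 a4 : ℂ) : ∃ c1 c2 c3 c4 : ℂ, ∀ r : ℂ, r ^ 5 = 1 →
    (a0 + a1 * r + a2 * r ^ 2 + a3 * r ^ 3 + a4 * r ^ 4) ^ 5 =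
      Pz a0 a1 a2 a3 a4 + c1 * r + c2 * r ^ 2 + c3 * r ^ 3 + c4 * r ^ 4 := by
  obtain ⟨s0, hs0⟩ : ∃ s, s = a0 * a0 + a1 * a4 + a2 * a3 + a3 * a2 + a4 * a1 := ⟨_, rfl⟩
  obtain ⟨s1, hs1⟩ : ∃ s, s = a0 * a1 + a1 * a0 + a2 * a4 + a3 * a3 + a4 * a2 := ⟨_, rfl⟩
  obtain ⟨s2, hs2⟩ : ∃ s, s = a0 * a2 + a1 * a1 + a2 * a0 + a3 * a4 + a4 * a3 := ⟨_, rfl⟩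
  obtain ⟨s3, hs3⟩ : ∃ s, s = a0 * a3 + a1 * a2 + a2 * a1 + a3 * a0 + a4 * a4 := ⟨_, rfl⟩
  obtain ⟨s4, hs4⟩ : ∃ s, s = a0 * a4 + a1 * a3 + a2 * a2 + a3 * a1 + a4 * a0 := ⟨_, rfl⟩
  have hP : Pz a0 a1 a2 a3 a4 =
      (s0 * s0 + s1 * s4 + s2 * s3 + s3 * s2 + s4 * s1) * a0 +
      (s0 * s1 + s1 * s0 + s2 * s4 + s3 * s3 + s4 * s2) * a4 +
      (s0 * s2 + s1 * s1 + s2 * s0 + s3 * s4 + s4 * s3) * a3 +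
      (s0 * s3 + s1 * s2 + s2 * s1 + s3 * s0 + s4 * s4) * a2 +
      (s0 * s4 + s1 * s3 + s2 * s2 + s3 * s1 + s4 * s0) * a1 := by
    rw [hs0, hs1, hs2, hs3, hs4]; unfold Pz Br; ring
  refine ⟨?_, ?_, ?_, ?_, fun r hr => ?_⟩
  rotate_left 4
  · have e : ∀ x : ℂ, x ^ 5 = x * x * (x * x) * x := fun x => by ring
    rw [e, cyc_mul hr, ← hs0, ← hs1, ← hs2, ← hs3, ← hs4, cyc_mul hr, cyc_mul hr, hP]

namespace Setup
variable {F : Type} [Field F] [Fintype F] (S : Setup F)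

lemma five_torsion (θ : MulChar F ℂ) : θ ^ 5 = 1 ↔ ∃ i ∈ Finset.range 5, θ = S.ρ ^ i := by
  constructor
  · intro h
    obtain ⟨j, rfl⟩ := S.hω θ
    have ho : orderOf S.ω = 5 * S.t := by
      rw [orderOf_eq_card_of_forall_mem_zpowers, 
        MulChar.card_eq_card_units_of_hasEnoughRootsOfUnity F ℂ,
        Nat.card_eq_fintype_card, Fintype.card_units, S.ht, Nat.add_sub_cancel]
      intro χ
      obtain ⟨j, rfl⟩ := S.hω χ
      exact ⟨j, by simp⟩
    rw [← pow_mul] at h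
    have h2 := orderOf_dvd_of_pow_eq_one h
    rw [ho, mul_comm j 5] at h2
    obtain ⟨i, rfl⟩ := Nat.dvd_of_mul_dvd_mul_left (by norm_num) h2
    refine ⟨i % 5, Finset.mem_range.2 (Nat.mod_lt _ (by norm_num)), ?_⟩
    rw [pow_mul]
    change S.ρ ^ i = _
    conv_lhs => rw [← Nat.mod_add_div i 5, pow_add, pow_mul, S.rho_five, one_pow, mul_one]
  · rintro ⟨i, _, rfl⟩
    rw [← pow_mul, mul_comm, pow_mul, S.rho_five, one_pow]

lemma rho_order : orderOf S.ρ = 5 := by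
  have : Fact (Nat.Prime 5) := ⟨by norm_num⟩
  exact orderOf_eq_prime S.rho_five S.rho_ne

lemma sum_torsion (f : MulChar F ℂ → ℂ) :
    ∑ θ : MulChar F ℂ, (if θ ^ 5 = 1 then f θ else 0) = ∑ i ∈ Finset.range 5, f (S.ρ ^ i) := by
  rw [← Finset.sum_filter]
  have : Finset.univ.filter (fun θ : MulChar F ℂ => θ ^ 5 = 1) =
      (Finset.range 5).image (fun i => S.ρ ^ i) := by
    ext θ
    rw [Finset.mem_filter, Finset.mem_image, S.five_torsion]
    simp [eq_comm]
  rw [this, Finset.sum_image]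
  intro i hi j hj h
  have hi' : i < 5 := by simpa using hi
  have hj' : j < 5 := by simpa using hj
  rw [← S.rho_order] at hi' hj'
  exact pow_injOn_Iio_orderOf hi' hj' h

lemma chi_inv_apply (χ : MulChar F ℂ) (a : F) : χ⁻¹ a = χ a⁻¹ := by
  rw [MulChar.inv_apply, Ring.inverse_eq_inv']

lemma chi_inv₀ (χ : MulChar F ℂ) (a : F) : χ a⁻¹ = (χ a)⁻¹ := by
  by_cases ha : a = 0
  · subst ha; simp [MulChar.map_zero]
  · refine eq_inv_of_mul_eq_one_left ?_
    rw [← map_mul, inv_mul_cancel₀ ha, map_one]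

lemma chi_ne (χ : MulChar F ℂ) {a : F} (ha : a ≠ 0) : χ a ≠ 0 := by
  intro h
  have : χ a * χ a⁻¹ = 1 := by rw [← map_mul, mul_inv_cancel₀ ha, map_one]
  rw [h, zero_mul] at this
  exact zero_ne_one this

lemma chi_inv_apply' (χ : MulChar F ℂ) (a : F) : χ⁻¹ a = (χ a)⁻¹ := by
  rw [chi_inv_apply, chi_inv₀]

lemma card_roots_five (y : F) (hy : y ≠ 0) :
    ((Finset.univ.filter (fun x : F => x ^ 5 = y)).card : ℂ) = ∑ i ∈ Finset.range 5, (S.ρ ^ i) y := by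
  have h1 : (S.q - 1) * ((Finset.univ.filter (fun x : F => x ^ 5 = y)).card : ℂ) =
      ∑ x : F, ∑ θ : MulChar F ℂ, θ⁻¹ (x ^ 5 * y⁻¹) := by
    have : ∀ x : F, ∑ θ : MulChar F ℂ, θ⁻¹ (x ^ 5 * y⁻¹) = if x ^ 5 = y then S.q - 1 else 0 := by
      intro x
      have h := Equiv.sum_comp (Equiv.inv (MulChar F ℂ)) (fun θ => θ (x ^ 5 * y⁻¹))
      simp only [Equiv.inv_apply] at h
      rw [h, S.orth]
      simp [mul_inv_eq_one₀ hy]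
    rw [Finset.sum_congr rfl fun x _ => this x, ← Finset.sum_filter, Finset.sum_const, nsmul_eq_mul,
      mul_comm]
  have h2 : ∑ x : F, ∑ θ : MulChar F ℂ, θ⁻¹ (x ^ 5 * y⁻¹) = 
      ∑ θ : MulChar F ℂ, if θ ^ 5 = 1 then (S.q - 1) * θ y else 0 := by
    rw [Finset.sum_comm]
    refine Finset.sum_congr rfl fun θ _ => ?_
    have : ∀ x : F, θ⁻¹ (x ^ 5 * y⁻¹) = θ y * ((θ ^ 5)⁻¹ x) := by
      intro x
      rw [map_mul, chi_inv_apply θ y⁻¹, inv_inv, mul_comm, chi_inv_apply', chi_inv_apply', MulChar.pow_apply' _ (by norm_num), map_pow]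
    rw [Finset.sum_congr rfl fun x _ => this x, ← Finset.mul_sum]
    split_ifs with h
    · rw [h, inv_one, MulChar.sum_one_eq_card_units, Fintype.card_units, Nat.cast_sub Fintype.card_pos, S.q_eq]
      push_cast; ring
    · rw [MulChar.sum_eq_zero_of_ne_one (inv_ne_one.2 h), mul_zero]
  rw [h2, S.sum_torsion (fun θ => (S.q - 1) * θ y), ← Finset.mul_sum] at h1
  exact mul_left_cancel₀ S.q_sub_ne h1

lemma card_mu (S : Setup F) : ((Finset.univ.filter (fun x : F => x ^ 5 = 1)).card : ℂ) = 5 := by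
  rw [S.card_roots_five 1 one_ne_zero]
  simp

lemma sum_mu (u : F) (hu : u ≠ 0) :
    (S.q - 1) * ∑ ζ ∈ Finset.univ.filter (fun x : F => x ^ 5 = 1), S.ψ (ζ * u) =
      ∑ θ : MulChar F ℂ, S.g (θ ^ 5)⁻¹ * (θ ^ 5) u := by
  unfold g gaussSum
  simp only [Finset.sum_mul]
  rw [Finset.sum_comm, ← Equiv.sum_comp (Equiv.mulRight₀ u hu), Finset.sum_filter, Finset.mul_sum]
  refine Finset.sum_congr rfl fun ζ _ => ?_
  have : ∀ θ : MulChar F ℂ, (θ ^ 5)⁻¹ (Equiv.mulRight₀ u hu ζ) * S.ψ (Equiv.mulRight₀ u hu ζ) * (θ ^ 5) u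
      = S.ψ (ζ * u) * θ ((ζ⁻¹) ^ 5) := by
    intro θ
    have hθ : θ u ≠ 0 := chi_ne θ hu
    have he : Equiv.mulRight₀ u hu ζ = ζ * u := rfl
    rw [chi_inv_apply', he]
    simp only [MulChar.pow_apply' _ (by norm_num : 5 ≠ 0), map_pow, map_mul, chi_inv₀]
    field_simp
  rw [Finset.sum_congr rfl fun θ _ => this θ, ← Finset.mul_sum, S.orth]
  simp only [inv_pow, inv_eq_one]
  split_ifs <;> ring

lemma sum_fifth (θ : MulChar F ℂ) (z : F) (hz : z ≠ 0) :
    ∑ x : F, (θ ^ 5) x * S.ψ (z * x ^ 5) =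
      θ⁻¹ z * (S.g θ + S.g (θ * S.ρ) * S.ρ⁻¹ z + S.g (θ * S.ρ ^ 2) * (S.ρ⁻¹ z) ^ 2 +
        S.g (θ * S.ρ ^ 3) * (S.ρ⁻¹ z) ^ 3 + S.g (θ * S.ρ ^ 4) * (S.ρ⁻¹ z) ^ 4) := by
  have h1 : ∑ x : F, (θ ^ 5) x * S.ψ (z * x ^ 5) = ∑ x : F, θ (x ^ 5) * S.ψ (z * x ^ 5) := by
    refine Finset.sum_congr rfl fun x _ => ?_
    rw [MulChar.pow_apply' _ (by norm_num : 5 ≠ 0), map_pow]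
  have h2 : ∑ x : F, θ (x ^ 5) * S.ψ (z * x ^ 5) =
      ∑ y : F, ∑ i ∈ Finset.range 5, (θ * S.ρ ^ i) y * S.ψ (z * y) := by
    rw [← Finset.sum_fiberwise (s := Finset.univ) (g := fun x : F => x ^ 5)]
    refine Finset.sum_congr rfl fun y _ => ?_
    have : ∑ x ∈ Finset.univ.filter (fun x : F => x ^ 5 = y), θ (x ^ 5) * S.ψ (z * x ^ 5) =
        ((Finset.univ.filter (fun x : F => x ^ 5 = y)).card : ℂ) * (θ y * S.ψ (z * y)) := by
      rw [← nsmul_eq_mul, ← Finset.sum_const]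
      refine Finset.sum_congr rfl fun x hx => ?_
      rw [(Finset.mem_filter.1 hx).2]
    rw [this]
    by_cases hy : y = 0
    · subst hy; simp [MulChar.map_zero]
    · rw [S.card_roots_five y hy, Finset.sum_mul]
      refine Finset.sum_congr rfl fun i _ => ?_
      rw [MulChar.mul_apply]; ring
  rw [h1, h2, Finset.sum_comm]
  have h3 : ∀ i ∈ Finset.range 5, ∑ y : F, (θ * S.ρ ^ i) y * S.ψ (z * y) =
      θ⁻¹ z * (S.g (θ * S.ρ ^ i) * (S.ρ⁻¹ z) ^ i) := by
    intro i _
    rw [S.gauss_shift _ hz, chi_inv_apply', MulChar.mul_apply, pow_apply_of_ne _ _ hz, chi_inv_apply',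
      chi_inv_apply', mul_inv, inv_pow]
    ring
  rw [Finset.sum_congr rfl h3, ← Finset.mul_sum]
  simp [Finset.sum_range_succ]

lemma sum_z (a0 a1 a2 a3 a4 : ℂ) :
    ∑ z ∈ Finset.univ.filter (fun z : F => z ≠ 0), (a0 + a1 * S.ρ⁻¹ z + a2 * (S.ρ⁻¹ z) ^ 2 +
        a3 * (S.ρ⁻¹ z) ^ 3 + a4 * (S.ρ⁻¹ z) ^ 4) ^ 5 = (S.q - 1) * Pz a0 a1 a2 a3 a4 := by
  obtain ⟨c1, c2, c3, c4, hc⟩ := cyc_five a0 a1 a2 a3 a4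
  have h1 : ∀ z ∈ Finset.univ.filter (fun z : F => z ≠ 0), (a0 + a1 * S.ρ⁻¹ z + a2 * (S.ρ⁻¹ z) ^ 2 +
        a3 * (S.ρ⁻¹ z) ^ 3 + a4 * (S.ρ⁻¹ z) ^ 4) ^ 5 =
        Pz a0 a1 a2 a3 a4 * (1 : MulChar F ℂ) z + c1 * (S.ρ ^ 4) z + c2 * (S.ρ ^ 3) z +
        c3 * (S.ρ ^ 2) z + c4 * S.ρ z := by
    intro z hz
    have hz := (Finset.mem_filter.1 hz).2
    have h5 := S.rho_apply_five hz
    have e2 : S.ρ⁻¹ z ^ 2 = (S.ρ ^ 3) z := by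
      rw [← S.rho2_inv, ← pow_apply_of_ne _ _ hz, inv_pow]
    have e3 : S.ρ⁻¹ z ^ 3 = (S.ρ ^ 2) z := by
      rw [← S.rho3_inv, ← pow_apply_of_ne _ _ hz, inv_pow]
    have e4 : S.ρ⁻¹ z ^ 4 = S.ρ z := by
      conv_rhs => rw [← S.rho4_inv]
      rw [← pow_apply_of_ne _ _ hz, inv_pow]
    have e5 : S.ρ⁻¹ z ^ 5 = 1 := by
      rw [chi_inv_apply', inv_pow, h5, inv_one]
    rw [hc _ e5, e2, e3, e4, S.rho_inv, MulChar.one_apply hz.isUnit, mul_one]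
  rw [Finset.sum_congr rfl h1, Finset.sum_filter_of_ne]
  · simp only [Finset.sum_add_distrib, ← Finset.mul_sum]
    rw [MulChar.sum_eq_zero_of_ne_one S.rho_ne, MulChar.sum_eq_zero_of_ne_one S.rho2_ne,
      MulChar.sum_eq_zero_of_ne_one S.rho3_ne, MulChar.sum_eq_zero_of_ne_one S.rho4_ne,
      MulChar.sum_one_eq_card_units, Fintype.card_units, Nat.cast_sub Fintype.card_pos, S.q_eq]
    push_cast; ring
  · rintro z _ h rfl
    apply h
    simp [MulChar.map_zero]

end Setup
end DworkFive
end

noncomputable section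
namespace DworkFive

set_option linter.unusedSectionVars false
namespace Setup
variable {F : Type} [Field F] [Fintype F] (S : Setup F)

/-- Number of affine points. -/
def Naff (_ : Setup F) (lam : F) : ℕ :=
  (Finset.univ.filter (fun x : Fin 5 → F => ∑ i, x i ^ 5 = 5 * lam * ∏ i, x i)).card

/-- The torus sum. -/
def U (c z : F) : ℂ := ∑ x : Fin 5 → F, (1 : MulChar F ℂ) (∏ i, x i) * S.ψ (z * ∑ i, x i ^ 5) *
  S.ψ (c * ∏ i, x i)

lemma pow_five (f : F → ℂ) : (∑ a, f a) ^ 5 = ∑ x : Fin 5 → F, ∏ i, f (x i) :=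
  Fintype.sum_pow f 5

lemma psi_sum (z : F) (x : Fin 5 → F) : S.ψ (z * ∑ i, x i ^ 5) = ∏ i, S.ψ (z * x i ^ 5) := by
  rw [Finset.mul_sum]
  simp only [Fin.sum_univ_succ, Fin.prod_univ_succ, AddChar.map_add_eq_mul, Finset.univ_eq_empty,
    Finset.sum_empty, Finset.prod_empty, AddChar.map_zero_eq_one]

lemma Naff_eq (lam : F) : S.q * S.Naff lam =
    ∑ z : F, ∑ x : Fin 5 → F, S.ψ (z * (∑ i, x i ^ 5 - 5 * lam * ∏ i, x i)) := by
  rw [Finset.sum_comm]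
  simp only [AddChar.sum_mulShift _ S.hψ, sub_eq_zero]
  unfold Naff
  push_cast
  rw [← Finset.sum_filter, Finset.sum_const, nsmul_eq_mul, mul_comm, S.q_eq]

lemma inner_z (lam z : F) :
    ∑ x : Fin 5 → F, S.ψ (z * (∑ i, x i ^ 5 - 5 * lam * ∏ i, x i)) =
      (∑ x : F, S.ψ (z * x ^ 5)) ^ 5 - (∑ x : F, (1 : MulChar F ℂ) x * S.ψ (z * x ^ 5)) ^ 5 +
      S.U (-5 * lam * z) z := by
  rw [pow_five, pow_five, U, ← Finset.sum_sub_distrib, ← Finset.sum_add_distrib]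
  refine Finset.sum_congr rfl fun x _ => ?_
  rw [Finset.prod_mul_distrib, ← psi_sum, ← map_prod]
  have h : S.ψ (z * (∑ i, x i ^ 5 - 5 * lam * ∏ i, x i)) =
      S.ψ (z * ∑ i, x i ^ 5) * S.ψ (-5 * lam * z * ∏ i, x i) := by
    rw [← AddChar.map_add_eq_mul]; congr 1; ring
  rw [h]
  by_cases h0 : ∏ i, x i = 0
  · rw [h0, MulChar.map_zero]; simp
  · rw [MulChar.one_apply (Ne.isUnit h0)]; ring

lemma U_twist (c z ζ : F) (hζ : ζ ^ 5 = 1) :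
    S.U c z = ∑ x : Fin 5 → F, (1 : MulChar F ℂ) (∏ i, x i) * S.ψ (z * ∑ i, x i ^ 5) *
      S.ψ (ζ * (c * ∏ i, x i)) := by
  have hζ0 : ζ ≠ 0 := by rintro rfl; simp at hζ
  unfold U
  rw [← (Fin.consEquiv (fun _ : Fin 5 => F)).sum_comp, Fintype.sum_prod_type, Finset.sum_comm]
  conv_rhs => rw [← (Fin.consEquiv (fun _ : Fin 5 => F)).sum_comp, Fintype.sum_prod_type, Finset.sum_comm]
  refine Finset.sum_congr rfl fun w _ => ?_
  rw [← Equiv.sum_comp (Equiv.mulLeft₀ ζ hζ0)]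
  refine Finset.sum_congr rfl fun a _ => ?_
  have he : Equiv.mulLeft₀ ζ hζ0 a = ζ * a := rfl
  rw [he]
  simp only [Fin.consEquiv, Equiv.coe_fn_mk, Fin.prod_univ_succ (n := 4), Fin.sum_univ_succ (n := 4),
    Fin.cons_zero, Fin.cons_succ]
  have h1 : (1 : MulChar F ℂ) (ζ * a * ∏ i, w i) = (1 : MulChar F ℂ) (a * ∏ i, w i) := by
    rw [mul_assoc, map_mul, MulChar.one_apply hζ0.isUnit, one_mul]
  rw [h1, mul_pow, hζ, one_mul]
  congr 2
  ring

lemma U_eq (c z : F) (hc : c ≠ 0) : 5 * (S.q - 1) * S.U c z =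
    ∑ θ : MulChar F ℂ, S.g (θ ^ 5)⁻¹ * (θ ^ 5) c * (∑ x : F, (θ ^ 5) x * S.ψ (z * x ^ 5)) ^ 5 := by
  have h1 : 5 * S.U c z = ∑ ζ ∈ Finset.univ.filter (fun x : F => x ^ 5 = 1),
      ∑ x : Fin 5 → F, (1 : MulChar F ℂ) (∏ i, x i) * S.ψ (z * ∑ i, x i ^ 5) *
      S.ψ (ζ * (c * ∏ i, x i)) := by
    rw [← S.card_mu, ← nsmul_eq_mul, ← Finset.sum_const]
    refine Finset.sum_congr rfl fun ζ hζ => ?_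
    exact S.U_twist c z ζ (Finset.mem_filter.1 hζ).2
  have h2 : 5 * (S.q - 1) * S.U c z = (S.q - 1) * (5 * S.U c z) := by ring
  rw [h2, h1, Finset.sum_comm, Finset.mul_sum]
  simp only [pow_five, Finset.mul_sum (s := (Finset.univ : Finset (Fin 5 → F)))]
  conv_rhs => rw [Finset.sum_comm]
  refine Finset.sum_congr rfl fun x _ => ?_
  rw [← Finset.mul_sum]
  by_cases h0 : ∏ i, x i = 0
  · rw [h0, MulChar.map_zero, zero_mul, zero_mul, mul_zero]
    symm
    refine Finset.sum_eq_zero fun θ _ => ?_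
    rw [Finset.prod_mul_distrib, ← map_prod, h0, MulChar.map_zero]; simp
  · rw [MulChar.one_apply (Ne.isUnit h0), one_mul, mul_left_comm, S.sum_mu _ (mul_ne_zero hc h0),
      Finset.mul_sum]
    refine Finset.sum_congr rfl fun θ _ => ?_
    rw [Finset.prod_mul_distrib, ← map_prod, ← psi_sum, map_mul (θ ^ 5) c]; ring

lemma U_sum (lam : F) (hlam : lam ≠ 0) :
    5 * ∑ z ∈ Finset.univ.filter (fun z : F => z ≠ 0), S.U (-5 * lam * z) z =
      ∑ θ : MulChar F ℂ, S.g (θ ^ 5)⁻¹ * (θ ^ 5) (-5 * lam) *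
        Pz (S.g θ) (S.g (θ * S.ρ)) (S.g (θ * S.ρ ^ 2)) (S.g (θ * S.ρ ^ 3)) (S.g (θ * S.ρ ^ 4)) := by
  refine mul_left_cancel₀ S.q_sub_ne ?_
  have h5 := S.five_ne
  rw [← mul_assoc, mul_comm (S.q - 1) 5, Finset.mul_sum, Finset.mul_sum]
  have h1 : ∀ z ∈ Finset.univ.filter (fun z : F => z ≠ 0), 5 * (S.q - 1) * S.U (-5 * lam * z) z =
      ∑ θ : MulChar F ℂ, S.g (θ ^ 5)⁻¹ * (θ ^ 5) (-5 * lam) *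
      (S.g θ + S.g (θ * S.ρ) * S.ρ⁻¹ z + S.g (θ * S.ρ ^ 2) * (S.ρ⁻¹ z) ^ 2 +
        S.g (θ * S.ρ ^ 3) * (S.ρ⁻¹ z) ^ 3 + S.g (θ * S.ρ ^ 4) * (S.ρ⁻¹ z) ^ 4) ^ 5 := by
    intro z hz
    have hz := (Finset.mem_filter.1 hz).2
    rw [S.U_eq _ _ (mul_ne_zero (mul_ne_zero (neg_ne_zero.2 h5) hlam) hz)]
    refine Finset.sum_congr rfl fun θ _ => ?_
    have hθ := chi_ne θ hz
    rw [S.sum_fifth θ z hz, map_mul, mul_pow, chi_inv_apply' θ, MulChar.pow_apply' _ (by norm_num : 5 ≠ 0) z]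
    field_simp
  rw [Finset.sum_congr rfl h1, Finset.sum_comm]
  refine Finset.sum_congr rfl fun θ _ => ?_
  rw [← Finset.mul_sum, S.sum_z]
  ring

lemma inner_one (z : F) (hz : z ≠ 0) : ∑ x : F, (1 : MulChar F ℂ) x * S.ψ (z * x ^ 5) =
    S.g 1 + S.g S.ρ * S.ρ⁻¹ z + S.g (S.ρ ^ 2) * (S.ρ⁻¹ z) ^ 2 +
        S.g (S.ρ ^ 3) * (S.ρ⁻¹ z) ^ 3 + S.g (S.ρ ^ 4) * (S.ρ⁻¹ z) ^ 4 := by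
  have h := S.sum_fifth 1 z hz
  have h1 : (1 : MulChar F ℂ) z = 1 := MulChar.one_apply hz.isUnit
  simpa [h1] using h

lemma inner_all (z : F) (hz : z ≠ 0) : ∑ x : F, S.ψ (z * x ^ 5) =
    0 + S.g S.ρ * S.ρ⁻¹ z + S.g (S.ρ ^ 2) * (S.ρ⁻¹ z) ^ 2 +
        S.g (S.ρ ^ 3) * (S.ρ⁻¹ z) ^ 3 + S.g (S.ρ ^ 4) * (S.ρ⁻¹ z) ^ 4 := by
  have h := S.inner_one z hz
  rw [S.g_one] at h
  have h2 : ∑ x : F, S.ψ (z * x ^ 5) = ∑ x : F, (1 : MulChar F ℂ) x * S.ψ (z * x ^ 5) + 1 := by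
    rw [← Finset.sum_erase_add _ _ (Finset.mem_univ (0 : F)), 
      ← Finset.sum_erase_add (f := fun x => (1 : MulChar F ℂ) x * S.ψ (z * x ^ 5)) _ (Finset.mem_univ (0 : F))]
    simp only [MulChar.map_zero]
    rw [Finset.sum_congr rfl (g := fun x => (1 : MulChar F ℂ) x * S.ψ (z * x ^ 5))]
    · simp
    · intro x hx
      rw [MulChar.one_apply (Ne.isUnit (Finset.ne_of_mem_erase hx)), one_mul]
  rw [h2, h]; ring

/-- First form of the affine point count. -/
theorem count_one (lam : F) (hlam : lam ≠ 0) : 5 * (S.q * S.Naff lam) =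
    5 * S.q ^ 5 + 5 * (S.q - 1) * Pz 0 (S.g S.ρ) (S.g (S.ρ ^ 2)) (S.g (S.ρ ^ 3)) (S.g (S.ρ ^ 4))
    - 5 * (S.q - 1) * Pz (S.g 1) (S.g S.ρ) (S.g (S.ρ ^ 2)) (S.g (S.ρ ^ 3)) (S.g (S.ρ ^ 4))
    + ∑ θ : MulChar F ℂ, S.g (θ ^ 5)⁻¹ * (θ ^ 5) (-5 * lam) *
        Pz (S.g θ) (S.g (θ * S.ρ)) (S.g (θ * S.ρ ^ 2)) (S.g (θ * S.ρ ^ 3)) (S.g (θ * S.ρ ^ 4)) := by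
  have h0 : ∑ x : Fin 5 → F, S.ψ (0 * (∑ i, x i ^ 5 - 5 * lam * ∏ i, x i)) = S.q ^ 5 := by
    simp [q]
  rw [S.Naff_eq, ← Finset.sum_filter_add_sum_filter_not Finset.univ (fun z : F => z ≠ 0)]
  have hf : Finset.univ.filter (fun z : F => ¬ z ≠ 0) = {0} := by ext; simp
  rw [hf, Finset.sum_singleton, h0]
  have h1 : ∀ z ∈ Finset.univ.filter (fun z : F => z ≠ 0),
      ∑ x : Fin 5 → F, S.ψ (z * (∑ i, x i ^ 5 - 5 * lam * ∏ i, x i)) =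
      (0 + S.g S.ρ * S.ρ⁻¹ z + S.g (S.ρ ^ 2) * (S.ρ⁻¹ z) ^ 2 +
        S.g (S.ρ ^ 3) * (S.ρ⁻¹ z) ^ 3 + S.g (S.ρ ^ 4) * (S.ρ⁻¹ z) ^ 4) ^ 5 -
      (S.g 1 + S.g S.ρ * S.ρ⁻¹ z + S.g (S.ρ ^ 2) * (S.ρ⁻¹ z) ^ 2 +
        S.g (S.ρ ^ 3) * (S.ρ⁻¹ z) ^ 3 + S.g (S.ρ ^ 4) * (S.ρ⁻¹ z) ^ 4) ^ 5 +
      S.U (-5 * lam * z) z := by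
    intro z hz
    have hz := (Finset.mem_filter.1 hz).2
    rw [S.inner_z, S.inner_all z hz, S.inner_one z hz]
  rw [Finset.sum_congr rfl h1, Finset.sum_add_distrib, Finset.sum_sub_distrib, S.sum_z, S.sum_z,
    ← S.U_sum lam hlam]
  ring

end Setup
end DworkFive
end

noncomputable section
namespace DworkFive

set_option linter.unusedSectionVars false
namespace Setup
variable {F : Type} [Field F] [Fintype F] (S : Setup F)

/-- Product of the five shifted Gauss sums. -/
def Ap (θ : MulChar F ℂ) : ℂ :=
  S.g θ * S.g (θ * S.ρ) * S.g (θ * S.ρ ^ 2) * S.g (θ * S.ρ ^ 3) * S.g (θ * S.ρ ^ 4)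

/-- The bracket at `θ`. -/
def Bt (θ : MulChar F ℂ) : ℂ :=
  Br (S.g θ) (S.g (θ * S.ρ)) (S.g (θ * S.ρ ^ 2)) (S.g (θ * S.ρ ^ 3)) (S.g (θ * S.ρ ^ 4))

lemma Ap_ne (θ : MulChar F ℂ) : S.Ap θ ≠ 0 := by
  unfold Ap
  simp only [ne_eq, mul_eq_zero, S.g_ne, or_self, not_false_eq_true]

lemma sh1 (θ : MulChar F ℂ) : θ * S.ρ * S.ρ = θ * S.ρ ^ 2 := by rw [pow_two, mul_assoc]
lemma sh2 (θ : MulChar F ℂ) : θ * S.ρ * S.ρ ^ 2 = θ * S.ρ ^ 3 := by rw [mul_assoc, ← pow_succ']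
lemma sh3 (θ : MulChar F ℂ) : θ * S.ρ * S.ρ ^ 3 = θ * S.ρ ^ 4 := by rw [mul_assoc, ← pow_succ']
lemma sh4 (θ : MulChar F ℂ) : θ * S.ρ * S.ρ ^ 4 = θ := by
  rw [mul_assoc, ← pow_succ', S.rho_five, mul_one]

lemma Ap_shift (θ : MulChar F ℂ) : S.Ap (θ * S.ρ) = S.Ap θ := by
  unfold Ap
  rw [sh1, sh2, sh3, sh4]; ring

lemma Pz_eq (θ : MulChar F ℂ) :
    Pz (S.g θ) (S.g (θ * S.ρ)) (S.g (θ * S.ρ ^ 2)) (S.g (θ * S.ρ ^ 3)) (S.g (θ * S.ρ ^ 4)) =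
    S.Bt θ + S.Bt (θ * S.ρ) + S.Bt (θ * S.ρ * S.ρ) + S.Bt (θ * S.ρ * S.ρ * S.ρ) +
      S.Bt (θ * S.ρ * S.ρ * S.ρ * S.ρ) + 120 * S.Ap θ := by
  unfold Bt Ap Pz
  simp only [sh1, sh2, sh3, sh4]
  have e1 : θ * S.ρ ^ 2 * S.ρ = θ * S.ρ ^ 3 := by rw [mul_assoc, ← pow_succ]
  have e2 : θ * S.ρ ^ 2 * S.ρ ^ 2 = θ * S.ρ ^ 4 := by rw [mul_assoc, ← pow_add]
  have e3 : θ * S.ρ ^ 2 * S.ρ ^ 3 = θ := by rw [mul_assoc, ← pow_add, S.rho_five, mul_one]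
  have e4 : θ * S.ρ ^ 2 * S.ρ ^ 4 = θ * S.ρ := by
    rw [mul_assoc, ← pow_add, pow_succ, S.rho_five, one_mul]
  have f1 : θ * S.ρ ^ 3 * S.ρ = θ * S.ρ ^ 4 := by rw [mul_assoc, ← pow_succ]
  have f2 : θ * S.ρ ^ 3 * S.ρ ^ 2 = θ := by rw [mul_assoc, ← pow_add, S.rho_five, mul_one]
  have f3 : θ * S.ρ ^ 3 * S.ρ ^ 3 = θ * S.ρ := by
    rw [mul_assoc, ← pow_add, pow_succ, S.rho_five, one_mul]
  have f4 : θ * S.ρ ^ 3 * S.ρ ^ 4 = θ * S.ρ ^ 2 := by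
    rw [mul_assoc, ← pow_add, pow_add S.ρ 5 2, S.rho_five, one_mul]
  have k1 : θ * S.ρ ^ 4 * S.ρ = θ := by rw [mul_assoc, ← pow_succ, S.rho_five, mul_one]
  have k2 : θ * S.ρ ^ 4 * S.ρ ^ 2 = θ * S.ρ := by
    rw [mul_assoc, ← pow_add, pow_succ, S.rho_five, one_mul]
  have k3 : θ * S.ρ ^ 4 * S.ρ ^ 3 = θ * S.ρ ^ 2 := by
    rw [mul_assoc, ← pow_add, pow_add S.ρ 5 2, S.rho_five, one_mul]
  have k4 : θ * S.ρ ^ 4 * S.ρ ^ 4 = θ * S.ρ ^ 3 := by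
    rw [mul_assoc, ← pow_add, pow_add S.ρ 5 3, S.rho_five, one_mul]
  simp only [e1, e2, e3, e4, f1, f2, f3, f4, k1, k2, k3, k4]
  ring

lemma coef_eq (θ : MulChar F ℂ) (lam : F) (hlam : lam ≠ 0) :
    S.g (θ ^ 5)⁻¹ * (θ ^ 5) (-5 * lam) =
      S.q ^ 3 * (θ ^ 5) lam / S.Ap θ + if θ ^ 5 = 1 then S.q - 1 else 0 := by
  have hd : S.Ap θ = S.q ^ 2 * ((θ ^ 5)⁻¹ 5 * S.g (θ ^ 5)) := S.hasse_davenport θ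
  have h5 := S.five_ne
  have hq := S.q_ne
  have hm : (θ ^ 5) (-5 * lam) = (θ ^ 5) (-1) * (θ ^ 5) 5 * (θ ^ 5) lam := by
    rw [← map_mul, ← map_mul]; congr 1; ring
  rw [hm, hd]
  split_ifs with h
  · rw [h, inv_one, S.g_one]
    simp only [MulChar.one_apply h5.isUnit, MulChar.one_apply hlam.isUnit,
      MulChar.one_apply (Ne.isUnit (by simp : (-1 : F) ≠ 0))]
    field_simp
    ring
  · have hg := S.g_mul_inv h
    have hgn := S.g_ne (θ ^ 5)
    have h5n := chi_ne (θ ^ 5) h5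
    rw [chi_inv_apply']
    have hs := chi_neg_one_sq (θ ^ 5)
    field_simp
    linear_combination (θ ^ 5) 5 * (θ ^ 5) lam * (θ ^ 5) (-1) * hg + (θ ^ 5) 5 * (θ ^ 5) lam * S.q * hs

lemma sum_shift (f : MulChar F ℂ → ℂ) : ∑ θ, f (θ * S.ρ) = ∑ θ, f θ :=
  Equiv.sum_comp (Equiv.mulRight S.ρ) f

lemma five_shift (θ : MulChar F ℂ) : (θ * S.ρ) ^ 5 = θ ^ 5 := by
  rw [mul_pow, S.rho_five, mul_one]

lemma orth_five (S : Setup F) (lam : F) (hlam : lam ^ 5 ≠ 1) : ∑ θ : MulChar F ℂ, (θ ^ 5) lam = 0 := by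
  have : ∀ θ : MulChar F ℂ, (θ ^ 5) lam = θ (lam ^ 5) := fun θ => by
    rw [MulChar.pow_apply' _ (by norm_num : 5 ≠ 0), map_pow]
  simp only [this]
  rw [S.orth, if_neg hlam]

theorem count_two (lam : F) (hlam : lam ≠ 0) (hlam5 : lam ^ 5 ≠ 1) : S.q * S.Naff lam =
    S.q ^ 5 + (S.q - 1) * Pz 0 (S.g S.ρ) (S.g (S.ρ ^ 2)) (S.g (S.ρ ^ 3)) (S.g (S.ρ ^ 4))
    + S.q ^ 3 * ∑ θ : MulChar F ℂ, (θ ^ 5) lam * (S.Bt θ / S.Ap θ) := by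
  set f : MulChar F ℂ → ℂ := fun θ => (θ ^ 5) lam * (S.Bt θ / S.Ap θ) with hf
  set Pt : MulChar F ℂ → ℂ := fun θ => Pz (S.g θ) (S.g (θ * S.ρ)) (S.g (θ * S.ρ ^ 2)) (S.g (θ * S.ρ ^ 3)) (S.g (θ * S.ρ ^ 4)) with hPt
  have h1 := S.count_one lam hlam
  have hs : ∑ θ : MulChar F ℂ, S.g (θ ^ 5)⁻¹ * (θ ^ 5) (-5 * lam) * Pt θ =
      S.q ^ 3 * (5 * ∑ θ, f θ) + 5 * (S.q - 1) * Pt 1 := by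
    have h2 : ∀ θ : MulChar F ℂ, S.g (θ ^ 5)⁻¹ * (θ ^ 5) (-5 * lam) * Pt θ =
        S.q ^ 3 * (f θ + f (θ * S.ρ) + f (θ * S.ρ * S.ρ) + f (θ * S.ρ * S.ρ * S.ρ) +
          f (θ * S.ρ * S.ρ * S.ρ * S.ρ) + 120 * (θ ^ 5) lam) +
        if θ ^ 5 = 1 then (S.q - 1) * Pt θ else 0 := by
      intro θ
      rw [S.coef_eq θ lam hlam]
      have hA := S.Ap_ne θ
      have h3 : S.q ^ 3 * (θ ^ 5) lam / S.Ap θ * Pt θ = 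
          S.q ^ 3 * (f θ + f (θ * S.ρ) + f (θ * S.ρ * S.ρ) + f (θ * S.ρ * S.ρ * S.ρ) +
          f (θ * S.ρ * S.ρ * S.ρ * S.ρ) + 120 * (θ ^ 5) lam) := by
        simp only [hPt, hf, S.Pz_eq θ, S.five_shift, S.Ap_shift]
        field_simp
      rw [add_mul, h3, ite_mul, zero_mul]
    rw [Finset.sum_congr rfl fun θ _ => h2 θ, Finset.sum_add_distrib,
      S.sum_torsion (fun θ => (S.q - 1) * Pt θ), ← Finset.mul_sum]
    simp only [Finset.sum_add_distrib, ← Finset.mul_sum]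
    rw [S.sum_shift (fun θ => f (θ * S.ρ * S.ρ * S.ρ)), S.sum_shift (fun θ => f (θ * S.ρ * S.ρ)),
      S.sum_shift (fun θ => f (θ * S.ρ)), S.sum_shift f, S.orth_five lam hlam5]
    have h4 : ∀ θ, Pt (θ * S.ρ) = Pt θ := by
      intro θ
      simp only [hPt, sh1, sh2, sh3, sh4]
      unfold Pz; ring
    have h5 : ∀ i : ℕ, Pt (S.ρ ^ i) = Pt 1 := by
      intro i
      induction i with
      | zero => rw [pow_zero]
      | succ n ih => rw [pow_succ, h4, ih]
    simp only [h5, Finset.sum_const, Finset.card_range]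
    simp only [nsmul_eq_mul]
    push_cast
    ring
  have hP1 : Pt 1 = Pz (S.g 1) (S.g S.ρ) (S.g (S.ρ ^ 2)) (S.g (S.ρ ^ 3)) (S.g (S.ρ ^ 4)) := by
    simp only [hPt, one_mul]
  rw [hs, hP1] at h1
  have h5 : (5 : ℂ) ≠ 0 := by norm_num
  apply mul_left_cancel₀ h5
  linear_combination h1

end Setup
end DworkFive
end

noncomputable section
namespace DworkFive

set_option linter.unusedSectionVars false
namespace Setup
variable {F : Type} [Field F] [Fintype F] (S : Setup F)

/-- The affine equation. -/
def Sol (lam : F) (x : Fin 5 → F) : Prop := ∑ i, x i ^ 5 = 5 * lam * ∏ i, x i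

lemma sol_smul (lam : F) (u : F) (hu : u ≠ 0) (x : Fin 5 → F) :
    Sol lam (u • x) ↔ Sol lam x := by
  unfold Sol
  simp only [Pi.smul_apply, smul_eq_mul, mul_pow, Finset.prod_mul_distrib, ← Finset.mul_sum,
    Finset.prod_const, Finset.card_univ, Fintype.card_fin]
  rw [show 5 * lam * (u ^ 5 * ∏ i, x i) = u ^ 5 * (5 * lam * ∏ i, x i) by ring]
  exact mul_right_inj' (pow_ne_zero 5 hu)

lemma dwork_eq (lam : F) : dworkCount F 5 lam =
    Nat.card {P : Projectivization F (Fin 5 → F) // Sol lam P.rep} := by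
  unfold dworkCount Sol
  norm_num

lemma proj_card (lam : F) :
    Nat.card {x : Fin 5 → F // Sol lam x ∧ x ≠ 0} = dworkCount F 5 lam * (Fintype.card F - 1) := by
  rw [dwork_eq, ← Fintype.card_units, ← Nat.card_eq_fintype_card, ← Nat.card_prod]
  symm
  let f : {P : Projectivization F (Fin 5 → F) // Sol lam P.rep} × Fˣ →
      {x : Fin 5 → F // Sol lam x ∧ x ≠ 0} := fun Pu =>
    ⟨(Pu.2 : F) • Pu.1.1.rep, (sol_smul lam _ Pu.2.ne_zero _).2 Pu.1.2,
      smul_ne_zero Pu.2.ne_zero Pu.1.1.rep_nonzero⟩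
  refine Nat.card_congr (Equiv.ofBijective f ⟨?_, ?_⟩)
  · rintro ⟨⟨P, hP⟩, u⟩ ⟨⟨Q, hQ⟩, v⟩ h
    have h' : (u : F) • P.rep = (v : F) • Q.rep := congrArg Subtype.val h
    have hPQ : P = Q := by
      rw [← P.mk_rep, ← Q.mk_rep, Projectivization.mk_eq_mk_iff]
      refine ⟨u⁻¹ * v, ?_⟩
      rw [mul_smul, Units.smul_def v, ← h', ← Units.smul_def u, inv_smul_smul]
    subst hPQ
    have : (u : F) = v := smul_left_injective F P.rep_nonzero h'
    have : u = v := Units.ext this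
    subst this
    rfl
  · rintro ⟨x, hx, hx0⟩
    obtain ⟨a, ha⟩ := Projectivization.exists_smul_eq_mk_rep F x hx0
    refine ⟨⟨⟨Projectivization.mk F x hx0, ?_⟩, a⁻¹⟩, ?_⟩
    · rw [← ha, Units.smul_def]
      exact (sol_smul lam _ a.ne_zero _).2 hx
    · apply Subtype.ext
      change ((a⁻¹ : Fˣ) : F) • (Projectivization.mk F x hx0).rep = x
      rw [← ha, ← Units.smul_def, inv_smul_smul]

lemma naff_eq_proj (lam : F) : (S.Naff lam : ℂ) = 1 + (S.q - 1) * dworkCount F 5 lam := by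
  have h : S.Naff lam = 1 + dworkCount F 5 lam * (Fintype.card F - 1) := by
    rw [← proj_card, Nat.card_eq_fintype_card, Fintype.card_subtype, Naff]
    change (Finset.univ.filter (fun x => Sol lam x)).card = _
    have h0 : (0 : Fin 5 → F) ∈ Finset.univ.filter (fun x => Sol lam x) := by
      exact Finset.mem_filter.2 ⟨Finset.mem_univ _, by simp [Sol]⟩
    rw [← Finset.card_erase_add_one h0, add_comm]
    congr 2
    ext x
    simp [and_comm]
  rw [h, S.ht, S.q_eq, S.ht]
  push_cast
  simp
  ring

end Setup
end DworkFive
end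

noncomputable section
namespace DworkFive

set_option linter.unusedSectionVars false
namespace Setup
variable {F : Type} [Field F] [Fintype F] (S : Setup F)

lemma gauss_all {A : MulChar F ℂ} (hA : A ≠ 1) (v : F) :
    S.g A * A⁻¹ v = ∑ s, A s * S.ψ (v * s) := by
  by_cases hv : v = 0
  · subst hv
    simp only [zero_mul, AddChar.map_zero_eq_one, mul_one, MulChar.map_zero, mul_zero]
    exact (MulChar.sum_eq_zero_of_ne_one hA).symm
  · rw [S.gauss_shift A hv, mul_comm]

lemma jac_general {A : MulChar F ℂ} (hA : A ≠ 1) (μ : MulChar F ℂ) :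
    S.g A * ∑ y, μ y * A⁻¹ (1 - y) = μ (-1) * S.g μ * S.g (A * μ⁻¹) := by
  have h1 : ∀ y, S.g A * (μ y * A⁻¹ (1 - y)) =
      ∑ s, (A s * S.ψ s) * (μ y * S.ψ (-s * y)) := by
    intro y
    rw [mul_left_comm, S.gauss_all hA, Finset.mul_sum]
    refine Finset.sum_congr rfl fun s _ => ?_
    rw [show (1 - y) * s = s + -s * y by ring, AddChar.map_add_eq_mul]
    ring
  rw [Finset.mul_sum, Finset.sum_congr rfl fun y _ => h1 y, Finset.sum_comm]
  simp only [← Finset.mul_sum]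
  unfold g gaussSum
  rw [Finset.mul_sum]
  refine Finset.sum_congr rfl fun s _ => ?_
  by_cases hs : s = 0
  · subst hs; simp [MulChar.map_zero]
  · rw [S.gauss_shift μ (neg_ne_zero.2 hs), MulChar.mul_apply, chi_inv_apply' μ, chi_inv_apply' μ,
      show -s = -1 * s by ring, map_mul, mul_inv]
    have : (μ (-1))⁻¹ = μ (-1) := inv_eq_of_mul_eq_one_left (chi_neg_one_sq μ)
    rw [this]
    unfold g gaussSum
    ring

lemma psi_expand {w : F} (hw : w ≠ 0) :
    (S.q - 1) * S.ψ w = ∑ χ : MulChar F ℂ, S.g χ⁻¹ * χ w := by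
  unfold g gaussSum
  simp only [Finset.sum_mul]
  rw [Finset.sum_comm]
  have : ∀ y, ∑ χ : MulChar F ℂ, χ⁻¹ y * S.ψ y * χ w = if y = w then (S.q - 1) * S.ψ w else 0 := by
    intro y
    by_cases hy : y = 0
    · subst hy
      simp [MulChar.map_zero, hw.symm]
    · have : ∀ χ : MulChar F ℂ, χ⁻¹ y * S.ψ y * χ w = S.ψ y * χ (y⁻¹ * w) := by
        intro χ; rw [chi_inv_apply, map_mul]; ring
      rw [Finset.sum_congr rfl fun χ _ => this χ, ← Finset.mul_sum, S.orth]
      have e : y⁻¹ * w = 1 ↔ y = w := by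
        rw [inv_mul_eq_one₀ hy]
      simp only [e]
      split_ifs with h
      · rw [h]; ring
      · simp
  rw [Finset.sum_congr rfl fun y _ => this y]
  simp

lemma binom_expand {A : MulChar F ℂ} (hA : A ≠ 1) {u : F} (hu : u ≠ 0) :
    (S.q - 1) * (S.g A * A⁻¹ (1 - u)) =
      ∑ χ : MulChar F ℂ, S.g χ⁻¹ * S.g (A * χ) * χ (-u) := by
  rw [S.gauss_all hA, Finset.mul_sum]
  have h1 : ∀ s, (S.q - 1) * (A s * S.ψ ((1 - u) * s)) =
      ∑ χ : MulChar F ℂ, S.g χ⁻¹ * χ (-u) * ((A * χ) s * S.ψ s) := by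
    intro s
    by_cases hs : s = 0
    · subst hs; simp [MulChar.map_zero]
    · rw [show (1 - u) * s = s + -u * s by ring, AddChar.map_add_eq_mul]
      have := S.psi_expand (w := -u * s) (mul_ne_zero (neg_ne_zero.2 hu) hs)
      rw [show (S.q - 1) * (A s * (S.ψ s * S.ψ (-u * s))) =
        A s * S.ψ s * ((S.q - 1) * S.ψ (-u * s)) by ring, this, Finset.mul_sum]
      refine Finset.sum_congr rfl fun χ _ => ?_
      rw [MulChar.mul_apply, map_mul]; ring
  rw [Finset.sum_congr rfl fun y _ => h1 y, Finset.sum_comm]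
  refine Finset.sum_congr rfl fun χ _ => ?_
  rw [← Finset.mul_sum]
  change S.g χ⁻¹ * χ (-u) * S.g (A * χ) = _
  ring

lemma two_f_one {A B C : MulChar F ℂ} (hA : A ≠ 1) (hBC : B * C⁻¹ ≠ 1) (hB : B (-1) = 1)
    (hC : C (-1) = 1) {x : F} (hx : x ≠ 0) :
    S.q * (S.q - 1) * (S.g A * S.g (B * C⁻¹)) * greene2F1 F A B C x =
      ∑ χ : MulChar F ℂ, S.g χ⁻¹ * S.g (A * χ) * S.g (B * χ) * S.g (C⁻¹ * χ⁻¹) * χ x := by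
  have hD : B⁻¹ * C = (B * C⁻¹)⁻¹ := by rw [mul_inv, inv_inv]
  unfold greene2F1
  rw [MulChar.one_apply hx.isUnit, MulChar.mul_apply, hB, hC, hD, ← S.q_eq]
  have hq := S.q_ne
  rw [show S.q * (S.q - 1) * (S.g A * S.g (B * C⁻¹)) * (1 * (1 * 1 / S.q) *
    ∑ y : F, B y * (B * C⁻¹)⁻¹ (1 - y) * A⁻¹ (1 - x * y)) = S.g (B * C⁻¹) *
    ∑ y : F, B y * (B * C⁻¹)⁻¹ (1 - y) * ((S.q - 1) * (S.g A * A⁻¹ (1 - x * y))) by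
      rw [Finset.mul_sum, Finset.mul_sum, Finset.mul_sum]
      refine Finset.sum_congr rfl fun y _ => ?_
      field_simp]
  have h1 : ∀ y, B y * (B * C⁻¹)⁻¹ (1 - y) * ((S.q - 1) * (S.g A * A⁻¹ (1 - x * y))) =
      ∑ χ : MulChar F ℂ, S.g χ⁻¹ * S.g (A * χ) * χ (-x) *
        ((B * χ) y * (B * C⁻¹)⁻¹ (1 - y)) := by
    intro y
    by_cases hy : y = 0
    · subst hy; simp [MulChar.map_zero]
    · rw [S.binom_expand hA (mul_ne_zero hx hy), Finset.mul_sum]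
      refine Finset.sum_congr rfl fun χ _ => ?_
      rw [MulChar.mul_apply, show -(x * y) = -x * y by ring, map_mul]; ring
  rw [Finset.sum_congr rfl fun y _ => h1 y, Finset.sum_comm, Finset.mul_sum]
  refine Finset.sum_congr rfl fun χ _ => ?_
  rw [← Finset.mul_sum, mul_left_comm, S.jac_general hBC, MulChar.mul_apply, hB,
    show B * C⁻¹ * (B * χ)⁻¹ = C⁻¹ * χ⁻¹ by rw [mul_inv]; rw [mul_assoc, mul_left_comm, mul_inv_cancel_left],
    show -x = -1 * x by ring, map_mul]
  linear_combination (S.g χ⁻¹ * S.g (A * χ) * χ x * S.g (B * χ) * S.g (C⁻¹ * χ⁻¹)) *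
    chi_neg_one_sq χ

lemma jacobiS_two (A B : MulChar F ℂ) : jacobiS F ![A, B] = jacobiSum A B := by
  unfold jacobiS jacobiSum
  symm
  refine Finset.sum_bij (fun x _ => ![x, 1 - x]) ?_ ?_ ?_ ?_
  · intro x _; simp
  · intro x _ y _ h; simpa using congrFun h 0
  · intro v hv
    refine ⟨v 0, Finset.mem_univ _, ?_⟩
    simp only [Finset.mem_filter, Finset.mem_univ, true_and, Fin.sum_univ_two] at hv
    ext i
    fin_cases i
    · rfl
    · simp [← hv]
  · intro x _; simp

lemma gBinom_eq {A : MulChar F ℂ} (hA : A ≠ 1) (χ : MulChar F ℂ) :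
    gBinom F (A * χ) χ = χ (-1) / S.q * (S.g (A * χ) * S.g χ⁻¹ / S.g A) := by
  unfold gBinom
  rw [jacobiS_two, S.q_eq]
  congr 1
  have h := jacobiSum_mul_nontrivial (χ := A * χ) (φ := χ⁻¹) (by simpa using hA) S.ψ
  rw [mul_inv_cancel_right] at h
  rw [eq_div_iff (S.g_ne A), mul_comm]
  exact h

lemma four_f_three (x : F) :
    S.q ^ 5 * (S.q - 1) * greeneF F S.ω ![S.ρ, S.ρ ^ 2, S.ρ ^ 3, S.ρ ^ 4] ![1, 1, 1] x =
      ∑ χ : MulChar F ℂ, S.g χ⁻¹ ^ 4 * S.g (S.ρ * χ) * S.g (S.ρ ^ 2 * χ) * S.g (S.ρ ^ 3 * χ) *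
        S.g (S.ρ ^ 4 * χ) * χ x := by
  unfold greeneF
  have hs := S.sum_range_eq (fun χ => gBinom F (![S.ρ, S.ρ ^ 2, S.ρ ^ 3, S.ρ ^ 4] 0 * χ) χ *
        (∏ i : Fin 3, gBinom F (![S.ρ, S.ρ ^ 2, S.ρ ^ 3, S.ρ ^ 4] i.succ * χ)
          ((![1, 1, 1] : Fin 3 → MulChar F ℂ) i * χ)) * χ x)
  rw [hs, ← S.q_eq, Finset.mul_sum, Finset.mul_sum]
  refine Finset.sum_congr rfl fun χ _ => ?_
  have e : (∏ i : Fin 3, gBinom F (![S.ρ, S.ρ ^ 2, S.ρ ^ 3, S.ρ ^ 4] i.succ * χ)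
          ((![1, 1, 1] : Fin 3 → MulChar F ℂ) i * χ)) =
      gBinom F (S.ρ ^ 2 * χ) χ * gBinom F (S.ρ ^ 3 * χ) χ * gBinom F (S.ρ ^ 4 * χ) χ := by
    rw [Fin.prod_univ_three]
    simp [one_mul]
  rw [e]
  change S.q ^ 5 * (S.q - 1) * (S.q / (S.q - 1) * (gBinom F (S.ρ * χ) χ * _ * χ x)) = _
  rw [S.gBinom_eq S.rho_ne, S.gBinom_eq S.rho2_ne, S.gBinom_eq S.rho3_ne, S.gBinom_eq S.rho4_ne]
  have h14 := S.g14
  have h23 := S.g23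
  have hq := S.q_ne
  have hq1 := S.q_sub_ne
  have n1 := S.g_ne S.ρ
  have n2 := S.g_ne (S.ρ ^ 2)
  have e4 : S.g (S.ρ ^ 4) = S.q / S.g S.ρ := by rw [eq_div_iff n1, mul_comm, h14]
  have e3 : S.g (S.ρ ^ 3) = S.q / S.g (S.ρ ^ 2) := by rw [eq_div_iff n2, mul_comm, h23]
  have hc : χ (-1) ^ 4 = 1 := by
    rw [show χ (-1) ^ 4 = (χ (-1) * χ (-1)) ^ 2 by ring, chi_neg_one_sq, one_pow]
  rw [e4, e3]
  field_simp
  rw [hc]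
  ring

end Setup
end DworkFive
end

noncomputable section
namespace DworkFive

set_option linter.unusedSectionVars false
namespace Setup
variable {F : Type} [Field F] [Fintype F] (S : Setup F)

/-- The summand of the hypergeometric side. -/
def Rh (θ : MulChar F ℂ) : ℂ :=
  S.g θ ^ 4 * S.g (S.ρ * θ⁻¹) * S.g (S.ρ ^ 2 * θ⁻¹) * S.g (S.ρ ^ 3 * θ⁻¹) *
      S.g (S.ρ ^ 4 * θ⁻¹) / S.q ^ 2
    + 20 * (S.g θ * S.g (S.ρ ^ 2 * θ⁻¹) * S.g (S.ρ ^ 3 * θ⁻¹) * S.g θ)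
    + 20 * (S.g θ * S.g (S.ρ * θ⁻¹) * S.g (S.ρ ^ 4 * θ⁻¹) * S.g θ)
    + 30 * (S.g θ * S.g (S.ρ * θ⁻¹) * S.g (S.ρ ^ 3 * θ⁻¹) * S.g (S.ρ * θ))
    + 30 * (S.g θ * S.g (S.ρ * θ⁻¹) * S.g (S.ρ ^ 2 * θ⁻¹) * S.g (S.ρ ^ 2 * θ))

lemma sum_inv (f : MulChar F ℂ → ℂ) : ∑ θ, f θ⁻¹ = ∑ θ, f θ := by
  have h := Equiv.sum_comp (Equiv.inv (MulChar F ℂ)) f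
  simpa only [Equiv.inv_apply] using h

lemma inv_eval (S : Setup F) (θ : MulChar F ℂ) (lam : F) (hlam : lam ≠ 0) :
    θ⁻¹ (lam ^ 5)⁻¹ = (θ ^ 5) lam := by
  rw [chi_inv_apply, inv_inv, map_pow, pow_apply_of_ne _ _ hlam]

lemma two_f_one' {A B C : MulChar F ℂ} (hA : A ≠ 1) (hBC : B * C⁻¹ ≠ 1) (hB : B (-1) = 1)
    (hC : C (-1) = 1) (hg : S.g A * S.g (B * C⁻¹) = S.q) {lam : F} (hlam : lam ≠ 0) :
    S.q ^ 2 * greene2F1 F A B C (lam ^ 5)⁻¹ = (S.q - 1)⁻¹ * ∑ θ : MulChar F ℂ, (θ ^ 5) lam *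
      (S.g θ * S.g (A * θ⁻¹) * S.g (B * θ⁻¹) * S.g (C⁻¹ * θ)) := by
  have h := S.two_f_one hA hBC hB hC (inv_ne_zero (pow_ne_zero 5 hlam))
  rw [← sum_inv, hg] at h
  simp only [S.inv_eval _ lam hlam, inv_inv] at h
  rw [eq_inv_mul_iff_mul_eq₀ S.q_sub_ne]
  rw [Finset.sum_congr rfl fun θ _ => mul_comm _ _, ← h]
  ring

lemma four_f_three' {lam : F} (hlam : lam ≠ 0) :
    S.q ^ 3 * greeneF F S.ω ![S.ρ, S.ρ ^ 2, S.ρ ^ 3, S.ρ ^ 4] ![1, 1, 1] (lam ^ 5)⁻¹ =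
      (S.q - 1)⁻¹ * ∑ θ : MulChar F ℂ, (θ ^ 5) lam *
      (S.g θ ^ 4 * S.g (S.ρ * θ⁻¹) * S.g (S.ρ ^ 2 * θ⁻¹) * S.g (S.ρ ^ 3 * θ⁻¹) *
      S.g (S.ρ ^ 4 * θ⁻¹) / S.q ^ 2) := by
  have h := S.four_f_three (lam ^ 5)⁻¹
  rw [← sum_inv] at h
  simp only [S.inv_eval _ lam hlam, inv_inv] at h
  rw [eq_inv_mul_iff_mul_eq₀ S.q_sub_ne]
  have hq := S.q_ne
  simp only [mul_div_assoc', ← Finset.sum_div]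
  rw [eq_div_iff (pow_ne_zero 2 hq), Finset.sum_congr rfl fun θ _ => mul_comm _ _, ← h]
  ring

lemma hyper_total {lam : F} (hlam : lam ≠ 0) :
    S.q ^ 3 * greeneF F S.ω ![S.ρ, S.ρ ^ 2, S.ρ ^ 3, S.ρ ^ 4] ![1, 1, 1] (lam ^ 5)⁻¹ +
      20 * S.q ^ 2 * greene2F1 F (S.ρ ^ 2) (S.ρ ^ 3) 1 (lam ^ 5)⁻¹ +
      20 * S.q ^ 2 * greene2F1 F S.ρ (S.ρ ^ 4) 1 (lam ^ 5)⁻¹ +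
      30 * S.q ^ 2 * greene2F1 F S.ρ (S.ρ ^ 3) (S.ρ ^ 4) (lam ^ 5)⁻¹ +
      30 * S.q ^ 2 * greene2F1 F S.ρ (S.ρ ^ 2) (S.ρ ^ 3) (lam ^ 5)⁻¹ =
    (S.q - 1)⁻¹ * ∑ θ : MulChar F ℂ, (θ ^ 5) lam * S.Rh θ := by
  have o1 : (1 : MulChar F ℂ) (-1) = 1 := MulChar.one_apply (Ne.isUnit (by simp))
  have e1 : S.ρ ^ 3 * (S.ρ ^ 4)⁻¹ = S.ρ ^ 4 := by rw [S.rho4_inv, ← pow_succ]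
  have e2 : S.ρ ^ 2 * (S.ρ ^ 3)⁻¹ = S.ρ ^ 4 := by rw [S.rho3_inv, ← pow_add]
  have h1 := S.two_f_one' (A := S.ρ ^ 2) (B := S.ρ ^ 3) (C := 1) S.rho2_ne
    (by rw [inv_one, mul_one]; exact S.rho3_ne) (S.rho_pow_neg_one 3) o1
    (by rw [inv_one, mul_one]; exact S.g23) hlam
  have h2 := S.two_f_one' (A := S.ρ) (B := S.ρ ^ 4) (C := 1) S.rho_ne
    (by rw [inv_one, mul_one]; exact S.rho4_ne) (S.rho_pow_neg_one 4) o1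
    (by rw [inv_one, mul_one]; exact S.g14) hlam
  have h3 := S.two_f_one' (A := S.ρ) (B := S.ρ ^ 3) (C := S.ρ ^ 4) S.rho_ne
    (by rw [e1]; exact S.rho4_ne) (S.rho_pow_neg_one 3) (S.rho_pow_neg_one 4)
    (by rw [e1]; exact S.g14) hlam
  have h4 := S.two_f_one' (A := S.ρ) (B := S.ρ ^ 2) (C := S.ρ ^ 3) S.rho_ne
    (by rw [e2]; exact S.rho4_ne) (S.rho_pow_neg_one 2) (S.rho_pow_neg_one 3)
    (by rw [e2]; exact S.g14) hlam
  have h0 := S.four_f_three' hlam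
  rw [h0, mul_assoc 20, mul_assoc 20, mul_assoc 30, mul_assoc 30, h1, h2, h3, h4]
  simp only [inv_one, one_mul, S.rho4_inv, S.rho3_inv]
  simp only [mul_left_comm _ (S.q - 1)⁻¹, ← mul_add]
  congr 1
  simp only [Finset.mul_sum, ← Finset.sum_add_distrib]
  refine Finset.sum_congr rfl fun θ _ => ?_
  unfold Rh
  ring

lemma g_dual (θ τ σ : MulChar F ℂ) (hτ : τ * σ = 1) (hτ1 : σ (-1) = 1) (h : θ ≠ τ) :
    S.g (τ * θ⁻¹) = θ (-1) * S.q / S.g (θ * σ) := by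
  have e : τ * θ⁻¹ = (θ * σ)⁻¹ := by
    rw [mul_inv, eq_inv_of_mul_eq_one_left hτ, mul_comm]
  have hn : θ * σ ≠ 1 := by
    intro h'
    apply h
    rw [eq_inv_of_mul_eq_one_left hτ, eq_inv_of_mul_eq_one_left h']
  have := S.g_mul_inv hn
  rw [e, eq_div_iff (S.g_ne _), mul_comm, this, MulChar.mul_apply, hτ1, mul_one]

lemma Rh_generic (θ : MulChar F ℂ) (h1 : θ ≠ S.ρ) (h2 : θ ≠ S.ρ ^ 2) (h3 : θ ≠ S.ρ ^ 3)
    (h4 : θ ≠ S.ρ ^ 4) : S.Rh θ = S.q ^ 2 * (S.Bt θ / S.Ap θ) := by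
  have r := S.rho_five
  have d1 := S.g_dual θ S.ρ (S.ρ ^ 4) (by rw [← pow_succ', r]) (S.rho_pow_neg_one 4) h1
  have d2 := S.g_dual θ (S.ρ ^ 2) (S.ρ ^ 3) (by rw [← pow_add, r]) (S.rho_pow_neg_one 3) h2
  have d3 := S.g_dual θ (S.ρ ^ 3) (S.ρ ^ 2) (by rw [← pow_add, r]) (S.rho_pow_neg_one 2) h3
  have d4 := S.g_dual θ (S.ρ ^ 4) S.ρ (by rw [← pow_succ, r]) S.rho_neg_one h4
  unfold Rh Bt Ap Br
  rw [d1, d2, d3, d4, mul_comm S.ρ θ, mul_comm (S.ρ ^ 2) θ]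
  have n0 := S.g_ne θ
  have n1 := S.g_ne (θ * S.ρ)
  have n2 := S.g_ne (θ * S.ρ ^ 2)
  have n3 := S.g_ne (θ * S.ρ ^ 3)
  have n4 := S.g_ne (θ * S.ρ ^ 4)
  have hq := S.q_ne
  have hs : θ (-1) ^ 2 = 1 := by rw [pow_two, chi_neg_one_sq]
  have hs4 : θ (-1) ^ 4 = 1 := by rw [show θ (-1) ^ 4 = (θ (-1) ^ 2) ^ 2 by ring, hs, one_pow]
  generalize S.g θ = a0 at *
  generalize S.g (θ * S.ρ) = a1 at *
  generalize S.g (θ * S.ρ ^ 2) = a2 at *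
  generalize S.g (θ * S.ρ ^ 3) = a3 at *
  generalize S.g (θ * S.ρ ^ 4) = a4 at *
  generalize θ (-1) = c at *
  generalize S.q = Q at *
  clear d1 d2 d3 d4
  field_simp
  simp only [hs]
  ring

lemma exceptional : (S.q - 1) * Pz 0 (S.g S.ρ) (S.g (S.ρ ^ 2)) (S.g (S.ρ ^ 3)) (S.g (S.ρ ^ 4)) / S.q
    + ∑ i ∈ Finset.range 5,
      (S.q ^ 2 * (S.Bt (S.ρ ^ i) / S.Ap (S.ρ ^ i)) - S.Rh (S.ρ ^ i)) = 0 := by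
  have hz : S.Rh (S.ρ ^ 0) = S.q ^ 2 * (S.Bt (S.ρ ^ 0) / S.Ap (S.ρ ^ 0)) := by
    rw [pow_zero]
    exact S.Rh_generic 1 S.rho_ne.symm S.rho2_ne.symm S.rho3_ne.symm S.rho4_ne.symm
  simp only [Finset.sum_range_succ, Finset.sum_range_zero, zero_add]
  rw [hz, sub_self, pow_one]
  unfold Rh Bt Ap
  have r5 := S.rho_five
  have r6 : S.ρ ^ 6 = S.ρ := by rw [pow_succ, r5, one_mul]
  have r7 : S.ρ ^ 7 = S.ρ ^ 2 := by rw [pow_add S.ρ 5 2, r5, one_mul]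
  have r8 : S.ρ ^ 8 = S.ρ ^ 3 := by rw [pow_add S.ρ 5 3, r5, one_mul]
  simp only [S.rho_inv, S.rho2_inv, S.rho3_inv, S.rho4_inv]
  simp only [← pow_add, ← pow_succ, ← pow_succ']
  simp only [← pow_two]
  norm_num only
  simp only [r5, r6, r7, r8, S.g_one]
  have hq := S.q_ne
  have n1 := S.g_ne S.ρ
  have n2 := S.g_ne (S.ρ ^ 2)
  have e4 : S.g (S.ρ ^ 4) = S.q / S.g S.ρ := by rw [eq_div_iff n1, mul_comm, S.g14]
  have e3 : S.g (S.ρ ^ 3) = S.q / S.g (S.ρ ^ 2) := by rw [eq_div_iff n2, mul_comm, S.g23]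
  rw [e4, e3]
  clear e4 e3 hz
  generalize S.g S.ρ = a at *
  generalize S.g (S.ρ ^ 2) = b at *
  generalize S.q = Q at *
  unfold Pz Br
  field_simp
  ring

theorem main_count (lam : F) (hlam : lam ≠ 0) (hlam5 : lam ^ 5 ≠ 1) :
    (dworkCount F 5 lam : ℂ) = (S.q ^ 4 - 1) / (S.q - 1) +
      (S.q - 1)⁻¹ * ∑ θ : MulChar F ℂ, (θ ^ 5) lam * S.Rh θ := by
  have hc := S.count_two lam hlam hlam5
  rw [S.naff_eq_proj] at hc
  have hx := S.exceptional
  have hs := S.sum_torsion (fun θ => S.q ^ 2 * (S.Bt θ / S.Ap θ) - S.Rh θ)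
  have hd : ∑ θ : MulChar F ℂ, (if θ ^ 5 = 1 then S.q ^ 2 * (S.Bt θ / S.Ap θ) - S.Rh θ else 0) =
      S.q ^ 2 * ∑ θ : MulChar F ℂ, (θ ^ 5) lam * (S.Bt θ / S.Ap θ) -
        ∑ θ : MulChar F ℂ, (θ ^ 5) lam * S.Rh θ := by
    rw [Finset.mul_sum, ← Finset.sum_sub_distrib]
    refine Finset.sum_congr rfl fun θ _ => ?_
    split_ifs with h
    · rw [h, MulChar.one_apply hlam.isUnit]; ring
    · have hk : ∀ k : ℕ, θ ≠ S.ρ ^ k := by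
        rintro k rfl
        apply h
        rw [← pow_mul, mul_comm, pow_mul, S.rho_five, one_pow]
      rw [S.Rh_generic θ (by simpa using hk 1) (hk 2) (hk 3) (hk 4)]
      ring
  rw [← hs, hd] at hx
  have hq := S.q_ne
  have hq1 := S.q_sub_ne
  generalize ∑ θ : MulChar F ℂ, (θ ^ 5) lam * (S.Bt θ / S.Ap θ) = X at *
  generalize ∑ θ : MulChar F ℂ, (θ ^ 5) lam * S.Rh θ = Y at *
  generalize Pz 0 (S.g S.ρ) (S.g (S.ρ ^ 2)) (S.g (S.ρ ^ 3)) (S.g (S.ρ ^ 4)) = P at *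
  field_simp at hx ⊢
  have : S.q * ((S.q - 1) * (dworkCount F 5 lam : ℂ)) = S.q * (S.q ^ 4 - 1 + Y) := by
    linear_combination hc + hx
  exact mul_left_cancel₀ hq this

end Setup
end DworkFive
end
/-- Goodson's formula for the number of rational points on the Dwork hypersurface of
degree five. -/
theorem dwork_five_point_count (p e q t : ℕ) [Fact p.Prime] (F : Type) [Field F] [Fintype F]
    (he : 0 < e) (hq : q = Fintype.card F) (hqe : q = p ^ e) (hmod : q % 5 = 1)
    (ht : t = (q - 1) / 5)
    (ω : MulChar F ℂ) (hω : ∀ χ : MulChar F ℂ, ∃ j : ℕ, χ = ω ^ j)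
    (lam : F) (hlam : lam ≠ 0) (hlam5 : lam ^ 5 ≠ 1) :
    (dworkCount F 5 lam : ℂ) =
      ((q : ℂ) ^ 4 - 1) / ((q : ℂ) - 1) +
      (q : ℂ) ^ 3 *
        greeneF F ω ![ω ^ t, ω ^ (2 * t), ω ^ (3 * t), ω ^ (4 * t)] ![1, 1, 1] (lam ^ 5)⁻¹ +
      20 * (q : ℂ) ^ 2 * greene2F1 F (ω ^ (2 * t)) (ω ^ (3 * t)) 1 (lam ^ 5)⁻¹ +
      20 * (q : ℂ) ^ 2 * greene2F1 F (ω ^ t) (ω ^ (4 * t)) 1 (lam ^ 5)⁻¹ +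
      30 * (q : ℂ) ^ 2 * greene2F1 F (ω ^ t) (ω ^ (3 * t)) (ω ^ (4 * t)) (lam ^ 5)⁻¹ +
      30 * (q : ℂ) ^ 2 * greene2F1 F (ω ^ t) (ω ^ (2 * t)) (ω ^ (3 * t)) (lam ^ 5)⁻¹ := by
  have hcard : Fintype.card F = 5 * t + 1 := by omega
  let S : DworkFive.Setup F :=
    { t := t, ht := hcard, ω := ω, hω := hω,
      ψ := AddChar.FiniteField.primitiveChar_to_Complex F,
      hψ := AddChar.FiniteField.primitiveChar_to_Complex_isPrimitive F }
  have hm := S.main_count lam hlam hlam5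
  rw [← S.hyper_total hlam] at hm
  have e1 : S.ρ = ω ^ t := rfl
  have e2 : S.ρ ^ 2 = ω ^ (2 * t) := by rw [e1, ← pow_mul, mul_comm]
  have e3 : S.ρ ^ 3 = ω ^ (3 * t) := by rw [e1, ← pow_mul, mul_comm]
  have e4 : S.ρ ^ 4 = ω ^ (4 * t) := by rw [e1, ← pow_mul, mul_comm]
  have eq : S.q = (q : ℂ) := by rw [hq]; rfl
  rw [e2, e3, e4, e1, eq] at hm
  rw [hm]
  ring
end

section
/- (Hasse–Davenport product relation) Let m be a positive integer and q a power of a prime with q ≡ 1 (mod m). For every multiplicative character χ of 𝔽_q of exact order m and every multiplicative character ψ of 𝔽_q, one has ∏_{i=0}^{m-1} g(χ^i·ψ) = −g(ψ^m)·ψ^{-m}(m)·∏_{i=0}^{m-1} g(χ^i). -/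
open scoped Classical

namespace HD
open Polynomial

/-- monic polynomials of degree `n` form a finite set -/
theorem finite_monics (F : Type) [Field F] [Fintype F] (n : ℕ) :
    {f : F[X] | f.Monic ∧ f.natDegree = n}.Finite := by
  have : Finite (Fin (n+1) → F) := inferInstance
  refine Set.Finite.of_finite_image (f := fun f : F[X] => fun i : Fin (n+1) => f.coeff i)
    (Set.toFinite _) ?_
  intro f hf g hg h
  ext i
  by_cases hi : i < n + 1
  · exact congrFun h ⟨i, hi⟩
  · rw [coeff_eq_zero_of_natDegree_lt, coeff_eq_zero_of_natDegree_lt]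
    · have := hg.2; omega
    · have := hf.2; omega

noncomputable def D (F : Type) [Field F] [Fintype F] (n : ℕ) : Finset F[X] :=
  (finite_monics F n).toFinset

theorem mem_D {F : Type} [Field F] [Fintype F] {n : ℕ} {f : F[X]} :
    f ∈ D F n ↔ f.Monic ∧ f.natDegree = n := by simp [D]

noncomputable def Irr (F : Type) [Field F] [Fintype F] (n : ℕ) : Finset F[X] :=
  (D F n).filter Irreducible

theorem mem_Irr {F : Type} [Field F] [Fintype F] {n : ℕ} {f : F[X]} :
    f ∈ Irr F n ↔ (f.Monic ∧ f.natDegree = n) ∧ Irreducible f := by simp [Irr, mem_D]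

theorem normalize_monic {F : Type} [Field F] {f : F[X]} (hf : f.Monic) : normalize f = f :=
  hf.normalize_eq_self

theorem sum_pow_dvd {F : Type} [Field F] {n : ℕ} {f P : F[X]} (hf : f.Monic)
    (hn : f.natDegree = n) (hP : P.Monic) (hi : Irreducible P) :
    ∑ j ∈ Finset.Icc 1 n, (if P ^ j ∣ f then 1 else 0) =
      (UniqueFactorizationMonoid.normalizedFactors f).count P := by
  have key : ∀ j, P ^ j ∣ f ↔ j ≤ (UniqueFactorizationMonoid.normalizedFactors f).count P := by
    intro j
    have := UniqueFactorizationMonoid.emultiplicity_eq_count_normalizedFactors hi hf.ne_zero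
    rw [hP.normalize_eq_self] at this
    rw [pow_dvd_iff_le_emultiplicity, this]
    simp
  have hle : (UniqueFactorizationMonoid.normalizedFactors f).count P ≤ n := by
    have h := (key _).2 le_rfl
    have h2 := natDegree_le_of_dvd h hf.ne_zero
    rw [natDegree_pow, hn] at h2
    have := hi.natDegree_pos
    nlinarith
  simp only [key]
  rw [← Finset.sum_filter, Finset.sum_const, smul_eq_mul, mul_one]
  have : (Finset.Icc 1 n).filter (fun j => j ≤ (UniqueFactorizationMonoid.normalizedFactors f).count P) = Finset.Icc 1 ((UniqueFactorizationMonoid.normalizedFactors f).count P) := by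
    ext j; simp; omega
  rw [this]; simp

theorem degree_count {F : Type} [Field F] [Fintype F] {n : ℕ} {f : F[X]} (hf : f ∈ D F n) :
    n = ∑ d ∈ Finset.Icc 1 n, ∑ P ∈ Irr F d, ∑ j ∈ Finset.Icc 1 n, (if P ^ j ∣ f then d else 0) := by
  rw [mem_D] at hf
  obtain ⟨hf, hn⟩ := hf
  have h1 : ∀ d ∈ Finset.Icc 1 n, ∀ P ∈ Irr F d, ∑ j ∈ Finset.Icc 1 n, (if P ^ j ∣ f then d else 0)
      = (UniqueFactorizationMonoid.normalizedFactors f).count P * P.natDegree := by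
    intro d _ P hP
    rw [mem_Irr] at hP
    rw [← sum_pow_dvd hf hn hP.1.1 hP.2, Finset.sum_mul]
    refine Finset.sum_congr rfl fun j _ => ?_
    rw [hP.1.2]; split_ifs <;> simp
  rw [Finset.sum_congr rfl fun d hd => Finset.sum_congr rfl (h1 d hd)]
  rw [← Finset.sum_biUnion]
  swap
  · intro a _ b _ hab
    rw [Function.onFun, Finset.disjoint_left]
    intro P hP hP'
    rw [mem_Irr] at hP hP'
    exact hab (hP.1.2.symm.trans hP'.1.2)
  have hprod : (UniqueFactorizationMonoid.normalizedFactors f).prod = f := by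
    have := UniqueFactorizationMonoid.prod_normalizedFactors_eq hf.ne_zero
    rw [this, hf.normalize_eq_self]
  have h2 : n = ((UniqueFactorizationMonoid.normalizedFactors f).map natDegree).sum := by
    rw [← hn, ← natDegree_multiset_prod, hprod]
    exact UniqueFactorizationMonoid.zero_notMem_normalizedFactors f
  rw [Finset.sum_multiset_map_count] at h2
  conv_lhs => rw [h2]
  refine Finset.sum_subset ?_ ?_
  · intro P hP
    rw [Multiset.mem_toFinset] at hP
    have hirr := UniqueFactorizationMonoid.irreducible_of_normalized_factor P hP
    have hmon : P.Monic := by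
      have := UniqueFactorizationMonoid.normalize_normalized_factor P hP
      rw [← this]; exact monic_normalize hirr.ne_zero
    rw [Finset.mem_biUnion]
    refine ⟨P.natDegree, ?_, mem_Irr.2 ⟨⟨hmon, rfl⟩, hirr⟩⟩
    rw [Finset.mem_Icc]
    refine ⟨hirr.natDegree_pos, ?_⟩
    rw [← hn]
    exact natDegree_le_of_dvd (UniqueFactorizationMonoid.dvd_of_mem_normalizedFactors hP) hf.ne_zero
  · intro P _ hP
    rw [Multiset.mem_toFinset, ← Multiset.count_eq_zero] at hP
    simp [hP]

noncomputable def cS {F : Type} [Field F] [Fintype F] (Λ : F[X] → ℂ) (n : ℕ) : ℂ := ∑ f ∈ D F n, Λ f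

noncomputable def pP {F : Type} [Field F] [Fintype F] (Λ : F[X] → ℂ) (k : ℕ) : ℂ :=
  ∑ x ∈ Nat.divisorsAntidiagonal k, ∑ P ∈ Irr F x.1, (x.1 : ℂ) * Λ P ^ x.2

theorem lam_pow {F : Type} [Field F] (Λ : F[X] → ℂ) (h1 : Λ 1 = 1)
    (hmul : ∀ f g : F[X], f.Monic → g.Monic → Λ (f * g) = Λ f * Λ g) {P : F[X]} (hP : P.Monic)
    (j : ℕ) : Λ (P ^ j) = Λ P ^ j := by
  induction j with
  | zero => simp [h1]
  | succ j ih => rw [pow_succ, hmul _ _ (hP.pow j) hP, ih, pow_succ]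

theorem sum_dvd {F : Type} [Field F] [Fintype F] (Λ : F[X] → ℂ)
    (hmul : ∀ f g : F[X], f.Monic → g.Monic → Λ (f * g) = Λ f * Λ g) {g : F[X]} (hg : g.Monic)
    (n : ℕ) : ∑ f ∈ D F n, (if g ∣ f then Λ f else 0) =
      if g.natDegree ≤ n then Λ g * cS Λ (n - g.natDegree) else 0 := by
  split_ifs with h
  · rw [← Finset.sum_filter, cS, Finset.mul_sum]
    symm
    refine Finset.sum_bij (fun f _ => g * f) ?_ ?_ ?_ ?_
    · intro f hf
      rw [mem_D] at hf
      rw [Finset.mem_filter, mem_D]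
      refine ⟨⟨hg.mul hf.1, ?_⟩, dvd_mul_right _ _⟩
      rw [hg.natDegree_mul hf.1]; omega
    · intro a _ b _ hab
      exact mul_left_cancel₀ hg.ne_zero hab
    · intro f hf
      rw [Finset.mem_filter, mem_D] at hf
      obtain ⟨⟨h1, h2⟩, e, rfl⟩ := hf
      have he : e.Monic := hg.of_mul_monic_left h1
      refine ⟨e, mem_D.2 ⟨he, ?_⟩, rfl⟩
      rw [hg.natDegree_mul he] at h2; omega
    · intro f hf
      rw [hmul _ _ hg (mem_D.1 hf).1]
  · refine Finset.sum_eq_zero fun f hf => if_neg fun hd => h ?_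
    rw [mem_D] at hf
    rw [← hf.2]
    exact natDegree_le_of_dvd hd hf.1.ne_zero

theorem newton_rec {F : Type} [Field F] [Fintype F] (Λ : F[X] → ℂ) (h1 : Λ 1 = 1)
    (hmul : ∀ f g : F[X], f.Monic → g.Monic → Λ (f * g) = Λ f * Λ g) (n : ℕ) :
    (n : ℂ) * cS Λ n = ∑ k ∈ Finset.Icc 1 n, pP Λ k * cS Λ (n - k) := by
  have e1 : (n : ℂ) * cS Λ n = ∑ d ∈ Finset.Icc 1 n, ∑ P ∈ Irr F d, ∑ j ∈ Finset.Icc 1 n,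
      (d : ℂ) * ∑ f ∈ D F n, (if P ^ j ∣ f then Λ f else 0) := by
    rw [cS, Finset.mul_sum]
    have : ∀ f ∈ D F n, (n : ℂ) * Λ f = ∑ d ∈ Finset.Icc 1 n, ∑ P ∈ Irr F d, ∑ j ∈ Finset.Icc 1 n,
      (d : ℂ) * (if P ^ j ∣ f then Λ f else 0) := by
      intro f hf
      conv_lhs => rw [degree_count hf]
      push_cast
      simp only [Finset.sum_mul]
      refine Finset.sum_congr rfl fun d _ => Finset.sum_congr rfl fun P _ => Finset.sum_congr rfl fun j _ => ?_
      split_ifs <;> simp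
    rw [Finset.sum_congr rfl this]
    rw [Finset.sum_comm]
    refine Finset.sum_congr rfl fun d _ => ?_
    rw [Finset.sum_comm]
    refine Finset.sum_congr rfl fun P _ => ?_
    rw [Finset.sum_comm]
    refine Finset.sum_congr rfl fun j _ => ?_
    rw [Finset.mul_sum]
  have e2 : ∀ d ∈ Finset.Icc 1 n, ∀ P ∈ Irr F d, ∀ j ∈ Finset.Icc 1 n, 
      (d : ℂ) * ∑ f ∈ D F n, (if P ^ j ∣ f then Λ f else 0) = 
       if d * j ≤ n then (d : ℂ) * Λ P ^ j * cS Λ (n - d * j) else 0 := by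
    intro d _ P hP j _
    rw [mem_Irr] at hP
    rw [sum_dvd Λ hmul (hP.1.1.pow j), lam_pow Λ h1 hmul hP.1.1, natDegree_pow, hP.1.2, mul_comm j d]
    split_ifs
    · ring
    · simp
  rw [e1, Finset.sum_congr rfl fun d hd => Finset.sum_congr rfl fun P hP => Finset.sum_congr rfl (e2 d hd P hP)]
  have e3 : ∀ d ∈ Finset.Icc 1 n, ∑ P ∈ Irr F d, ∑ j ∈ Finset.Icc 1 n,
      (if d * j ≤ n then (d : ℂ) * Λ P ^ j * cS Λ (n - d * j) else 0) =
      ∑ j ∈ Finset.Icc 1 n, if d * j ≤ n then ∑ P ∈ Irr F d, (d : ℂ) * Λ P ^ j * cS Λ (n - d * j) else 0 := by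
    intro d _
    rw [Finset.sum_comm]
    refine Finset.sum_congr rfl fun j _ => ?_
    split_ifs <;> simp
  rw [Finset.sum_congr rfl e3]
  simp only [pP, Finset.sum_mul]
  rw [← Finset.sum_product', ← Finset.sum_filter,
    Finset.sum_sigma' (Finset.Icc 1 n) (fun k => Nat.divisorsAntidiagonal k)]
  refine Finset.sum_bij' (fun x _ => ⟨x.1 * x.2, x⟩) (fun x _ => x.2) ?_ ?_ ?_ ?_ ?_
  · rintro ⟨d, j⟩ h
    simp only [Finset.mem_filter, Finset.mem_product, Finset.mem_Icc, Finset.mem_sigma, Nat.mem_divisorsAntidiagonal] at h ⊢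
    have : 0 < d * j := Nat.mul_pos (by omega) (by omega)
    exact ⟨⟨by omega, h.2⟩, trivial, by omega⟩
  · rintro ⟨k, d, j⟩ h
    simp only [Finset.mem_filter, Finset.mem_product, Finset.mem_Icc, Finset.mem_sigma, Nat.mem_divisorsAntidiagonal] at h ⊢
    obtain ⟨⟨h1, h2⟩, rfl, h4⟩ := h
    have hd : 0 < d := Nat.pos_of_ne_zero (by rintro rfl; simp at h4)
    have hj : 0 < j := Nat.pos_of_ne_zero (by rintro rfl; simp at h4)
    refine ⟨⟨⟨hd, ?_⟩, hj, ?_⟩, h2⟩ <;> nlinarith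
  · rintro ⟨d, j⟩ h; rfl
  · rintro ⟨k, d, j⟩ h
    simp only [Finset.mem_sigma, Nat.mem_divisorsAntidiagonal] at h
    obtain ⟨_, rfl, _⟩ := h
    rfl
  · rintro ⟨d, j⟩ h; rfl

end HD

namespace HD
open Polynomial

theorem ps_unique (A B S : PowerSeries ℂ) (hA : PowerSeries.X * PowerSeries.derivative ℂ A = S * A)
    (hB : PowerSeries.X * PowerSeries.derivative ℂ B = S * B) (hS : PowerSeries.coeff 0 S = 0)
    (h0 : PowerSeries.coeff 0 A = PowerSeries.coeff 0 B) : A = B := by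
  ext n
  induction n using Nat.strong_induction_on with
  | _ n ih =>
    rcases n with _ | n
    · exact h0
    have ha := congrArg (PowerSeries.coeff (n+1)) hA
    have hb := congrArg (PowerSeries.coeff (n+1)) hB
    rw [PowerSeries.coeff_succ_X_mul, PowerSeries.coeff_derivative, PowerSeries.coeff_mul] at ha hb
    have : ∑ p ∈ Finset.HasAntidiagonal.antidiagonal (n+1), PowerSeries.coeff p.1 S * PowerSeries.coeff p.2 A =
      ∑ p ∈ Finset.HasAntidiagonal.antidiagonal (n+1), PowerSeries.coeff p.1 S * PowerSeries.coeff p.2 B := by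
      refine Finset.sum_congr rfl ?_
      rintro ⟨i, j⟩ hij
      rw [Finset.HasAntidiagonal.mem_antidiagonal] at hij
      rcases Nat.eq_zero_or_pos i with rfl | hi
      · simp only [hS, zero_mul]
      · simp only; rw [ih j (by simp only at hij; omega)]
    rw [← ha, ← hb] at this
    have hn : (n : ℂ) + 1 ≠ 0 := by exact_mod_cast Nat.succ_ne_zero n
    exact mul_right_cancel₀ hn this

theorem ps_prod {ι : Type*} (s : Finset ι) (A S : ι → PowerSeries ℂ)
    (h : ∀ i ∈ s, PowerSeries.X * PowerSeries.derivative ℂ (A i) = S i * A i) :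
    PowerSeries.X * PowerSeries.derivative ℂ (∏ i ∈ s, A i) = (∑ i ∈ s, S i) * ∏ i ∈ s, A i := by
  induction s using Finset.induction_on with
  | empty => simp
  | insert a s ha ih =>
    rw [Finset.prod_insert ha, Finset.sum_insert ha, Derivation.leibniz, smul_eq_mul, smul_eq_mul,
      mul_add]
    have h1 := h a (Finset.mem_insert_self _ _)
    have h2 := ih fun i hi => h i (Finset.mem_insert_of_mem hi)
    linear_combination A a * h2 + (∏ i ∈ s, A i) * h1

theorem ps_of_rec (c p : ℕ → ℂ)
    (h : ∀ n : ℕ, (n : ℂ) * c n = ∑ k ∈ Finset.Icc 1 n, p k * c (n - k)) :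
    PowerSeries.X * PowerSeries.derivative ℂ (PowerSeries.mk c) =
      PowerSeries.mk (fun k => if k = 0 then 0 else p k) * PowerSeries.mk c := by
  ext n
  rw [PowerSeries.coeff_mul n (PowerSeries.mk _), Finset.Nat.sum_antidiagonal_eq_sum_range_succ_mk]
  simp only [PowerSeries.coeff_mk]
  have e : ∑ k ∈ Finset.range n.succ, (if k = 0 then 0 else p k) * c (n - k) = (n : ℂ) * c n := by
    rw [h, Finset.sum_range_eq_add_Ico _ (Nat.succ_pos n)]
    simp only [if_true, zero_mul, zero_add]
    have : Finset.Ico 1 n.succ = Finset.Icc 1 n := by ext; simp [Nat.lt_succ_iff]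
    rw [this]
    refine Finset.sum_congr rfl fun k hk => ?_
    rw [Finset.mem_Icc] at hk
    rw [if_neg (by omega)]
  rw [e]
  rcases n with _ | n
  · simp
  · rw [PowerSeries.coeff_succ_X_mul, PowerSeries.coeff_derivative]
    simp; ring

theorem coeff_prod_linear (m : ℕ) (g : ℕ → ℂ) :
    PowerSeries.coeff m (∏ i ∈ Finset.range m, (1 + PowerSeries.C (g i) * PowerSeries.X)) =
      ∏ i ∈ Finset.range m, g i := by
  have h : (∏ i ∈ Finset.range m, (1 + PowerSeries.C (g i) * PowerSeries.X)) =
     ((∏ i ∈ Finset.range m, (1 + Polynomial.C (g i) * Polynomial.X) : ℂ[X]) : PowerSeries ℂ) := by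
    rw [← Polynomial.coeToPowerSeries.ringHom_apply, map_prod]
    simp
  rw [h, Polynomial.coeff_coe]
  have := Polynomial.coeff_prod_of_natDegree_le (Finset.range m) (fun i => (1 + Polynomial.C (g i) * Polynomial.X : ℂ[X])) 1 (by
    intro i _
    compute_degree)
  simp only [Finset.card_range, mul_one] at this
  rw [this]
  refine Finset.prod_congr rfl fun i _ => ?_
  simp [Polynomial.coeff_one]

theorem coeff_eq_of_rec (m : ℕ) (c p : ℕ → ℂ) (P : ℕ → ℕ → ℂ) (C : ℕ → ℕ → ℂ)
    (h : ∀ n : ℕ, (n : ℂ) * c n = ∑ k ∈ Finset.Icc 1 n, p k * c (n - k))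
    (h' : ∀ i, ∀ n : ℕ, (n : ℂ) * C i n = ∑ k ∈ Finset.Icc 1 n, P i k * C i (n - k))
    (h0 : c 0 = 1) (h0' : ∀ i, C i 0 = 1) (h2 : ∀ i n, 2 ≤ n → C i n = 0)
    (hs : ∀ k, 1 ≤ k → p k = ∑ i ∈ Finset.range m, P i k) : c m = ∏ i ∈ Finset.range m, C i 1 := by
  have hA := ps_of_rec c p h
  have hB := ps_prod (Finset.range m) _ _ (fun i _ => ps_of_rec (C i) (P i) (h' i))
  have hS : (∑ i ∈ Finset.range m, PowerSeries.mk (fun k => if k = 0 then 0 else P i k)) =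
      PowerSeries.mk (fun k => if k = 0 then 0 else p k) := by
    ext k
    rw [map_sum]
    simp only [PowerSeries.coeff_mk]
    split_ifs with hk
    · simp
    · rw [hs k (by omega)]
  rw [hS] at hB
  have := ps_unique _ _ _ hA hB (by simp) (by
    simp only [PowerSeries.coeff_zero_eq_constantCoeff, map_prod]
    simp only [← PowerSeries.coeff_zero_eq_constantCoeff_apply, PowerSeries.coeff_mk, h0, h0']
    simp)
  have e : ∀ i, PowerSeries.mk (C i) = 1 + PowerSeries.C (C i 1) * PowerSeries.X := by
    intro i
    ext n
    rcases n with _ | _ | n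
    · simp [h0' i]
    · simp [PowerSeries.coeff_one]
    · simp [PowerSeries.coeff_one, PowerSeries.coeff_X, h2 i]
  simp only [e] at this
  rw [← coeff_prod_linear, ← this, PowerSeries.coeff_mk]

/-- power sums -/
noncomputable def LS {F : Type*} [Field F] (f : F[X]) : PowerSeries F :=
  - (PowerSeries.X * PowerSeries.derivative F (f.reverse : PowerSeries F)) *
    (f.reverse : PowerSeries F)⁻¹

noncomputable def pS {F : Type*} [Field F] (m : ℕ) (f : F[X]) : F := PowerSeries.coeff m (LS f)

theorem cc_rev {F : Type*} [Field F] {f : F[X]} (hf : f.Monic) :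
    PowerSeries.constantCoeff (f.reverse : PowerSeries F) = 1 := by
  rw [← PowerSeries.coeff_zero_eq_constantCoeff_apply, Polynomial.coeff_coe, coeff_zero_reverse,
    hf.leadingCoeff]

theorem rev_ne {F : Type*} [Field F] {f : F[X]} (hf : f.Monic) :
    (f.reverse : PowerSeries F) ≠ 0 := by
  intro h
  have := cc_rev hf
  rw [h] at this; simp at this

theorem LS_mul_rev {F : Type*} [Field F] {f : F[X]} (hf : f.Monic) :
    LS f * (f.reverse : PowerSeries F) =
      - (PowerSeries.X * PowerSeries.derivative F (f.reverse : PowerSeries F)) := by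
  rw [LS, mul_assoc, PowerSeries.inv_mul_cancel, mul_one]
  rw [cc_rev hf]; exact one_ne_zero

theorem LS_unique {F : Type*} [Field F] {f : F[X]} (hf : f.Monic) {S : PowerSeries F}
    (h : S * (f.reverse : PowerSeries F) =
      - (PowerSeries.X * PowerSeries.derivative F (f.reverse : PowerSeries F))) : S = LS f :=
  mul_right_cancel₀ (rev_ne hf) (h.trans (LS_mul_rev hf).symm)

theorem LS_mul {F : Type*} [Field F] {f g : F[X]} (hf : f.Monic) (hg : g.Monic) :
    LS (f * g) = LS f + LS g := by
  symm
  apply LS_unique (hf.mul hg)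
  rw [reverse_mul_of_domain, Polynomial.coe_mul, Derivation.leibniz, smul_eq_mul, smul_eq_mul]
  linear_combination (g.reverse : PowerSeries F) * LS_mul_rev hf + (f.reverse : PowerSeries F) * LS_mul_rev hg

theorem LS_one {F : Type*} [Field F] : LS (1 : F[X]) = 0 := by
  symm; apply LS_unique monic_one
  have : (1 : F[X]).reverse = 1 := by rw [← C_1, reverse_C]
  rw [this]; simp

theorem LS_map {F E : Type*} [Field F] [Field E] (φ : F →+* E) {f : F[X]} (hf : f.Monic) :
    LS (f.map φ) = (LS f).map φ := by
  symm; apply LS_unique (hf.map φ)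
  have h : ((f.map φ).reverse : PowerSeries E) = PowerSeries.map φ (f.reverse : PowerSeries F) := by
    rw [← Polynomial.polynomial_map_coe, reverse, reverse, reflect_map, natDegree_map]
  have hd : PowerSeries.derivative E (PowerSeries.map φ (f.reverse : PowerSeries F)) =
     PowerSeries.map φ (PowerSeries.derivative F (f.reverse : PowerSeries F)) := by
    ext n
    simp [PowerSeries.coeff_derivative]
  rw [h, hd, ← map_mul, LS_mul_rev hf]
  simp

theorem LS_X_sub_C {F : Type*} [Field F] (r : F) :
    LS (X - C r) = PowerSeries.mk (fun k => if k = 0 then 0 else r ^ k) := by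
  symm; apply LS_unique (monic_X_sub_C r)
  have h : ((X - C r : F[X]).reverse : PowerSeries F) = 1 - PowerSeries.C r * PowerSeries.X := by
    have : (X - C r : F[X]).reverse = 1 - C r * X := by
      have h1 : (X - C r : F[X]) = C 1 * X ^ 1 + C (-r) * X ^ 0 := by simp [sub_eq_add_neg]
      rw [reverse, natDegree_X_sub_C, h1, reflect_add, reflect_C_mul_X_pow, reflect_C_mul_X_pow,
        revAt_le le_rfl, revAt_le (by omega)]
      simp [sub_eq_add_neg]
    rw [this]; simp
  rw [h]
  ext n
  rcases n with _ | n
  · simp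
  · rw [mul_sub, mul_one, ← mul_assoc, map_sub, PowerSeries.coeff_succ_mul_X, mul_comm _ (PowerSeries.C r),
      PowerSeries.coeff_C_mul, map_neg, PowerSeries.coeff_succ_X_mul, PowerSeries.coeff_derivative]
    rcases n with _ | n
    · simp [PowerSeries.coeff_one]
    · simp [PowerSeries.coeff_one, PowerSeries.coeff_X]; ring

theorem LS_prod {F : Type*} [Field F] (s : Multiset F) :
    LS ((s.map (fun r => X - C r)).prod) = (s.map (fun r => LS (X - C r))).sum := by
  induction s using Multiset.induction_on with
  | empty => simp [LS_one]
  | cons a s ih =>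
    simp only [Multiset.map_cons, Multiset.prod_cons, Multiset.sum_cons]
    rw [LS_mul (monic_X_sub_C a) (monic_multiset_prod_of_monic _ _ fun r _ => monic_X_sub_C r), ih]

theorem pS_shift {F : Type*} [Field F] {f : F[X]} (hf : f.Monic) {m : ℕ} (hm : 1 ≤ m)
    (hmn : m ≤ f.natDegree) (b : F) :
    pS m (f + C b * X ^ (f.natDegree - m)) = pS m f - m * b := by
  have hdeg : (C b * X ^ (f.natDegree - m)).degree < f.degree := by
    refine (degree_C_mul_X_pow_le _ _).trans_lt ?_
    rw [degree_eq_natDegree hf.ne_zero]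
    exact_mod_cast (by omega : f.natDegree - m < f.natDegree)
  have hg : (f + C b * X ^ (f.natDegree - m)).Monic := hf.add_of_left hdeg
  have hnd : (f + C b * X ^ (f.natDegree - m)).natDegree = f.natDegree :=
    natDegree_eq_of_degree_eq (degree_add_eq_left_of_degree_lt hdeg)
  have hrev : (f + C b * X ^ (f.natDegree - m)).reverse = f.reverse + C b * X ^ m := by
    rw [reverse, reverse, hnd, reflect_add, reflect_C_mul_X_pow, revAt_le (by omega)]
    congr 3; omega
  set g := f + C b * X ^ (f.natDegree - m) with hgdef
  have e1 := LS_mul_rev hf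
  have e2 := LS_mul_rev hg
  rw [hrev] at e2
  have hD : PowerSeries.X * PowerSeries.derivative F ((C b * X ^ m : F[X]) : PowerSeries F) =
      PowerSeries.C (m * b) * PowerSeries.X ^ m := by
    rw [Polynomial.coe_mul, Polynomial.coe_C, Polynomial.coe_pow, Polynomial.coe_X,
      Derivation.leibniz, Derivation.leibniz_pow]
    obtain ⟨k, rfl⟩ : ∃ k, m = k + 1 := ⟨m - 1, by omega⟩
    simp [PowerSeries.derivative_C]
    ring
  rw [Polynomial.coe_add, map_add, mul_add, mul_add, hD] at e2
  have e3 : (LS g - LS f) * (f.reverse : PowerSeries F) = - PowerSeries.C (m * b) * PowerSeries.X ^ m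
      - LS g * ((C b * X ^ m : F[X]) : PowerSeries F) := by
    linear_combination e2 - e1
  have hg0 : PowerSeries.constantCoeff (LS g) = 0 := by
    simp [LS]
  have e4 : (LS g - LS f) = (f.reverse : PowerSeries F)⁻¹ * (- PowerSeries.C (m * b) - LS g * PowerSeries.C b) * PowerSeries.X ^ m := by
    have : (f.reverse : PowerSeries F) * (f.reverse : PowerSeries F)⁻¹ = 1 := 
      PowerSeries.mul_inv_cancel _ (by rw [cc_rev hf]; exact one_ne_zero)
    rw [Polynomial.coe_mul, Polynomial.coe_C, Polynomial.coe_pow, Polynomial.coe_X] at e3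
    linear_combination (f.reverse : PowerSeries F)⁻¹ * e3 - (LS g - LS f) * this
  have e5 := congrArg (PowerSeries.coeff m) e4
  rw [map_sub, PowerSeries.coeff_mul_X_pow', if_pos le_rfl, Nat.sub_self] at e5
  simp only [PowerSeries.coeff_zero_eq_constantCoeff, map_mul, map_sub, map_neg, PowerSeries.constantCoeff_inv, cc_rev hf, hg0] at e5
  simp at e5
  rw [pS, pS]
  linear_combination e5
end HD

namespace HD
open Polynomial IntermediateField

noncomputable def Lam {F : Type} [Field F] (ψ : MulChar F ℂ) (Ψ : AddChar F ℂ) (m : ℕ) (f : F[X]) : ℂ :=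
  ψ ((-1) ^ f.natDegree * f.coeff 0) * Ψ (pS m f)

theorem Lam_one {F : Type} [Field F] (ψ : MulChar F ℂ) (Ψ : AddChar F ℂ) (m : ℕ) :
    Lam ψ Ψ m 1 = 1 := by
  simp [Lam, pS, LS_one]

theorem Lam_mul {F : Type} [Field F] (ψ : MulChar F ℂ) (Ψ : AddChar F ℂ) (m : ℕ) (f g : F[X])
    (hf : f.Monic) (hg : g.Monic) : Lam ψ Ψ m (f * g) = Lam ψ Ψ m f * Lam ψ Ψ m g := by
  simp only [Lam, pS, LS_mul hf hg, map_add, AddChar.map_add_eq_mul, hf.natDegree_mul hg,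
    mul_coeff_zero]
  have : ((-1 : F) ^ (f.natDegree + g.natDegree) * (f.coeff 0 * g.coeff 0)) =
    ((-1) ^ f.natDegree * f.coeff 0) * ((-1) ^ g.natDegree * g.coeff 0) := by ring
  rw [this, map_mul]; ring

theorem pS_roots {F E : Type*} [Field F] [Field E] [Algebra F E] {f : F[X]} (hf : f.Monic)
    (hs : (f.map (algebraMap F E)).Splits) {m : ℕ} (hm : 1 ≤ m) :
    algebraMap F E (pS m f) = ((f.aroots E).map (fun r => r ^ m)).sum := by
  have h1 : algebraMap F E (pS m f) = pS m (f.map (algebraMap F E)) := by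
    rw [pS, pS, LS_map _ hf, PowerSeries.coeff_map]
  have h2 := hs.eq_prod_roots_of_monic (hf.map _)
  rw [h1, pS, h2, LS_prod]
  rw [map_multiset_sum, Multiset.map_map]
  congr 1
  refine Multiset.map_congr rfl fun r _ => ?_
  simp [LS_X_sub_C, show m ≠ 0 by omega]

theorem trace_pow_eq {F K : Type} [Field F] [Fintype F] [Field K] [Fintype K] [Algebra F K] (x : K)
    {m : ℕ} (hm : 1 ≤ m) :
    Algebra.trace F K (x ^ m) = Module.finrank F⟮x⟯ K • pS m (minpoly F x) := by
  have hx : IsIntegral F x := Algebra.IsIntegral.isIntegral x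
  have h1 : Algebra.trace F K (x ^ m) =
      Module.finrank F⟮x⟯ K • Algebra.trace F F⟮x⟯ (AdjoinSimple.gen F x ^ m) := by
    rw [← Algebra.trace_trace (S := F⟮x⟯)]
    have : x ^ m = algebraMap F⟮x⟯ K (AdjoinSimple.gen F x ^ m) := by
      rw [map_pow, AdjoinSimple.algebraMap_gen]
    rw [this, Algebra.trace_algebraMap, map_nsmul]
  rw [h1]
  congr 1
  let E := AlgebraicClosure F
  apply FaithfulSMul.algebraMap_injective F E
  rw [pS_roots (minpoly.monic hx) (IsAlgClosed.splits _) hm, trace_eq_sum_embeddings E]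
  simp only [map_pow]
  let pb := adjoin.powerBasis hx
  have hgen : pb.gen = AdjoinSimple.gen F x := adjoin.powerBasis_gen hx
  have hmin : minpoly F pb.gen = minpoly F x := by rw [hgen, minpoly_gen]
  have hsep : (minpoly F pb.gen).Separable := by
    rw [hmin]; exact Algebra.IsSeparable.isSeparable F x
  rw [← hmin, ← hgen]
  rw [Fintype.sum_equiv pb.liftEquiv' (fun σ : F⟮x⟯ →ₐ[F] E => σ pb.gen ^ m) (fun y => (y : E) ^ m)]
  · rw [Finset.sum_mem_multiset _ _ (fun y : E => y ^ m) (fun y => rfl), Finset.sum_eq_multiset_sum, Multiset.toFinset_val,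
      Multiset.dedup_eq_self.mpr]
    exact nodup_roots ((separable_map _).mpr hsep)
  · intro σ
    simp [PowerBasis.liftEquiv']

theorem Lam_minpoly {F K : Type} [Field F] [Fintype F] [Field K] [Fintype K] [Algebra F K]
    (ψ : MulChar F ℂ) (Ψ : AddChar F ℂ) (x : K) {m : ℕ} (hm : 1 ≤ m) :
    Lam ψ Ψ m (minpoly F x) ^ (Module.finrank F K / (minpoly F x).natDegree) =
      ψ (Algebra.norm F x) * Ψ (Algebra.trace F K (x ^ m)) := by
  have hx : IsIntegral F x := Algebra.IsIntegral.isIntegral x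
  have hd : Module.finrank F K / (minpoly F x).natDegree = Module.finrank F⟮x⟯ K := by
    rw [← Module.finrank_mul_finrank F F⟮x⟯ K, adjoin.finrank hx,
      Nat.mul_div_cancel_left _ (minpoly.natDegree_pos hx)]
  rw [hd, trace_pow_eq x hm, Algebra.norm_eq_norm_adjoin, AddChar.map_nsmul_eq_pow, map_pow, ← mul_pow]
  congr 1
  rw [Lam]
  congr 2
  have := Algebra.PowerBasis.norm_gen_eq_coeff_zero_minpoly (adjoin.powerBasis hx)
  rw [adjoin.powerBasis_gen hx, minpoly_gen, adjoin.powerBasis_dim] at this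
  rw [this]

theorem card_fiber {F K : Type} [Field F] [Fintype F] [Field K] [Fintype K] [Algebra F K] {P : F[X]}
    (hP : P.Monic) (hi : Irreducible P) (hd : P.natDegree ∣ Module.finrank F K) :
    (Finset.univ.filter (fun x : K => minpoly F x = P)).card = P.natDegree := by
  have hsep : P.Separable := PerfectField.separable_of_irreducible hi
  have hsplit : (P.map (algebraMap F K)).Splits := by
    have h := hi.natDegree_dvd_iff_dvd_X_pow_card_pow_sub_X.1 hd
    rw [← Module.natCard_eq_pow_finrank, Nat.card_eq_fintype_card] at h
    have h2 := (FiniteField.isSplittingField_sub K F).splits'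
    refine h2.of_dvd ?_ (Polynomial.map_dvd _ h)
    rw [Polynomial.map_ne_zero_iff (algebraMap F K).injective]
    exact FiniteField.X_pow_card_sub_X_ne_zero F Fintype.one_lt_card
  rw [← card_rootSet_eq_natDegree hsep hsplit, ← Set.toFinset_card]
  congr 1
  ext x
  simp only [Finset.mem_filter, Finset.mem_univ, true_and, Set.mem_toFinset, mem_rootSet]
  constructor
  · rintro rfl
    exact ⟨hi.ne_zero, minpoly.aeval _ _⟩
  · rintro ⟨_, h⟩
    exact (minpoly.eq_of_irreducible_of_monic hi h hP).symm

theorem pP_eq {F K : Type} [Field F] [Fintype F] [Field K] [Fintype K] [Algebra F K] (Λ : F[X] → ℂ) :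
    pP Λ (Module.finrank F K) =
     ∑ x : K, Λ (minpoly F x) ^ (Module.finrank F K / (minpoly F x).natDegree) := by
  have hpos : 0 < Module.finrank F K := Module.finrank_pos
  set k := Module.finrank F K with hk
  have hdisj : ((Nat.divisors k : Set ℕ)).PairwiseDisjoint (fun d => Irr F d) := by
    intro a _ b _ hab
    rw [Function.onFun, Finset.disjoint_left]
    intro P hP hP'
    rw [mem_Irr] at hP hP'
    exact hab (hP.1.2.symm.trans hP'.1.2)
  have hmem : ∀ x ∈ (Finset.univ : Finset K), minpoly F x ∈ (Nat.divisors k).biUnion (fun d => Irr F d) := by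
    intro x _
    have hx : IsIntegral F x := Algebra.IsIntegral.isIntegral x
    rw [Finset.mem_biUnion]
    refine ⟨(minpoly F x).natDegree, ?_, mem_Irr.2 ⟨⟨minpoly.monic hx, rfl⟩, minpoly.irreducible hx⟩⟩
    rw [Nat.mem_divisors]
    exact ⟨minpoly.degree_dvd hx, hpos.ne'⟩
  rw [← Finset.sum_fiberwise_of_maps_to hmem, Finset.sum_biUnion hdisj, pP,
    Nat.sum_divisorsAntidiagonal (fun d j => ∑ P ∈ Irr F d, (d : ℂ) * Λ P ^ j)]
  refine Finset.sum_congr rfl fun d hd => Finset.sum_congr rfl fun P hP => ?_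
  rw [mem_Irr] at hP
  rw [Nat.mem_divisors] at hd
  have h1 : ∀ x ∈ Finset.univ.filter (fun x : K => minpoly F x = P),
      Λ (minpoly F x) ^ (k / (minpoly F x).natDegree) = Λ P ^ (k / d) := by
    intro x hx
    rw [Finset.mem_filter] at hx
    rw [hx.2, hP.1.2]
  rw [Finset.sum_congr rfl h1, Finset.sum_const, card_fiber hP.1.1 hP.2 (by rw [hP.1.2]; exact hd.1),
    hP.1.2, nsmul_eq_mul]

end HD

namespace HD
open Polynomial

theorem cS_zero {F : Type} [Field F] [Fintype F] (ψ : MulChar F ℂ) (Ψ : AddChar F ℂ) (m : ℕ) :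
    cS (Lam ψ Ψ m) 0 = 1 := by
  have : D F 0 = {1} := by
    ext f
    rw [mem_D, Finset.mem_singleton]
    constructor
    · rintro ⟨h1, h2⟩
      exact h1.natDegree_eq_zero.1 h2
    · rintro rfl
      exact ⟨monic_one, natDegree_one⟩
  rw [cS, this, Finset.sum_singleton, Lam_one]

theorem cS_one {F : Type} [Field F] [Fintype F] (ψ : MulChar F ℂ) (Ψ : AddChar F ℂ) :
    cS (Lam ψ Ψ 1) 1 = gaussSum ψ Ψ := by
  rw [cS, gaussSum]
  symm
  refine Finset.sum_bij (fun a _ => X - C a) ?_ ?_ ?_ ?_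
  · intro a _
    exact mem_D.2 ⟨monic_X_sub_C a, natDegree_X_sub_C a⟩
  · intro a _ b _ h
    exact C_injective (sub_right_injective h)
  · intro f hf
    rw [mem_D] at hf
    refine ⟨- f.coeff 0, Finset.mem_univ _, ?_⟩
    rw [hf.1.eq_X_add_C hf.2]
    simp
  · intro a _
    simp [Lam, pS, LS_X_sub_C]

theorem mem_D_shift {F : Type} [Field F] [Fintype F] {n j : ℕ} {f : F[X]} (hf : f ∈ D F n)
    (hj : j < n) (b : F) : f + C b * X ^ j ∈ D F n := by
  rw [mem_D] at hf ⊢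
  have hdeg : (C b * X ^ j).degree < f.degree := by
    refine (degree_C_mul_X_pow_le _ _).trans_lt ?_
    rw [degree_eq_natDegree hf.1.ne_zero, hf.2]
    exact_mod_cast hj
  exact ⟨hf.1.add_of_left hdeg, (natDegree_eq_of_degree_eq (degree_add_eq_left_of_degree_lt hdeg)).trans hf.2⟩

theorem pS_shift' {F : Type} [Field F] [Fintype F] {n m j : ℕ} {f : F[X]} (hf : f ∈ D F n)
    (hm : 1 ≤ m) (hj : j + m = n) (b : F) : pS m (f + C b * X ^ j) = pS m f - m * b := by
  rw [mem_D] at hf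
  have := pS_shift hf.1 hm (by rw [hf.2]; omega) b
  rwa [hf.2, show n - m = j by omega] at this

theorem cS_two {F : Type} [Field F] [Fintype F] (ψ : MulChar F ℂ) (Ψ : AddChar F ℂ) (hΨ : Ψ ≠ 1)
    (n : ℕ) (hn : 2 ≤ n) : cS (Lam ψ Ψ 1) n = 0 := by
  obtain ⟨a, ha⟩ := (AddChar.ne_one_iff).1 hΨ
  have h : cS (Lam ψ Ψ 1) n = cS (Lam ψ Ψ 1) n * Ψ a := by
    conv_lhs => rw [cS]
    rw [cS, Finset.sum_mul]
    refine Finset.sum_bij' (fun f _ => f + C a * X ^ (n - 1)) (fun f _ => f + C (-a) * X ^ (n - 1)) ?_ ?_ ?_ ?_ ?_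
    · intro f hf; exact mem_D_shift hf (by omega) a
    · intro f hf; exact mem_D_shift hf (by omega) _
    · intro f hf; simp
    · intro f hf; simp
    · intro f hf
      have h1 := mem_D_shift hf (by omega : n - 1 < n) a
      rw [Lam, Lam, pS_shift' hf le_rfl (by omega), (mem_D.1 hf).2, (mem_D.1 h1).2]
      rw [mul_assoc, ← AddChar.map_add_eq_mul]
      congr 2
      · simp [coeff_X_pow]; intro h; omega
      · simp
  have h2 : cS (Lam ψ Ψ 1) n * (1 - Ψ a) = 0 := by linear_combination h
  rcases mul_eq_zero.1 h2 with h3 | h3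
  · exact h3
  · exact absurd (by linear_combination -h3) ha

theorem cS_top {F : Type} [Field F] [Fintype F] (Ψ : AddChar F ℂ) (m : ℕ) (hm : 1 ≤ m)
    (hmF : (m : F) ≠ 0) : ∃ c : ℂ, ∀ ψ : MulChar F ℂ,
      cS (Lam (ψ ^ m) Ψ m) m = c * ((ψ ^ m)⁻¹ (m : F) * gaussSum (ψ ^ m) Ψ) := by
  refine ⟨∑ f ∈ (D F m).filter (fun f => f.coeff 0 = 0), Ψ (pS m f), fun ψ => ?_⟩
  have e1 : cS (Lam (ψ ^ m) Ψ m) m = ∑ x ∈ (D F m).filter (fun f => f.coeff 0 = 0) ×ˢ (Finset.univ : Finset F),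
      Ψ (pS m x.1) * ((ψ ^ m) ((-1) ^ m * x.2) * Ψ (- (m * x.2))) := by
    rw [cS]
    refine Finset.sum_bij' (fun f _ => (f + C (- f.coeff 0) * X ^ 0, f.coeff 0)) (fun x _ => x.1 + C x.2 * X ^ 0) ?_ ?_ ?_ ?_ ?_
    · intro f hf
      simp only [Finset.mem_product, Finset.mem_filter, Finset.mem_univ, and_true]
      exact ⟨mem_D_shift hf (by omega) _, by simp⟩
    · rintro ⟨f, b⟩ hf
      simp only [Finset.mem_product, Finset.mem_filter, Finset.mem_univ, and_true] at hf
      exact mem_D_shift hf.1 (by omega) _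
    · intro f hf; simp
    · rintro ⟨f, b⟩ hf
      simp only [Finset.mem_product, Finset.mem_filter, Finset.mem_univ, and_true] at hf
      simp [hf.2]
    · intro f hf
      simp only
      rw [pS_shift' hf hm (by omega), Lam, (mem_D.1 hf).2]
      have : pS m f = (pS m f - m * (- f.coeff 0)) + - (m * f.coeff 0) := by ring
      conv_lhs => rw [this, AddChar.map_add_eq_mul]
      ring
  rw [e1, Finset.sum_product]
  simp only [← Finset.mul_sum]
  rw [← Finset.sum_mul]
  congr 1
  have e2 : ∀ b : F, (ψ ^ m) ((-1) ^ m * b) = (ψ ^ m)⁻¹ (m : F) * (ψ ^ m) (-(m * b)) := by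
    intro b
    have h1 : (-1 : F) ^ m * b = (-1) ^ (m + 1) * ((m : F)⁻¹ * (-(m * b))) := by
      field_simp; ring
    rw [h1, map_mul, map_mul, MulChar.inv_apply']
    have h2 : (ψ ^ m) ((-1) ^ (m + 1)) = 1 := by
      rw [MulChar.pow_apply' _ (by omega), ← map_pow, ← pow_mul, mul_comm,
        (Nat.even_mul_succ_self m).neg_one_pow, map_one]
    rw [h2, one_mul]
  simp only [e2, mul_assoc]
  rw [← Finset.mul_sum, gaussSum]
  congr 1
  refine Fintype.sum_bijective (fun b => -((m : F) * b)) ?_ _ _ (fun b => rfl)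
  exact (neg_involutive.bijective).comp (mulLeft_bijective₀ _ hmF)

theorem card_roots {F K : Type} [Field F] [Fintype F] [Field K] [Fintype K] [Algebra F K]
    (χ : MulChar F ℂ) (m : ℕ) (hm : 0 < m) (hχ : orderOf χ = m) (t : K) (ht : t ≠ 0) :
    ((Finset.univ.filter (fun x : K => x ^ m = t)).card : ℂ) =
      ∑ i ∈ Finset.range m, χ (Algebra.norm F t) ^ i := by
  obtain ⟨g, hg⟩ := IsCyclic.exists_generator (α := Kˣ)
  set N : Kˣ →* Fˣ := Units.map (Algebra.norm F (S := K)) with hN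
  have hsurj : Function.Surjective N := FiniteField.unitsMap_norm_surjective F K
  have hχm : χ ^ m = 1 := by rw [← hχ]; exact pow_orderOf_eq_one χ
  have hprim : IsPrimitiveRoot (χ (N g : F)) m := by
    refine ⟨?_, fun l hl => ?_⟩
    · rw [← MulChar.pow_apply_coe, hχm, MulChar.one_apply_coe]
    · rw [← hχ]
      apply orderOf_dvd_of_pow_eq_one
      ext u
      obtain ⟨v, rfl⟩ := hsurj u
      obtain ⟨j, rfl⟩ := (mem_powers_iff_mem_zpowers.2 (hg v) )
      rw [MulChar.pow_apply_coe, MulChar.one_apply_coe]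
      simp only [map_pow, Units.val_pow_eq_pow_val]
      rw [← pow_mul, mul_comm, pow_mul, hl, one_pow]
  have hdvd : m ∣ orderOf g := by
    apply hprim.dvd_of_pow_eq_one
    rw [← map_pow, ← Units.val_pow_eq_pow_val, ← map_pow, pow_orderOf_eq_one]
    simp
  obtain ⟨s, hs⟩ := hdvd
  have hK : IsPrimitiveRoot ((g : K) ^ s) m := by
    have h1 : IsPrimitiveRoot (g : K) (orderOf g) := (IsPrimitiveRoot.orderOf g).map_of_injective (f := Units.coeHom K) Units.val_injective
    exact h1.pow (orderOf_pos g) (by rw [hs, mul_comm])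
  have hcard : (Finset.univ.filter (fun x : K => x ^ m = t)).card = if ∃ α, α ^ m = t then m else 0 := by
    have h := hK.card_nthRoots t
    rw [← Multiset.toFinset_card_of_nodup (hK.nthRoots_nodup ht)] at h
    have h' : (Finset.univ.filter (fun x : K => x ^ m = t)) = (nthRoots m t).toFinset := by
      ext x
      simp [mem_nthRoots hm]
    rw [h']
    convert h
  rw [hcard]
  split_ifs with h
  · obtain ⟨α, rfl⟩ := h
    have hα : α ≠ 0 := by rintro rfl; exact ht (zero_pow hm.ne')
    have : χ (Algebra.norm F (α ^ m)) = 1 := by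
      rw [map_pow, map_pow, ← MulChar.pow_apply' _ hm.ne', hχm,
        MulChar.one_apply (IsUnit.mk0 _ (Algebra.norm_ne_zero_iff.2 hα))]
    simp only [this, one_pow]
    simp
  · have h1 : χ (Algebra.norm F t) ≠ 1 := by
      intro h1
      apply h
      obtain ⟨j, hj⟩ := (mem_powers_iff_mem_zpowers.2 (hg (Units.mk0 t ht)))
      have hj' : t = (g : K) ^ j := by
        have := congrArg Units.val hj
        simpa using this.symm
      have h2 : χ (Algebra.norm F t) = χ (N g : F) ^ j := by
        rw [hj', map_pow, map_pow]; rfl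
      rw [h2] at h1
      obtain ⟨r, rfl⟩ := hprim.dvd_of_pow_eq_one _ h1
      exact ⟨(g : K) ^ r, by rw [hj', ← pow_mul, mul_comm]⟩
    have h2 : χ (Algebra.norm F t) ^ m = 1 := by
      rw [← MulChar.pow_apply' _ hm.ne', hχm,
        MulChar.one_apply (IsUnit.mk0 _ (Algebra.norm_ne_zero_iff.2 ht))]
    rw [geom_sum_eq h1, h2]
    simp

theorem sum_split {F K : Type} [Field F] [Fintype F] [Field K] [Fintype K] [Algebra F K]
    (χ ψ : MulChar F ℂ) (Ψ : AddChar F ℂ) (m : ℕ) (hm : 0 < m) (hχ : orderOf χ = m) :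
    ∑ x : K, (ψ ^ m) (Algebra.norm F x) * Ψ (Algebra.trace F K (x ^ m)) =
     ∑ i ∈ Finset.range m, ∑ x : K, (χ ^ i * ψ) (Algebra.norm F x) * Ψ (Algebra.trace F K (x ^ 1)) := by
  rw [Finset.sum_comm]
  have e1 : ∀ x : K, (ψ ^ m) (Algebra.norm F x) * Ψ (Algebra.trace F K (x ^ m)) =
     ψ (Algebra.norm F (x ^ m)) * Ψ (Algebra.trace F K (x ^ m)) := by
    intro x
    rw [MulChar.pow_apply' _ hm.ne', map_pow (Algebra.norm F), map_pow ψ]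
  simp only [e1]
  rw [← Finset.sum_fiberwise (s := Finset.univ) (g := fun x : K => x ^ m)]
  refine Finset.sum_congr rfl fun t _ => ?_
  have e2 : ∀ x ∈ Finset.univ.filter (fun x : K => x ^ m = t), 
     ψ (Algebra.norm F (x ^ m)) * Ψ (Algebra.trace F K (x ^ m)) = ψ (Algebra.norm F t) * Ψ (Algebra.trace F K t) := by
    intro x hx
    rw [(Finset.mem_filter.1 hx).2]
  rw [Finset.sum_congr rfl e2, Finset.sum_const, nsmul_eq_mul]
  by_cases ht : t = 0
  · subst ht
    simp [Algebra.norm_zero, MulChar.map_zero]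
  · rw [card_roots χ m hm hχ t ht, Finset.sum_mul]
    refine Finset.sum_congr rfl fun i _ => ?_
    have hu : IsUnit (Algebra.norm F t) := IsUnit.mk0 _ (Algebra.norm_ne_zero_iff.2 ht)
    obtain ⟨u, hu⟩ := hu
    rw [← hu, MulChar.mul_apply, MulChar.pow_apply_coe, pow_one]
    ring

theorem prod_eq {F : Type} [Field F] [Fintype F] (p : ℕ) [Fact p.Prime] [CharP F p]
    (χ ψ : MulChar F ℂ) (Ψ : AddChar F ℂ) (hΨ : Ψ ≠ 1) (m : ℕ) (hm : 0 < m) (hχ : orderOf χ = m) :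
    cS (Lam (ψ ^ m) Ψ m) m = ∏ i ∈ Finset.range m, gaussSum (χ ^ i * ψ) Ψ := by
  have := coeff_eq_of_rec m (cS (Lam (ψ ^ m) Ψ m)) (pP (Lam (ψ ^ m) Ψ m))
    (fun i => pP (Lam (χ ^ i * ψ) Ψ 1)) (fun i => cS (Lam (χ ^ i * ψ) Ψ 1))
    (newton_rec _ (Lam_one _ _ _) (Lam_mul _ _ _))
    (fun i => newton_rec _ (Lam_one _ _ _) (Lam_mul _ _ _)) (cS_zero _ _ _) (fun i => cS_zero _ _ _)
    (fun i n hn => cS_two _ _ hΨ n hn) ?_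
  · rw [this]
    exact Finset.prod_congr rfl fun i _ => cS_one _ _
  · intro k hk
    haveI : NeZero k := ⟨by omega⟩
    let K := FiniteField.Extension F p k
    letI : Fintype K := Fintype.ofFinite K
    have hfin : Module.finrank F K = k := FiniteField.finrank_extension F p k
    have e : ∀ (φ : MulChar F ℂ) (l : ℕ), 1 ≤ l → pP (Lam φ Ψ l) k =
       ∑ x : K, φ (Algebra.norm F x) * Ψ (Algebra.trace F K (x ^ l)) := by
      intro φ l hl
      conv_lhs => rw [← hfin]
      rw [pP_eq (K := K)]
      exact Finset.sum_congr rfl fun x _ => Lam_minpoly φ Ψ x hl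
    simp only [e _ _ le_rfl, e _ _ (show 1 ≤ m from hm)]
    exact sum_split χ ψ Ψ m hm hχ

theorem main {F : Type} [Field F] [Fintype F] (p : ℕ) [Fact p.Prime] [CharP F p]
    (χ ψ : MulChar F ℂ) (Ψ : AddChar F ℂ) (hΨ : Ψ ≠ 1) (m : ℕ) (hm : 0 < m) (hχ : orderOf χ = m)
    (hmF : (m : F) ≠ 0) :
    ∏ i ∈ Finset.range m, gaussSum (χ ^ i * ψ) Ψ =
      - gaussSum (ψ ^ m) Ψ * (ψ ^ (-(m : ℤ))) (m : F) * ∏ i ∈ Finset.range m, gaussSum (χ ^ i) Ψ := by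
  obtain ⟨c, hc⟩ := cS_top Ψ m hm hmF
  have h1 := prod_eq p χ ψ Ψ hΨ m hm hχ
  have h2 := prod_eq p χ 1 Ψ hΨ m hm hχ
  rw [hc] at h1 h2
  simp only [mul_one, one_pow, inv_one, gaussSum_one_left hΨ, MulChar.one_apply (IsUnit.mk0 _ hmF)] at h2
  rw [← h1, ← h2, zpow_neg, zpow_natCast]
  ring

end HD

/-- The Hasse–Davenport product relation. -/
theorem hasse_davenport_product (p e m : ℕ) [Fact p.Prime] (F : Type) [Field F] [Fintype F]
    [Algebra (ZMod p) F] (he : 0 < e) (hcard : Fintype.card F = p ^ e)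
    (hm : 0 < m) (hqm : (Fintype.card F : ZMod m) = 1)
    (χ ψ : MulChar F ℂ) (hχ : orderOf χ = m) :
    ∏ i ∈ Finset.range m, gaussChar p F (χ ^ i * ψ) =
      -gaussChar p F (ψ ^ m) * (ψ ^ (-(m : ℤ))) ((m : F)) *
        ∏ i ∈ Finset.range m, gaussChar p F (χ ^ i) := by
  haveI : CharP F p := charP_of_injective_algebraMap (algebraMap (ZMod p) F).injective p
  let Ψ : AddChar F ℂ := (ZMod.stdAddChar (N := p)).compAddMonoidHom
    (Algebra.trace (ZMod p) F).toAddMonoidHom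
  have hΨa : ∀ x, Ψ x = ZMod.stdAddChar (Algebra.trace (ZMod p) F x) := fun x => rfl
  have hg : ∀ φ : MulChar F ℂ, gaussChar p F φ = gaussSum φ Ψ := by
    intro φ
    rw [gaussChar, gaussSum]
    refine Finset.sum_congr rfl fun x _ => ?_
    rw [hΨa]
    have h := ZMod.stdAddChar_coe (N := p) ((Algebra.trace (ZMod p) F x).val : ℤ)
    rw [Int.cast_natCast, ZMod.natCast_zmod_val] at h
    rw [h]
    push_cast
    rfl
  have hΨ : Ψ ≠ 1 := by
    rw [AddChar.ne_one_iff]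
    obtain ⟨x, hx⟩ := Algebra.trace_surjective (ZMod p) F 1
    refine ⟨x, ?_⟩
    rw [hΨa, hx]
    intro h
    rw [← AddChar.map_zero_eq_one (ZMod.stdAddChar (N := p))] at h
    exact one_ne_zero (ZMod.injective_stdAddChar h)
  have hmF : (m : F) ≠ 0 := by
    rw [Ne, CharP.cast_eq_zero_iff F p]
    intro hdvd
    have h1 : ((Fintype.card F : ℕ) : ZMod m) = ((1 : ℕ) : ZMod m) := by simpa using hqm
    rw [ZMod.natCast_eq_natCast_iff] at h1
    have h2 : Fintype.card F ≡ 1 [MOD p] := h1.of_dvd hdvd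
    have h3 : p ∣ Fintype.card F := by rw [hcard]; exact dvd_pow_self p he.ne'
    have h4 : 1 ≡ 0 [MOD p] := h2.symm.trans ((Nat.modEq_zero_iff_dvd).2 h3)
    exact (Fact.out : p.Prime).one_lt.ne' (Nat.dvd_one.1 ((Nat.modEq_zero_iff_dvd).1 h4))
  simp only [hg]
  exact HD.main p χ ψ Ψ hΨ m hm hχ hmF
end
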